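/- arXiv:2406.07326 — 3 statements merged into one kernel-verified Lean document; each statement's English description precedes it below -/
import Mathlib

section
/- Let q ≥ 7 be a prime power, F a finite field with q^2 elements, and G ∈ F[x_0,...,x_4] a nonzero homogeneous polynomial of degree 3. Then |V(G)(F) ∩ V_3| = 3(q^5 + q^2) + q^3 + 1 holds if and only if there exist a nonzero scalar c ∈ F and linear forms L_1, L_2, L_3 ∈ F[x_0,...,x_4] with G = c·L_1·L_2·L_3 such that the hyperplanes Σ_i = V(L_i)(F) (i = 1,2,3) are pairwise distinct, none of them is tangent to V_3, the intersection Σ_1 ∩ Σ_2 ∩ Σ_3 is a plane Π of ℙ^4(F), and |Π ∩ V_3| = q^3 + 1. -/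
open MvPolynomial

noncomputable section

/-- The projective space ℙ⁴(F): 1-dimensional F-linear subspaces of F⁵. -/
abbrev P4 (F : Type) [Field F] := Projectivization F (Fin 5 → F)

/-- The non-degenerate Hermitian threefold
    V₃ = {[x] ∈ ℙ⁴(F) : x₀^{q+1} + ⋯ + x₄^{q+1} = 0}. -/
def hermV3 (q : ℕ) (F : Type) [Field F] : Set (P4 F) :=
  {x | ∑ i, x.rep i ^ (q + 1) = 0}

/-- V(G)(F) = {[x] ∈ ℙ⁴(F) : G(x) = 0}, for G homogeneous this is well defined. -/
def VG {F : Type} [Field F] (G : MvPolynomial (Fin 5) F) : Set (P4 F) :=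
  {x | eval x.rep G = 0}

/-- The set of points of ℙ⁴(F) contained in an F-linear subspace of F⁵ of dimension k. -/
def IsLinSub (F : Type) [Field F] (k : ℕ) (S : Set (P4 F)) : Prop :=
  ∃ W : Submodule F (Fin 5 → F), Module.finrank F W = k ∧
    S = {x : P4 F | x.submodule ≤ W}

/-- A line of ℙ⁴(F). -/
def IsLine (F : Type) [Field F] (S : Set (P4 F)) : Prop := IsLinSub F 2 S

/-- A plane of ℙ⁴(F). -/
def IsPlane (F : Type) [Field F] (S : Set (P4 F)) : Prop := IsLinSub F 3 S

/-- A hyperplane of ℙ⁴(F). -/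
def IsHyperplane (F : Type) [Field F] (S : Set (P4 F)) : Prop := IsLinSub F 4 S

/-- The tangent hyperplane T_P(V₃) = {[x] : a₀^q x₀ + ⋯ + a₄^q x₄ = 0} where P = [a]. -/
def tangentHyp (q : ℕ) {F : Type} [Field F] (P : P4 F) : Set (P4 F) :=
  {x | ∑ i, P.rep i ^ q * x.rep i = 0}

/-- A subset of ℙ⁴(F) is a tangent hyperplane to V₃ if it equals T_P(V₃) for some P ∈ V₃. -/
def IsTangentHyp (q : ℕ) {F : Type} [Field F] (S : Set (P4 F)) : Prop :=
  ∃ P ∈ hermV3 q F, S = tangentHyp q P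

namespace HermitianCubic

open scoped Classical Finset

/-- The properties of `q` and `F` used below: `F` has `q ^ 2` elements, `7 ≤ q`, and `a ↦ a ^ q` is
additive. -/
structure IsHermField (q : ℕ) (F : Type) [Field F] [Fintype F] : Prop where
  le : 7 ≤ q
  card : Fintype.card F = q ^ 2
  add_pow : ∀ a b : F, (a + b) ^ q = a ^ q + b ^ q

lemma IsHermField.of_isPrimePow {q : ℕ} (hq : IsPrimePow q) (hq7 : 7 ≤ q) {F : Type} [Field F]
    [Fintype F] (hF : Fintype.card F = q ^ 2) : IsHermField q F := by
  refine ⟨hq7, hF, fun a b => ?_⟩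
  obtain ⟨p, k, hp, hk, rfl⟩ := hq
  have : Fact p.Prime := ⟨hp.nat_prime⟩
  have : CharP F p := charP_of_card_eq_prime_pow (f := k * 2) (by
    rw [hF, pow_mul])
  exact add_pow_char_pow a b p k

/-- If all fibres of `f : s → t` have at most `c` elements and `s` has `c * n ≥ c * #t` elements,
then all fibres have exactly `c` elements. -/
lemma card_fiber_eq {α β : Type*} {s : Finset α} {t : Finset β} (f : α → β)
    (hf : ∀ a ∈ s, f a ∈ t) (c n : ℕ) (hc : ∀ b ∈ t, #{a ∈ s | f a = b} ≤ c) (ht : #t ≤ n)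
    (hs : c * n ≤ #s) {b : β} (hb : b ∈ t) : #{a ∈ s | f a = b} = c := by
  by_contra hne
  have hlt : #s < ∑ _b ∈ t, c := by
    rw [Finset.card_eq_sum_card_fiberwise (f := f) (t := t) hf]
    exact Finset.sum_lt_sum hc ⟨b, hb, lt_of_le_of_ne (hc b hb) hne⟩
  rw [Finset.sum_const, smul_eq_mul] at hlt
  nlinarith [Nat.mul_le_mul_right c ht]

lemma card_roots_le {F : Type} [Field F] [Fintype F] {p : Polynomial F} (hp : p ≠ 0) {n : ℕ}
    (hn : p.natDegree ≤ n) : #{t : F | p.eval t = 0} ≤ n := by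
  have h : ({t : F | p.eval t = 0} : Finset F) ⊆ p.roots.toFinset := by
    intro t ht
    simpa [hp] using ht
  exact (Finset.card_le_card h).trans ((Multiset.toFinset_card_le _).trans
    ((Polynomial.card_roots' p).trans hn))

section Field

variable {q : ℕ} {F : Type} [Field F] [Fintype F] (h : IsHermField q F)
include h

lemma IsHermField.pos : 0 < q := by have := h.le; omega

lemma IsHermField.ne_zero : q ≠ 0 := h.pos.ne'

lemma IsHermField.pow_pow (a : F) : (a ^ q) ^ q = a := by
  rw [← pow_mul, ← sq, ← h.card, FiniteField.pow_card]

lemma IsHermField.zero_pow : (0 : F) ^ q = 0 := _root_.zero_pow h.ne_zero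

lemma IsHermField.neg_pow (a : F) : (-a) ^ q = -(a ^ q) := by
  have := h.add_pow a (-a)
  rw [add_neg_cancel, h.zero_pow] at this
  linear_combination -this

lemma IsHermField.sum_pow {ι : Type*} (s : Finset ι) (f : ι → F) :
    (∑ i ∈ s, f i) ^ q = ∑ i ∈ s, f i ^ q := by
  induction s using Finset.induction_on with
  | empty => simp [h.ne_zero]
  | insert i s hi ih => rw [Finset.sum_insert hi, Finset.sum_insert hi, h.add_pow, ih]

lemma IsHermField.card_fixed_le : #{a : F | a ^ q = a} ≤ q := by
  have h1 : 1 < q := by have := h.le; omega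
  refine (Finset.card_le_card ?_).trans
    (card_roots_le (p := Polynomial.X ^ q - Polynomial.X) ?_ ?_ (n := q))
  · intro a ha
    simp only [Finset.mem_filter, Finset.mem_univ, true_and] at ha ⊢
    simp [ha]
  · exact FiniteField.X_pow_card_sub_X_ne_zero F h1
  · rw [FiniteField.X_pow_card_sub_X_natDegree_eq F h1]

lemma IsHermField.card_trace_eq {a : F} (ha : a ^ q = a) : #{u : F | u ^ q + u = a} = q := by
  have h1 : 1 < q := by have := h.le; omega
  refine card_fiber_eq (s := Finset.univ) (t := ({a : F | a ^ q = a} : Finset F))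
    (fun u : F => u ^ q + u) ?_ q q ?_ h.card_fixed_le ?_ (by simpa using ha)
  · intro u _
    simp [h.add_pow, h.pow_pow, add_comm]
  · intro b _
    have hd : (Polynomial.X ^ q + (Polynomial.X - Polynomial.C b)).natDegree = q := by
      rw [Polynomial.natDegree_add_eq_left_of_natDegree_lt] <;> simp [h1]
    refine (Finset.card_le_card ?_).trans (card_roots_le
      (p := Polynomial.X ^ q + (Polynomial.X - Polynomial.C b)) ?_ hd.le)
    · intro u hu
      simp only [Finset.mem_filter, Finset.mem_univ, true_and] at hu ⊢
      simp [← hu]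
    · intro h0
      rw [h0] at hd
      simp at hd
      omega
  · rw [Finset.card_univ, h.card, sq]

lemma IsHermField.card_norm_eq {a : F} (ha : a ^ q = a) (h0 : a ≠ 0) :
    #{u : F | u ^ (q + 1) = a} = q + 1 := by
  have key : #{u ∈ ({u : F | u ≠ 0} : Finset F) | u ^ (q + 1) = a} = q + 1 := by
    refine card_fiber_eq (t := ({a : F | a ^ q = a} : Finset F).erase 0)
      (fun u : F => u ^ (q + 1)) ?_ (q + 1) (q - 1) ?_ ?_ ?_ (by simp [ha, h0])
    · intro u hu
      simp only [Finset.mem_filter, Finset.mem_univ, true_and, ne_eq] at hu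
      simp only [Finset.mem_erase, ne_eq, Finset.mem_filter, Finset.mem_univ, true_and]
      refine ⟨pow_ne_zero _ hu, ?_⟩
      rw [pow_succ, mul_pow, h.pow_pow, mul_comm]
    · intro b _
      refine (Finset.card_le_card ?_).trans (card_roots_le
        (p := Polynomial.X ^ (q + 1) - Polynomial.C b)
        (Polynomial.X_pow_sub_C_ne_zero (by omega) b) (Polynomial.natDegree_X_pow_sub_C).le)
      intro u hu
      simp only [Finset.mem_filter, Finset.mem_univ, true_and] at hu ⊢
      simp [hu.2]
    · rw [Finset.card_erase_of_mem (by simp [h.ne_zero])]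
      have := h.card_fixed_le
      omega
    · have : ({u : F | u ≠ 0} : Finset F) = Finset.univ.erase 0 := by ext; simp
      rw [this, Finset.card_erase_of_mem (Finset.mem_univ _), Finset.card_univ, h.card]
      obtain ⟨k, hk⟩ : ∃ k, q = k + 1 := ⟨q - 1, by have := h.pos; omega⟩
      subst hk
      apply le_of_eq
      have : (k + 1) ^ 2 = (k + 1 + 1) * k + 1 := by ring
      rw [this]
      simp
  refine Eq.trans ?_ key
  congr 1
  ext u
  simp only [Finset.mem_filter, Finset.mem_univ, true_and, ne_eq, iff_and_self]
  rintro rfl rfl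
  simp at h0

end Field

section Counting

variable {F : Type} [Field F] [Fintype F] {V : Type} [AddCommGroup V] [Module F V]

lemma sum_card_shift {S : Finset V} (x : V) (hS : ∀ v ∈ S, ∀ s : F, v + s • x ∈ S) (P : V → Prop) :
    ∑ v ∈ S, #{s : F | P (v + s • x)} = Fintype.card F * #{v ∈ S | P v} := by
  simp_rw [Finset.card_filter]
  rw [Finset.sum_comm, ← Finset.card_univ, ← smul_eq_mul, ← Finset.sum_const]
  refine Finset.sum_congr rfl fun s _ => ?_
  refine Finset.sum_equiv (Equiv.addRight (s • x)) (fun v => ⟨fun hv => hS v hv s, fun hv => ?_⟩)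
    (fun v _ => rfl)
  simpa [add_assoc] using hS _ hv (-s)

variable [Fintype V]

lemma card_submodule_ker (U : Submodule F V) (f : V →ₗ[F] F) {u : V} (hu : u ∈ U) (hfu : f u ≠ 0) :
    #{v | v ∈ U} = Fintype.card F * #{v | v ∈ U ∧ f v = 0} := by
  have := sum_card_shift (S := ({v | v ∈ U} : Finset V)) (F := F) u
    (fun v hv s => by simpa using U.add_mem (by simpa using hv) (U.smul_mem s hu))
    (fun v => f v = 0)
  rw [Finset.filter_filter] at this
  rw [← this, Finset.card_eq_sum_ones]
  refine Finset.sum_congr rfl fun v _ => ?_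
  symm
  rw [Finset.card_eq_one]
  refine ⟨-(f v) / f u, ?_⟩
  ext s
  simp only [map_add, map_smul, smul_eq_mul, Finset.mem_filter, Finset.mem_univ, true_and,
    Finset.mem_singleton]
  rw [eq_div_iff hfu]
  constructor <;> intro hh <;> linear_combination hh

end Counting

section Form

variable {F : Type} [Field F]

/-- The standard Hermitian form on `F⁵`, semilinear in the first variable, as a linear form in the
second variable. -/
def herm (q : ℕ) (x : Fin 5 → F) : (Fin 5 → F) →ₗ[F] F :=
  ∑ i, x i ^ q • LinearMap.proj i

lemma herm_apply (q : ℕ) (x y : Fin 5 → F) : herm q x y = ∑ i, x i ^ q * y i := by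
  simp [herm]

/-- The orthogonal complement of a vector. -/
def perp (q : ℕ) (x : Fin 5 → F) : Submodule F (Fin 5 → F) := LinearMap.ker (herm q x)

@[simp] lemma mem_perp {q : ℕ} {x y : Fin 5 → F} : y ∈ perp q x ↔ herm q x y = 0 := Iff.rfl

variable [Fintype F]

/-- The number of vectors of a subspace. -/
def vecCard (U : Submodule F (Fin 5 → F)) : ℕ := #{v | v ∈ U}

/-- The number of isotropic vectors of a subspace. -/
def isoCard (q : ℕ) (U : Submodule F (Fin 5 → F)) : ℕ := #{v | v ∈ U ∧ herm q v v = 0}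

lemma vecCard_mono {U W : Submodule F (Fin 5 → F)} (hUW : U ≤ W) : vecCard U ≤ vecCard W :=
  Finset.card_le_card (Finset.monotone_filter_right _ fun _ _ hv => hUW hv)

lemma eq_of_le_of_vecCard_le {U W : Submodule F (Fin 5 → F)} (hUW : U ≤ W)
    (hc : vecCard W ≤ vecCard U) : U = W := by
  refine le_antisymm hUW fun v hv => ?_
  have := Finset.eq_of_subset_of_card_le
    (Finset.monotone_filter_right (Finset.univ : Finset (Fin 5 → F)) fun _ _ hv => hUW hv) hc
  have hv' : v ∈ ({v | v ∈ W} : Finset (Fin 5 → F)) := by simpa using hv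
  rw [← this] at hv'
  simpa using hv'

variable {q : ℕ} (h : IsHermField q F)
include h

namespace IsHermField

lemma vecCard_ker (U : Submodule F (Fin 5 → F)) (f : (Fin 5 → F) →ₗ[F] F) {u : Fin 5 → F}
    (hu : u ∈ U) (hfu : f u ≠ 0) : vecCard U = q ^ 2 * vecCard (U ⊓ LinearMap.ker f) := by
  rw [vecCard, card_submodule_ker U f hu hfu, h.card]
  simp [vecCard]

lemma vecCard_perp (U : Submodule F (Fin 5 → F)) {a u : Fin 5 → F}
    (hu : u ∈ U) (hau : herm q a u ≠ 0) : vecCard U = q ^ 2 * vecCard (U ⊓ perp q a) :=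
  h.vecCard_ker U _ hu hau

lemma vecCard_top : vecCard (⊤ : Submodule F (Fin 5 → F)) = q ^ 10 := by
  have : vecCard (⊤ : Submodule F (Fin 5 → F)) = Fintype.card (Fin 5 → F) := by simp [vecCard]
  rw [this, Fintype.card_fun, h.card, Fintype.card_fin, ← pow_mul]

lemma herm_add_left (x y z : Fin 5 → F) : herm q (x + y) z = herm q x z + herm q y z := by
  simp [herm_apply, h.add_pow, add_mul, Finset.sum_add_distrib]

omit [Fintype F] h in
lemma _root_.HermitianCubic.herm_smul_left (c : F) (x z : Fin 5 → F) :
    herm q (c • x) z = c ^ q * herm q x z := by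
  simp [herm_apply, mul_pow, mul_assoc, Finset.mul_sum]

lemma herm_pow (x y : Fin 5 → F) : herm q x y ^ q = herm q y x := by
  simp [herm_apply, h.sum_pow, mul_pow, h.pow_pow, mul_comm]

lemma herm_comm_eq_zero {x y : Fin 5 → F} : herm q x y = 0 ↔ herm q y x = 0 := by
  rw [← h.herm_pow x y, pow_eq_zero_iff h.ne_zero]

lemma exists_herm (f : (Fin 5 → F) →ₗ[F] F) : ∃ a, f = herm q a := by
  refine ⟨fun i => f (Pi.single i 1) ^ q, LinearMap.pi_ext' fun i => LinearMap.ext_ring ?_⟩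
  simp [herm_apply, h.pow_pow, Pi.single_apply]

lemma herm_eq_zero {a : Fin 5 → F} (ha : herm q a = 0) : a = 0 := by
  ext i
  have := congrArg (fun f => f (Pi.single i 1)) ha
  simpa [herm_apply, Pi.single_apply, h.ne_zero] using this

lemma herm_injective {a b : Fin 5 → F} (hab : herm q a = herm q b) : a = b := by
  rw [← sub_eq_zero]
  refine h.herm_eq_zero (LinearMap.ext fun y => ?_)
  rw [sub_eq_add_neg, h.herm_add_left, ← neg_one_smul F b, herm_smul_left, h.neg_pow, one_pow, hab]
  simp

lemma exists_herm_ne_zero {a : Fin 5 → F} (ha : a ≠ 0) : ∃ u, herm q a u ≠ 0 := by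
  by_contra! hu
  exact ha (h.herm_eq_zero (LinearMap.ext hu))

lemma herm_add_smul_self (v x : Fin 5 → F) (s : F) :
    herm q (v + s • x) (v + s • x) = herm q v v + s * herm q v x + (s * herm q v x) ^ q +
      s ^ (q + 1) * herm q x x := by
  rw [mul_pow, h.herm_pow, h.herm_add_left, herm_smul_left]
  simp only [map_add, map_smul, smul_eq_mul]
  ring

lemma card_iso_shift {v x : Fin 5 → F} (hx : herm q x x = 0) (hv : herm q x v ≠ 0) :
    #{s : F | herm q (v + s • x) (v + s • x) = 0} = q := by
  have hv' : herm q v x ≠ 0 := fun h0 => hv (h.herm_comm_eq_zero.1 h0)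
  have hfix : (-herm q v v) ^ q = -herm q v v := by rw [h.neg_pow, h.herm_pow]
  refine Eq.trans ?_ (h.card_trace_eq hfix)
  refine Finset.card_bij (fun s _ => s * herm q v x) ?_ ?_ ?_
  · intro s hs
    simp only [Finset.mem_filter, Finset.mem_univ, true_and] at hs ⊢
    rw [h.herm_add_smul_self, hx] at hs
    linear_combination hs
  · intro s _ t _ hst
    exact mul_right_cancel₀ hv' hst
  · intro u hu
    refine ⟨u / herm q v x, ?_, div_mul_cancel₀ _ hv'⟩
    simp only [Finset.mem_filter, Finset.mem_univ, true_and] at hu ⊢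
    rw [h.herm_add_smul_self, hx, div_mul_cancel₀ _ hv']
    linear_combination hu

lemma isoCard_of_isotropic {U : Submodule F (Fin 5 → F)} {x u : Fin 5 → F} (hxU : x ∈ U)
    (hx : herm q x x = 0) (hu : u ∈ U) (hxu : herm q x u ≠ 0) :
    q * isoCard q U + vecCard (U ⊓ perp q x) =
      q * isoCard q (U ⊓ perp q x) + q ^ 2 * vecCard (U ⊓ perp q x) := by
  have h1 := sum_card_shift (S := ({v | v ∈ U ∧ herm q x v ≠ 0} : Finset (Fin 5 → F))) (F := F) x
    (fun v hv s => by
      simp only [Finset.mem_filter, Finset.mem_univ, true_and] at hv ⊢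
      refine ⟨U.add_mem hv.1 (U.smul_mem s hxU), ?_⟩
      rw [map_add, map_smul, hx]
      simpa using hv.2)
    (fun v => herm q v v = 0)
  rw [Finset.sum_congr rfl fun v hv => h.card_iso_shift hx (Finset.mem_filter.1 hv).2.2,
    Finset.sum_const, smul_eq_mul, h.card, Finset.filter_filter] at h1
  have h2 : vecCard U = vecCard (U ⊓ perp q x) + #{v | v ∈ U ∧ herm q x v ≠ 0} := by
    unfold vecCard
    rw [← Finset.card_filter_add_card_filter_not (s := ({v | v ∈ U} : Finset (Fin 5 → F)))
      (fun v => herm q x v = 0), Finset.filter_filter, Finset.filter_filter]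
    simp
  have h3 : isoCard q U = isoCard q (U ⊓ perp q x) +
      #{v | (v ∈ U ∧ herm q x v ≠ 0) ∧ herm q v v = 0} := by
    unfold isoCard
    rw [← Finset.card_filter_add_card_filter_not
      (s := ({v | v ∈ U ∧ herm q v v = 0} : Finset (Fin 5 → F)))
      (fun v => herm q x v = 0), Finset.filter_filter, Finset.filter_filter]
    congr 2 <;> ext v <;> simp <;> tauto
  have h4 := h.vecCard_perp U hu hxu
  have h5 : #{v | v ∈ U ∧ herm q x v ≠ 0} =
      q * #{v | (v ∈ U ∧ herm q x v ≠ 0) ∧ herm q v v = 0} := by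
    refine Nat.eq_of_mul_eq_mul_right h.pos ?_
    rw [h1]; ring
  rw [h3, ← h4, h2, h5]
  ring

lemma card_iso_shift_of_perp {w a : Fin 5 → F} (ha : herm q a a ≠ 0) (hw : herm q a w = 0) :
    #{s : F | herm q (w + s • a) (w + s • a) = 0} = if herm q w w = 0 then 1 else q + 1 := by
  have hwa : herm q w a = 0 := h.herm_comm_eq_zero.1 hw
  have hiff (s : F) : herm q (w + s • a) (w + s • a) = 0 ↔
      s ^ (q + 1) = -herm q w w / herm q a a := by
    rw [h.herm_add_smul_self, hwa, mul_zero, h.zero_pow, eq_div_iff ha]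
    constructor <;> intro hh <;> linear_combination hh
  simp_rw [hiff]
  split_ifs with h0
  · rw [h0, Finset.card_eq_one]
    refine ⟨0, ?_⟩
    ext s
    simp
  · refine h.card_norm_eq ?_ (by simp [h0, ha])
    rw [div_pow, h.neg_pow, h.herm_pow, h.herm_pow]

lemma isoCard_of_not_isotropic {U : Submodule F (Fin 5 → F)} {a : Fin 5 → F} (haU : a ∈ U)
    (ha : herm q a a ≠ 0) :
    isoCard q U + q * isoCard q (U ⊓ perp q a) = (q + 1) * vecCard (U ⊓ perp q a) := by
  have h1 : isoCard q U = ∑ w ∈ ({w | w ∈ U ⊓ perp q a} : Finset (Fin 5 → F)),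
      if herm q w w = 0 then 1 else q + 1 := by
    rw [isoCard, Finset.card_eq_sum_card_fiberwise (f := fun v => v - (herm q a v / herm q a a) • a)
      (t := ({w | w ∈ U ⊓ perp q a} : Finset (Fin 5 → F)))]
    · refine Finset.sum_congr rfl fun w hw => ?_
      simp only [Finset.mem_filter, Finset.mem_univ, true_and, Submodule.mem_inf, mem_perp] at hw
      rw [← h.card_iso_shift_of_perp ha hw.2]
      symm
      refine Finset.card_bij (fun s _ => w + s • a) ?_ ?_ ?_
      · intro s hs
        simp only [Finset.mem_filter, Finset.mem_univ, true_and] at hs ⊢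
        refine ⟨⟨U.add_mem hw.1 (U.smul_mem s haU), hs⟩, ?_⟩
        rw [map_add, map_smul, hw.2, zero_add, smul_eq_mul, mul_div_assoc, div_self ha, mul_one,
          add_sub_cancel_right]
      · intro s _ t _ hst
        have ha0 : a ≠ 0 := by rintro rfl; simp at ha
        exact smul_left_injective F ha0 (add_left_cancel hst)
      · intro v hv
        simp only [Finset.mem_filter, Finset.mem_univ, true_and] at hv
        refine ⟨herm q a v / herm q a a, ?_, ?_⟩
        · simp [← hv.2, hv.1.2]
        · rw [← hv.2]; simp
    · intro v hv
      simp only [Finset.coe_filter, Finset.mem_univ, true_and, Set.mem_ofPred_eq, Submodule.mem_inf,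
        mem_perp] at hv ⊢
      refine ⟨U.sub_mem hv.1 (U.smul_mem _ haU), ?_⟩
      rw [map_sub, map_smul, smul_eq_mul, div_mul_cancel₀ _ ha, sub_self]
  have h2 : vecCard (U ⊓ perp q a) = isoCard q (U ⊓ perp q a) +
      #{w | w ∈ U ⊓ perp q a ∧ ¬ herm q w w = 0} := by
    unfold vecCard isoCard
    rw [← Finset.card_filter_add_card_filter_not
      (s := ({v | v ∈ U ⊓ perp q a} : Finset (Fin 5 → F))) (fun v => herm q v v = 0),
      Finset.filter_filter, Finset.filter_filter]
  rw [Finset.sum_ite, Finset.sum_const, Finset.sum_const, Finset.filter_filter,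
    Finset.filter_filter] at h1
  rw [h1, h2]
  simp only [isoCard, smul_eq_mul]
  ring

/-- The number of isotropic vectors of `F⁵` is `q⁹ - q⁵ + q⁴`. -/
lemma isoCard_top : isoCard q (⊤ : Submodule F (Fin 5 → F)) + q ^ 5 = q ^ 9 + q ^ 4 := by
  let U (k : ℕ) : Submodule F (Fin 5 → F) :=
    { carrier := {v | ∀ i : Fin 5, k ≤ i.val → v i = 0}
      add_mem' := fun {v w} hv hw i hi => by simp [hv i hi, hw i hi]
      zero_mem' := fun i _ => rfl
      smul_mem' := fun c v hv i hi => by simp [hv i hi] }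
  have hU0 : U 0 = ⊥ := by
    rw [eq_bot_iff]
    exact fun v hv => funext fun i => hv i (Nat.zero_le _)
  have hU5 : U 5 = ⊤ := by
    rw [eq_top_iff]
    exact fun v _ i hi => absurd i.isLt (by omega)
  have hn0 : vecCard (U 0) = 1 := by
    rw [hU0, vecCard, Finset.card_eq_one]
    exact ⟨0, by ext; simp⟩
  have ha0 : isoCard q (U 0) = 1 := by
    rw [hU0, isoCard, Finset.card_eq_one]
    exact ⟨0, by ext v; simp only [Submodule.mem_bot, Finset.mem_filter, Finset.mem_univ, true_and,
      Finset.mem_singleton, and_iff_left_iff_imp]; rintro rfl; simp⟩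
  have step (k : Fin 5) : vecCard (U (k + 1)) = q ^ 2 * vecCard (U k) ∧
      isoCard q (U (k + 1)) + q * isoCard q (U k) = (q + 1) * vecCard (U k) := by
    have hherm (v : Fin 5 → F) : herm q (Pi.single k 1) v = v k := by
      simp [herm_apply, Pi.single_apply, ite_pow, h.ne_zero]
    have hmem : Pi.single k 1 ∈ U (k + 1) := by
      intro i hi
      refine Pi.single_eq_of_ne ?_ _
      rintro rfl
      omega
    have hself : herm q (Pi.single k 1) (Pi.single k (1 : F)) ≠ 0 := by
      rw [hherm]; simp
    have hinf : U (k + 1) ⊓ perp q (Pi.single k 1) = U k := by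
      ext v
      rw [Submodule.mem_inf, mem_perp, hherm]
      constructor
      · rintro ⟨h1, h2⟩ i hi
        rcases eq_or_ne i k with rfl | hik
        · exact h2
        · exact h1 i (by have := Fin.val_ne_of_ne hik; omega)
      · exact fun hv => ⟨fun i hi => hv i (by omega), hv k le_rfl⟩
    rw [← hinf]
    exact ⟨h.vecCard_perp _ hmem hself, h.isoCard_of_not_isotropic hmem hself⟩
  have s0 := step 0
  have s1 := step 1
  have s2 := step 2
  have s3 := step 3
  have s4 := step 4
  norm_num at s0 s1 s2 s3 s4
  rw [hU5] at s4
  simp only [s3.1, s2.1, s1.1, s0.1, hn0, ha0, mul_one] at s0 s1 s2 s3 s4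
  zify at *
  linear_combination s4.2 - q * s3.2 + q ^ 2 * s2.2 - q ^ 3 * s1.2 + q ^ 4 * s0.2

lemma vecCard_perp_top {a : Fin 5 → F} (ha : a ≠ 0) : vecCard (perp q a) = q ^ 8 := by
  obtain ⟨u, hu⟩ := h.exists_herm_ne_zero ha
  have := h.vecCard_perp ⊤ (Submodule.mem_top) hu
  rw [h.vecCard_top, top_inf_eq] at this
  refine Nat.eq_of_mul_eq_mul_left (pow_pos h.pos 2) ?_
  rw [← this]; ring

lemma isoCard_perp_isotropic {x : Fin 5 → F} (hx0 : x ≠ 0) (hx : herm q x x = 0) :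
    isoCard q (perp q x) + q ^ 5 = q ^ 7 + q ^ 4 := by
  obtain ⟨u, hu⟩ := h.exists_herm_ne_zero hx0
  have h1 := h.isoCard_of_isotropic Submodule.mem_top hx Submodule.mem_top hu
  rw [top_inf_eq, h.vecCard_perp_top hx0] at h1
  have h2 := h.isoCard_top
  refine Nat.eq_of_mul_eq_mul_left h.pos ?_
  zify at *
  linear_combination -h1 + q * h2

lemma isoCard_perp_not_isotropic {a : Fin 5 → F} (ha : herm q a a ≠ 0) :
    isoCard q (perp q a) + q ^ 3 = q ^ 7 + q ^ 4 := by
  have ha0 : a ≠ 0 := by rintro rfl; simp at ha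
  have h1 := h.isoCard_of_not_isotropic Submodule.mem_top ha
  rw [top_inf_eq, h.vecCard_perp_top ha0] at h1
  have h2 := h.isoCard_top
  refine Nat.eq_of_mul_eq_mul_left h.pos ?_
  zify at *
  linear_combination h1 - h2

/-- If `herm q b` vanishes on the complement of `a`, then `b` is a multiple of `a`. -/
lemma exists_smul_eq {a b : Fin 5 → F} (ha : a ≠ 0) (hab : perp q a ≤ perp q b) :
    ∃ c : F, b = c • a := by
  obtain ⟨u, hu⟩ := h.exists_herm_ne_zero ha
  refine ⟨(herm q b u / herm q a u) ^ q, h.herm_injective (LinearMap.ext fun w => ?_)⟩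
  have hw : w - (herm q a w / herm q a u) • u ∈ perp q a := by
    rw [mem_perp, map_sub, map_smul, smul_eq_mul, div_mul_cancel₀ _ hu, sub_self]
  have := hab hw
  rw [mem_perp, map_sub, map_smul, smul_eq_mul] at this
  rw [herm_smul_left, h.pow_pow]
  linear_combination this

lemma vecCard_perp_inf {a b : Fin 5 → F} (ha : a ≠ 0) (hb : ∀ c : F, b ≠ c • a) :
    vecCard (perp q a ⊓ perp q b) = q ^ 6 := by
  have : ∃ u ∈ perp q a, herm q b u ≠ 0 := by
    by_contra! hu
    obtain ⟨c, hc⟩ := h.exists_smul_eq ha hu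
    exact hb c hc
  obtain ⟨u, hu, hbu⟩ := this
  have := h.vecCard_perp (perp q a) hu hbu
  rw [h.vecCard_perp_top ha] at this
  refine Nat.eq_of_mul_eq_mul_left (pow_pos h.pos 2) ?_
  rw [← this]; ring

lemma le_isoCard_perp_inf {a b : Fin 5 → F} (ha : herm q a a ≠ 0) (hb : ∀ c : F, b ≠ c • a) :
    q ^ 5 + q ^ 2 ≤ isoCard q (perp q a ⊓ perp q b) + q ^ 3 := by
  have ha0 : a ≠ 0 := by rintro rfl; simp at ha
  set b' := b - (herm q a b / herm q a a) • a with hb'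
  have hb'a : b' ∈ perp q a := by
    rw [mem_perp, hb', map_sub, map_smul, smul_eq_mul, div_mul_cancel₀ _ ha, sub_self]
  have hb'c : ∀ c : F, b' ≠ c • a := by
    intro c hc
    apply hb (c + herm q a b / herm q a a)
    rw [add_smul, ← hc, hb', sub_add_cancel]
  have hinf : perp q a ⊓ perp q b = perp q a ⊓ perp q b' := by
    ext v
    simp only [Submodule.mem_inf, mem_perp]
    refine and_congr_right fun hv => ?_
    rw [hb', sub_eq_add_neg, h.herm_add_left, ← neg_smul, herm_smul_left, hv, mul_zero, add_zero]
  have hZ := h.isoCard_perp_not_isotropic ha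
  have hn := h.vecCard_perp_inf ha0 hb'c
  have hq := h.pos
  rw [hinf]
  by_cases hiso : herm q b' b' = 0
  · have : ∃ u ∈ perp q a, herm q b' u ≠ 0 := by
      by_contra! hu
      obtain ⟨c, hc⟩ := h.exists_smul_eq ha0 hu
      exact hb'c c hc
    obtain ⟨u, hu, hbu⟩ := this
    have h1 := h.isoCard_of_isotropic hb'a hiso hu hbu
    rw [hn] at h1
    have h2 : isoCard q (perp q a ⊓ perp q b') + q ^ 3 = q ^ 5 + q ^ 4 := by
      refine Nat.eq_of_mul_eq_mul_left hq ?_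
      zify at *
      linear_combination -h1 + q * hZ
    have : q ^ 2 ≤ q ^ 4 := Nat.pow_le_pow_right hq (by norm_num)
    omega
  · have h1 := h.isoCard_of_not_isotropic hb'a hiso
    rw [hn] at h1
    have h2 : isoCard q (perp q a ⊓ perp q b') + q ^ 3 = q ^ 5 + q ^ 2 := by
      refine Nat.eq_of_mul_eq_mul_left hq ?_
      zify at *
      linear_combination h1 - hZ
    omega

end IsHermField

end Form

section Polynomials

variable {F : Type} [Field F]

/-- The differential of a polynomial at a point, as a linear form. -/
def dir (H : MvPolynomial (Fin 5) F) (x : Fin 5 → F) : (Fin 5 → F) →ₗ[F] F :=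
  ∑ i, eval x (pderiv i H) • LinearMap.proj i

lemma dir_apply (H : MvPolynomial (Fin 5) F) (x y : Fin 5 → F) :
    dir H x y = ∑ i, eval x (pderiv i H) * y i := by
  simp [dir]

/-- The restriction of a polynomial to the parametrised line `t ↦ x + t y`. -/
def lineP (H : MvPolynomial (Fin 5) F) (x y : Fin 5 → F) : Polynomial F :=
  aeval (fun i => Polynomial.C (x i) + Polynomial.C (y i) * Polynomial.X) H

lemma eval_lineP (H : MvPolynomial (Fin 5) F) (x y : Fin 5 → F) (t : F) :
    (lineP H x y).eval t = eval (x + t • y) H := by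
  have : (Polynomial.aeval t).comp (aeval fun i => Polynomial.C (x i) +
      Polynomial.C (y i) * Polynomial.X) = aeval (x + t • y) := by
    refine algHom_ext fun i => ?_
    simp only [AlgHom.comp_apply, aeval_X, Polynomial.coe_aeval_eq_eval, Polynomial.eval_add,
      Polynomial.eval_mul, Polynomial.eval_C, Polynomial.eval_X, Pi.add_apply, Pi.smul_apply,
      smul_eq_mul, mul_comm]
  have h2 := DFunLike.congr_fun this H
  rw [AlgHom.comp_apply, Polynomial.coe_aeval_eq_eval] at h2
  rw [lineP, h2]
  rfl

lemma derivative_lineP (H : MvPolynomial (Fin 5) F) (x y : Fin 5 → F) :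
    (lineP H x y).derivative = ∑ i, lineP (pderiv i H) x y * Polynomial.C (y i) := by
  unfold lineP
  induction H using MvPolynomial.induction_on with
  | C a => simp
  | add p r hp hr =>
    simp only [map_add, hp, hr, add_mul, Finset.sum_add_distrib]
  | mul_X p i hp =>
    rw [map_mul, aeval_X, Polynomial.derivative_mul, hp, Finset.sum_mul]
    have h1 : (Polynomial.C (x i) + Polynomial.C (y i) * Polynomial.X).derivative =
        Polynomial.C (y i) := by simp
    have h2 (j : Fin 5) : pderiv j (p * X i) = p * (if j = i then 1 else 0) + X i * pderiv j p := by
      rw [Derivation.leibniz, pderiv_X, smul_eq_mul, smul_eq_mul, Pi.single_apply]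
      simp only [eq_comm]
    simp only [h1, h2, map_add, map_mul, aeval_X, add_mul _ _ (Polynomial.C (y _)),
      Finset.sum_add_distrib]
    rw [Finset.sum_eq_single (f := fun j => _ * _ * Polynomial.C (y j)) i
      (by intro j _ hj; simp [hj]) (by simp), add_comm]
    generalize (aeval fun i => Polynomial.C (x i) + Polynomial.C (y i) * Polynomial.X :
      MvPolynomial (Fin 5) F →ₐ[F] Polynomial F) = φ
    refine congrArg₂ (· + ·) ?_ ?_
    · simp
    · exact Finset.sum_congr rfl fun j _ => by ring

lemma eval_derivative_lineP (H : MvPolynomial (Fin 5) F) (x y : Fin 5 → F) (t : F) :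
    (lineP H x y).derivative.eval t = dir H (x + t • y) y := by
  simp [derivative_lineP, Polynomial.eval_finsetSum, eval_lineP, dir_apply]

lemma eval_smul_of_isHomogeneous {H : MvPolynomial (Fin 5) F} {d : ℕ} (hH : H.IsHomogeneous d)
    (c : F) (x : Fin 5 → F) : eval (c • x) H = c ^ d * eval x H := by
  rw [eval_eq, eval_eq, Finset.mul_sum]
  refine Finset.sum_congr rfl fun m hm => ?_
  simp only [Pi.smul_apply, smul_eq_mul, mul_pow, Finset.prod_mul_distrib]
  rw [Finset.prod_pow_eq_pow_sum, ← hH.degree_eq_sum_deg_support hm]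
  ring

lemma natDegree_lineP_le {H : MvPolynomial (Fin 5) F} {d : ℕ} (hH : H.IsHomogeneous d)
    (x y : Fin 5 → F) : (lineP H x y).natDegree ≤ d := by
  have := MvPolynomial.aeval_natDegree_le H hH.totalDegree_le
    (fun i => Polynomial.C (x i) + Polynomial.C (y i) * Polynomial.X) (n := 1)
    (fun i => by compute_degree)
  rwa [mul_one] at this

variable [Fintype F]

lemma reflect_lineP {H : MvPolynomial (Fin 5) F} {d : ℕ} (hH : H.IsHomogeneous d)
    (hd : d + 1 < Fintype.card F) (x y : Fin 5 → F) :
    Polynomial.reflect d (lineP H x y) = lineP H y x := by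
  rw [← sub_eq_zero]
  by_contra h0
  have hdeg : (Polynomial.reflect d (lineP H x y) - lineP H y x).natDegree ≤ d := by
    refine (Polynomial.natDegree_sub_le _ _).trans (max_le ?_ (natDegree_lineP_le hH y x))
    exact Polynomial.natDegree_reflect_le.trans (max_le le_rfl (natDegree_lineP_le hH x y))
  have h1 := card_roots_le h0 hdeg
  have h2 : Finset.univ.erase 0 ⊆ ({t : F |
      (Polynomial.reflect d (lineP H x y) - lineP H y x).eval t = 0} : Finset F) := by
    intro t ht
    have ht0 : t ≠ 0 := by simpa using ht
    let _ := invertibleOfNonzero (inv_ne_zero ht0)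
    have h3 := Polynomial.eval₂_reflect_mul_pow (RingHom.id F) t⁻¹ d (lineP H x y)
      (natDegree_lineP_le hH x y)
    rw [invOf_eq_inv, inv_inv, Polynomial.eval₂_id, Polynomial.eval₂_id, eval_lineP] at h3
    have h4 : y + t • x = t • (x + t⁻¹ • y) := by
      rw [smul_add, smul_smul, mul_inv_cancel₀ ht0, one_smul, add_comm]
    simp only [Finset.mem_filter, Finset.mem_univ, true_and, Polynomial.eval_sub]
    rw [eval_lineP, h4, eval_smul_of_isHomogeneous hH, ← h3, mul_left_comm, ← mul_pow,
      mul_inv_cancel₀ ht0, one_pow, mul_one, sub_self]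
  have h5 := Finset.card_le_card h2
  rw [Finset.card_erase_of_mem (Finset.mem_univ _), Finset.card_univ] at h5
  omega

lemma coeff_lineP {H : MvPolynomial (Fin 5) F} {d : ℕ} (hH : H.IsHomogeneous d)
    (hd : d + 1 < Fintype.card F) (x y : Fin 5 → F) {k : ℕ} (hk : k ≤ d) :
    (lineP H x y).coeff (d - k) = (lineP H y x).coeff k := by
  rw [← reflect_lineP hH hd, Polynomial.coeff_reflect, Polynomial.revAt_le (Nat.sub_le _ _),
    Nat.sub_sub_self hk]

lemma coeff_lineP_degree {H : MvPolynomial (Fin 5) F} {d : ℕ} (hH : H.IsHomogeneous d)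
    (hd : d + 1 < Fintype.card F) (x y : Fin 5 → F) : (lineP H x y).coeff d = eval y H := by
  have := coeff_lineP hH hd x y (Nat.zero_le d)
  rw [Nat.sub_zero] at this
  rw [this, Polynomial.coeff_zero_eq_eval_zero, eval_lineP]
  simp

lemma coeff_lineP_degree_sub_one {H : MvPolynomial (Fin 5) F} {d : ℕ} (hH : H.IsHomogeneous d)
    (hd : d + 1 < Fintype.card F) (hd1 : 1 ≤ d) (x y : Fin 5 → F) :
    (lineP H x y).coeff (d - 1) = dir H y x := by
  rw [coeff_lineP hH hd x y hd1]
  have := eval_derivative_lineP H y x 0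
  rw [← Polynomial.coeff_zero_eq_eval_zero, Polynomial.coeff_derivative] at this
  simpa using this

lemma lineP_eq_zero {H : MvPolynomial (Fin 5) F} {d : ℕ} (hH : H.IsHomogeneous d)
    (hd : d + 1 < Fintype.card F) {x y : Fin 5 → F} (hxy : ∀ t : F, eval (x + t • y) H = 0) :
    lineP H x y = 0 := by
  by_contra h0
  have := card_roots_le h0 (natDegree_lineP_le hH x y)
  simp only [eval_lineP, hxy, Finset.filter_true, Finset.card_univ] at this
  omega

/-- The polynomial `H` vanishes on the span of `x` and `y`. -/
def Cont (H : MvPolynomial (Fin 5) F) (x y : Fin 5 → F) : Prop :=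
  ∀ a b : F, eval (a • x + b • y) H = 0

lemma cont_of_lineP_eq_zero {H : MvPolynomial (Fin 5) F} {d : ℕ} (hH : H.IsHomogeneous d)
    (hd : d + 1 < Fintype.card F) {x y : Fin 5 → F} (h0 : lineP H x y = 0) : Cont H x y := by
  intro a b
  rcases eq_or_ne a 0 with rfl | ha
  · rw [zero_smul, zero_add, eval_smul_of_isHomogeneous hH, ← coeff_lineP_degree hH hd x y, h0]
    simp
  · have : a • x + b • y = a • (x + (a⁻¹ * b) • y) := by
      rw [smul_add, smul_smul, mul_inv_cancel_left₀ ha]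
    rw [this, eval_smul_of_isHomogeneous hH, ← eval_lineP, h0]
    simp

lemma Cont.lineP_eq_zero {H : MvPolynomial (Fin 5) F} {d : ℕ} (hH : H.IsHomogeneous d)
    (hd : d + 1 < Fintype.card F) {x y : Fin 5 → F} (hc : Cont H x y) : lineP H x y = 0 :=
  HermitianCubic.lineP_eq_zero hH hd fun t => by simpa using hc 1 t

lemma Cont.dir_eq_zero {H : MvPolynomial (Fin 5) F} {d : ℕ} (hH : H.IsHomogeneous d)
    (hd : d + 1 < Fintype.card F) {x y : Fin 5 → F} (hc : Cont H x y) : dir H x y = 0 := by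
  have := eval_derivative_lineP H x y 0
  rw [hc.lineP_eq_zero hH hd] at this
  simpa using this.symm

omit [Fintype F] in
lemma Cont.symm {H : MvPolynomial (Fin 5) F} {x y : Fin 5 → F} (hc : Cont H x y) : Cont H y x :=
  fun a b => by rw [add_comm]; exact hc b a

omit [Fintype F] in
lemma Cont.left {H : MvPolynomial (Fin 5) F} {x y : Fin 5 → F} (hc : Cont H x y) :
    eval x H = 0 := by
  simpa using hc 1 0

omit [Fintype F] in
lemma Cont.right {H : MvPolynomial (Fin 5) F} {x y : Fin 5 → F} (hc : Cont H x y) :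
    eval y H = 0 := hc.symm.left

omit [Fintype F] in
lemma Cont.add_smul {H : MvPolynomial (Fin 5) F} {x y : Fin 5 → F} (hc : Cont H x y) (t : F) :
    Cont H (x + t • y) y := by
  intro a b
  have := hc a (a * t + b)
  rwa [_root_.add_smul, ← add_assoc, ← smul_smul, ← smul_add] at this

omit [Fintype F] in
lemma cont_add_smul_iff {H : MvPolynomial (Fin 5) F} {x y : Fin 5 → F} (t : F) :
    Cont H (x + t • y) y ↔ Cont H x y :=
  ⟨fun hc => by simpa [add_assoc] using hc.add_smul (-t), fun hc => hc.add_smul t⟩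

lemma sum_roots_le {p : Polynomial F} (hp : p ≠ 0) :
    ∑ t : F, (if p.eval t = 0 then 1 + (if p.derivative.eval t = 0 then 1 else 0) else 0) ≤
      p.natDegree := by
  refine le_trans ?_ (Polynomial.card_roots' p)
  rw [← Multiset.sum_count_eq_card (s := Finset.univ) (fun a _ => Finset.mem_univ a)]
  refine Finset.sum_le_sum fun t _ => ?_
  rw [Polynomial.count_roots]
  split_ifs with h1 h2
  · exact (Polynomial.one_lt_rootMultiplicity_iff_isRoot hp).2 ⟨h1, h2⟩
  · exact (Polynomial.rootMultiplicity_pos hp).2 h1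
  · exact Nat.zero_le _

/-- The weighted number of zeros, on a projective line, of a form of degree `d`. -/
lemma line_bound {H : MvPolynomial (Fin 5) F} {d : ℕ} (hH : H.IsHomogeneous d)
    (hd : d + 1 < Fintype.card F) (hd1 : 1 ≤ d) {x y : Fin 5 → F} (hc : ¬ Cont H x y) :
    (if eval y H = 0 then 1 + (if dir H y x = 0 then 1 else 0) else 0) +
      ∑ t : F, (if eval (x + t • y) H = 0 then
        1 + (if dir H (x + t • y) y = 0 then 1 else 0) else 0) ≤ d := by
  have h0 : lineP H x y ≠ 0 := fun h0 => hc (cont_of_lineP_eq_zero hH hd h0)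
  have h1 := sum_roots_le h0
  simp only [eval_lineP, eval_derivative_lineP] at h1
  have h2 := natDegree_lineP_le hH x y
  have h3 : lineP H x y ≠ 0 → (lineP H x y).coeff (lineP H x y).natDegree ≠ 0 := by
    simp
  have h4 := h3 h0
  refine le_trans (Nat.add_le_add_left h1 _) ?_
  split_ifs with hy hy'
  · have : (lineP H x y).natDegree ≠ d := by
      intro e; rw [e, coeff_lineP_degree hH hd, hy] at h4; exact h4 rfl
    have : (lineP H x y).natDegree ≠ d - 1 := by
      intro e; rw [e, coeff_lineP_degree_sub_one hH hd hd1, hy'] at h4; exact h4 rfl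
    omega
  · have : (lineP H x y).natDegree ≠ d := by
      intro e; rw [e, coeff_lineP_degree hH hd, hy] at h4; exact h4 rfl
    omega
  · omega

/-- A form of degree `d` not vanishing identically on a subspace vanishes on at most a
proportion `d / |F|` of it. -/
lemma card_zeros_le {H : MvPolynomial (Fin 5) F} {d : ℕ} (hH : H.IsHomogeneous d)
    (hd : d + 1 < Fintype.card F) {U : Submodule F (Fin 5 → F)} {u : Fin 5 → F} (hu : u ∈ U)
    (hHu : eval u H ≠ 0) :
    Fintype.card F * #{v | v ∈ U ∧ eval v H = 0} ≤ d * vecCard U := by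
  have := sum_card_shift (S := ({v | v ∈ U} : Finset (Fin 5 → F))) (F := F) u
    (fun v hv s => by simpa using U.add_mem (by simpa using hv) (U.smul_mem s hu))
    (fun v => eval v H = 0)
  rw [Finset.filter_filter] at this
  rw [← this, mul_comm, vecCard, ← smul_eq_mul, ← Finset.sum_const]
  refine Finset.sum_le_sum fun v _ => ?_
  have h0 : lineP H v u ≠ 0 := fun h0 => hHu (cont_of_lineP_eq_zero hH hd h0).right
  simpa only [eval_lineP] using card_roots_le h0 (natDegree_lineP_le hH v u)

end Polynomials

section LinearFactor

variable {F : Type} [Field F] {q : ℕ}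

/-- The linear form `herm q a`, as a polynomial. -/
def linForm (q : ℕ) (a : Fin 5 → F) : MvPolynomial (Fin 5) F := ∑ i, C (a i ^ q) * X i

lemma eval_linForm (a v : Fin 5 → F) : eval v (linForm q a) = herm q a v := by
  simp [linForm, herm_apply]

lemma isHomogeneous_linForm (a : Fin 5 → F) : (linForm q a).IsHomogeneous 1 :=
  IsHomogeneous.sum _ _ _ fun i _ => isHomogeneous_C_mul_X _ i

lemma homogeneousComponent_mul_of_isHomogeneous {P Q : MvPolynomial (Fin 5) F} {m n : ℕ}
    (hP : P.IsHomogeneous m) : homogeneousComponent (m + n) (P * Q) =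
      P * homogeneousComponent n Q := by
  let _ : GradedAlgebra (homogeneousSubmodule (Fin 5) F) := gradedAlgebra
  have h1 := DirectSum.coe_decompose_mul_add_of_left_mem (homogeneousSubmodule (Fin 5) F) (i := m)
    (j := n) (a := P) (b := Q) hP
  rw [← decomposition.decompose'_apply, ← decomposition.decompose'_apply]
  exact h1

variable [Fintype F]

/-- A form vanishing on a hyperplane is divisible by the equation of the hyperplane. -/
lemma exists_eq_linForm_mul {H : MvPolynomial (Fin 5) F} {d : ℕ} (hH : H.IsHomogeneous (1 + d))
    (hd : 1 + d ≤ Fintype.card F) {a : Fin 5 → F} (ha : a ≠ 0)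
    (hv : ∀ y ∈ perp q a, eval y H = 0) :
    ∃ Q : MvPolynomial (Fin 5) F, Q.IsHomogeneous d ∧ H = linForm q a * Q := by
  obtain ⟨j, hj⟩ : ∃ j, a j ≠ 0 := by
    by_contra! h0
    exact ha (funext h0)
  have hc : a j ^ q ≠ 0 := pow_ne_zero _ hj
  let f : Fin 5 → MvPolynomial (Fin 5) F :=
    fun i => X i - C ((Pi.single j (a j ^ q)⁻¹ : Fin 5 → F) i) * linForm q a
  have hdvd : linForm q a ∣ H - aeval f H := by
    rw [← Ideal.mem_span_singleton, ← Ideal.Quotient.eq]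
    have : (Ideal.Quotient.mkₐ F (Ideal.span {linForm q a})).comp (aeval f) =
        Ideal.Quotient.mkₐ F (Ideal.span {linForm q a}) := by
      refine algHom_ext fun i => ?_
      rw [AlgHom.comp_apply, aeval_X, Ideal.Quotient.mkₐ_eq_mk, Ideal.Quotient.eq,
        Ideal.mem_span_singleton]
      exact ⟨-C ((Pi.single j (a j ^ q)⁻¹ : Fin 5 → F) i), by simp only [f]; ring⟩
    exact (DFunLike.congr_fun this H).symm
  have hf : (aeval f H).IsHomogeneous (1 + d) := by
    have := hH.aeval f (n := 1) fun i => (isHomogeneous_X F i).sub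
      (by simpa using (isHomogeneous_linForm (q := q) a).C_mul _)
    rwa [one_mul] at this
  have hf0 : aeval f H = 0 := by
    refine hf.eq_zero_of_forall_eval_eq_zero_of_le_card (fun v => ?_)
      (by rw [Cardinal.mk_fintype]; exact_mod_cast hd)
    have h1 : eval v (aeval f H) = eval (fun i => eval v (f i)) H := by
      rw [← coe_aeval_eq_eval, ← coe_aeval_eq_eval]
      change ((aeval v).comp (aeval f)) H = _
      rw [comp_aeval]
      rfl
    rw [h1]
    refine hv _ ?_
    have h2 : (fun i => eval v (f i)) =
        v - herm q a v • (Pi.single j (a j ^ q)⁻¹ : Fin 5 → F) := by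
      funext i
      simp [f, eval_linForm, mul_comm]
    rw [h2, mem_perp, map_sub, map_smul, smul_eq_mul]
    have h3 : herm q a (Pi.single j (a j ^ q)⁻¹) = 1 := by
      simp [herm_apply, Pi.single_apply, hc]
    rw [h3, mul_one, sub_self]
  rw [hf0, sub_zero] at hdvd
  obtain ⟨Q, hQ⟩ := hdvd
  refine ⟨homogeneousComponent d Q, homogeneousComponent_isHomogeneous d Q, ?_⟩
  rw [← homogeneousComponent_mul_of_isHomogeneous (isHomogeneous_linForm a), ← hQ,
    homogeneousComponent_eq_self hH]

variable (h : IsHermField q F)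
include h

namespace IsHermField

/-- Every linear form is of the form `herm q a`. -/
lemma exists_eq_linForm {L : MvPolynomial (Fin 5) F} (hL : L.IsHomogeneous 1) :
    ∃ a, L = linForm q a := by
  have hL' : L ∈ Submodule.span F (Set.range (X : Fin 5 → MvPolynomial (Fin 5) F)) := by
    rw [← homogeneousSubmodule_one_eq_span_X]
    exact hL
  obtain ⟨c, rfl⟩ := (Submodule.mem_span_range_iff_exists_fun F).1 hL'
  refine ⟨fun i => c i ^ q, Finset.sum_congr rfl fun i _ => ?_⟩
  rw [h.pow_pow, smul_eq_C_mul]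

end IsHermField

end LinearFactor

section Local

variable {F : Type} [Field F] {q : ℕ}

/-- The vectors `x` and `y` span a totally isotropic plane. -/
structure IsoPair (q : ℕ) (x y : Fin 5 → F) : Prop where
  left : herm q x x = 0
  right : herm q y y = 0
  orth : herm q x y = 0
  indep : LinearIndependent F ![x, y]

lemma IsoPair.left_ne_zero {x y : Fin 5 → F} (hxy : IsoPair q x y) : x ≠ 0 :=
  hxy.indep.ne_zero 0

/-- The intersection of the complement of `x` with the tangent hyperplane of `H` at `x`. -/
def tang (q : ℕ) (H : MvPolynomial (Fin 5) F) (x : Fin 5 → F) : Submodule F (Fin 5 → F) :=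
  perp q x ⊓ LinearMap.ker (dir H x)

lemma mem_tang {H : MvPolynomial (Fin 5) F} {x y : Fin 5 → F} :
    y ∈ tang q H x ↔ herm q x y = 0 ∧ dir H x y = 0 := Iff.rfl

lemma tang_le_perp (H : MvPolynomial (Fin 5) F) (x : Fin 5 → F) : tang q H x ≤ perp q x :=
  inf_le_left

variable [Fintype F] (h : IsHermField q F)
include h

namespace IsHermField

lemma degree_lt_card {d : ℕ} (hd : d ≤ 3) : d + 1 < Fintype.card F := by
  have := h.le
  rw [h.card]
  nlinarith

lemma isoPair_symm {x y : Fin 5 → F} (hxy : IsoPair q x y) : IsoPair q y x :=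
  ⟨hxy.right, hxy.left, h.herm_comm_eq_zero.1 hxy.orth, LinearIndependent.pair_symm_iff.1 hxy.indep⟩

lemma isoPair_add_smul {x y : Fin 5 → F} (hxy : IsoPair q x y) (t : F) :
    IsoPair q (x + t • y) y where
  left := by
    rw [h.herm_add_smul_self, hxy.left, hxy.right, h.herm_comm_eq_zero.1
      (h.herm_comm_eq_zero.1 hxy.orth)]
    simp [h.ne_zero]
  right := hxy.right
  orth := by rw [h.herm_add_left, herm_smul_left, hxy.orth, hxy.right]; simp
  indep := by
    have := hxy.indep
    rw [LinearIndependent.pair_iff] at this ⊢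
    intro a b hab
    have h1 := this a (a * t + b) (by rw [← hab, add_smul, mul_smul, smul_add, add_assoc])
    refine ⟨h1.1, ?_⟩
    simpa [h1.1] using h1.2

lemma isoPair_add_smul_iff {x y : Fin 5 → F} (t : F) :
    IsoPair q (x + t • y) y ↔ IsoPair q x y :=
  ⟨fun hxy => by simpa [add_assoc] using h.isoPair_add_smul hxy (-t),
    fun hxy => h.isoPair_add_smul hxy t⟩

lemma card_isoPair {W : Submodule F (Fin 5 → F)} {x : Fin 5 → F} (hW : W ≤ perp q x) (hxW : x ∈ W)
    (hx0 : x ≠ 0) : #{y | y ∈ W ∧ IsoPair q x y} + q ^ 2 = isoCard q W := by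
  rw [isoCard, ← Finset.card_filter_add_card_filter_not
      (s := ({y | y ∈ W ∧ herm q y y = 0} : Finset (Fin 5 → F))) (fun y => IsoPair q x y),
    Finset.filter_filter, Finset.filter_filter]
  have hx : herm q x x = 0 := hW hxW
  refine congrArg₂ (· + ·) (congrArg Finset.card (Finset.filter_congr fun y _ => ?_)) ?_
  · exact ⟨fun hy => ⟨⟨hy.1, hy.2.right⟩, hy.2⟩, fun hy => ⟨hy.1.1, hy.2⟩⟩
  · rw [← h.card, ← Finset.card_univ,
      ← Finset.card_image_of_injective _ (smul_left_injective F hx0)]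
    congr 1
    ext y
    simp only [Finset.mem_image, Finset.mem_univ, true_and, Finset.mem_filter]
    constructor
    · rintro ⟨c, rfl⟩
      refine ⟨⟨W.smul_mem c hxW, by simp [herm_smul_left, hx]⟩, fun hp => ?_⟩
      exact (LinearIndependent.pair_iff' hx0).1 hp.indep c rfl
    · rintro ⟨⟨hy, hy'⟩, hp⟩
      by_contra! hc
      exact hp ⟨hx, hy', hW hy, (LinearIndependent.pair_iff' hx0).2 hc⟩

lemma card_isoPair_top {x : Fin 5 → F} (hx0 : x ≠ 0) (hx : herm q x x = 0) :
    #{y | IsoPair q x y} = (q ^ 3 + 1) * (q ^ 4 - q ^ 2) := by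
  have h1 := h.card_isoPair le_rfl hx hx0
  have h2 := h.isoCard_perp_isotropic hx0 hx
  have h3 : #{y | y ∈ perp q x ∧ IsoPair q x y} = #{y | IsoPair q x y} :=
    congrArg Finset.card (Finset.filter_congr fun y _ => ⟨fun hy => hy.2, fun hy => ⟨hy.orth, hy⟩⟩)
  rw [h3] at h1
  have h4 : q ^ 2 ≤ q ^ 4 := Nat.pow_le_pow_right h.pos (by norm_num)
  zify [h4] at *
  linear_combination h1 + h2

lemma self_mem_tang {H : MvPolynomial (Fin 5) F} {d : ℕ} (hH : H.IsHomogeneous d) (hd : d ≤ 3)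
    {x : Fin 5 → F} (hx : herm q x x = 0) (hHx : eval x H = 0) : x ∈ tang q H x := by
  refine mem_tang.2 ⟨hx, Cont.dir_eq_zero hH (h.degree_lt_card hd) fun a b => ?_⟩
  rw [← add_smul, eval_smul_of_isHomogeneous hH, hHx, mul_zero]

lemma tang_eq {H : MvPolynomial (Fin 5) F} (x : Fin 5 → F) :
    ∃ b, tang q H x = perp q x ⊓ perp q b ∧ dir H x = herm q b := by
  obtain ⟨b, hb⟩ := h.exists_herm (dir H x)
  exact ⟨b, by rw [tang, perp, perp, hb], hb⟩

lemma vecCard_tang {H : MvPolynomial (Fin 5) F} {x : Fin 5 → F} (hx0 : x ≠ 0)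
    (hu : ∃ u ∈ perp q x, dir H x u ≠ 0) : vecCard (tang q H x) = q ^ 6 := by
  obtain ⟨u, hu, hxu⟩ := hu
  have := h.vecCard_ker (perp q x) (dir H x) hu hxu
  rw [h.vecCard_perp_top hx0] at this
  refine Nat.eq_of_mul_eq_mul_left (pow_pos h.pos 2) ?_
  rw [tang, ← this]; ring

/-- The complement of the intersection of two hyperplanes has at most `q⁴` elements. -/
lemma card_perp_of_inf_le (a b : Fin 5 → F) :
    #{y : Fin 5 → F | perp q a ⊓ perp q b ≤ perp q y} ≤ q ^ 4 := by
  have : ({y : Fin 5 → F | perp q a ⊓ perp q b ≤ perp q y} : Finset (Fin 5 → F)) ⊆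
      Finset.univ.image fun c : F × F => c.1 • a + c.2 • b := by
    intro y hy
    simp only [Finset.mem_filter, Finset.mem_univ, true_and, Finset.mem_image] at hy ⊢
    have hspan : herm q y ∈ Submodule.span F (Set.range ![herm q a, herm q b]) := by
      refine mem_span_of_iInf_ker_le_ker (le_trans (fun v hv => ?_) hy)
      simp only [Submodule.mem_iInf, LinearMap.mem_ker, Fin.forall_fin_two] at hv
      exact hv
    obtain ⟨c, hc⟩ := (Submodule.mem_span_range_iff_exists_fun F).1 hspan
    refine ⟨(c 0 ^ q, c 1 ^ q), h.herm_injective (LinearMap.ext fun v => ?_)⟩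
    rw [← hc, h.herm_add_left, herm_smul_left, herm_smul_left, h.pow_pow, h.pow_pow]
    simp
  refine (Finset.card_le_card this).trans (Finset.card_image_le.trans ?_)
  rw [Finset.card_univ, Fintype.card_prod, h.card]
  exact (by ring : q ^ 2 * q ^ 2 = q ^ 4).le

/-- If the subspace `W`, orthogonal to the isotropic vector `x` and of dimension three, contains an
isotropic vector `y` outside its radical, then the vectors of `W` orthogonal to `y` are the linear
combinations of `x` and `y`. -/
lemma exists_eq_add_smul {W : Submodule F (Fin 5 → F)} {x y u z : Fin 5 → F} (hW : W ≤ perp q x)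
    (hc : vecCard W = q ^ 6) (hx0 : x ≠ 0) (hxW : x ∈ W) (hyW : y ∈ W) (hy : herm q y y = 0)
    (hu : u ∈ W) (hyu : herm q y u ≠ 0) (hz : z ∈ W ⊓ perp q y) : ∃ a b : F, z = a • x + b • y := by
  have h1 := h.vecCard_perp W hu hyu
  rw [hc] at h1
  have h2 : vecCard (W ⊓ perp q y) = q ^ 4 := by
    refine Nat.eq_of_mul_eq_mul_left (pow_pos h.pos 2) ?_
    rw [← h1]; ring
  have hyx : herm q y x = 0 := h.herm_comm_eq_zero.1 (hW hyW)
  have hsub : (Finset.univ.image fun c : F × F => c.1 • x + c.2 • y) ⊆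
      ({v | v ∈ W ⊓ perp q y} : Finset (Fin 5 → F)) := by
    intro v hv
    simp only [Finset.mem_image, Finset.mem_univ, true_and] at hv
    obtain ⟨c, rfl⟩ := hv
    simp only [Finset.mem_filter, Finset.mem_univ, true_and, Submodule.mem_inf, mem_perp]
    refine ⟨W.add_mem (W.smul_mem _ hxW) (W.smul_mem _ hyW), ?_⟩
    rw [map_add, map_smul, map_smul, hyx, hy]
    simp
  have hinj : Function.Injective fun c : F × F => c.1 • x + c.2 • y := by
    intro c c' hcc
    simp only at hcc
    have h3 : c.2 = c'.2 := by
      have := congrArg (fun v => herm q v u) hcc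
      have hxu : herm q x u = 0 := hW hu
      simp only [h.herm_add_left, herm_smul_left, hxu, mul_zero, zero_add] at this
      have := congrArg (· ^ q) (mul_right_cancel₀ hyu this)
      simpa only [h.pow_pow] using this
    rw [h3] at hcc
    exact Prod.ext (smul_left_injective F hx0 (add_right_cancel hcc)) h3
  have heq := Finset.eq_of_subset_of_card_le hsub (by
    rw [Finset.card_image_of_injective _ hinj, Finset.card_univ, Fintype.card_prod, h.card]
    exact (h2.trans (by ring)).le)
  have hz' : z ∈ ({v | v ∈ W ⊓ perp q y} : Finset (Fin 5 → F)) := by simpa using hz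
  rw [← heq] at hz'
  simp only [Finset.mem_image, Finset.mem_univ, true_and] at hz'
  obtain ⟨c, hc⟩ := hz'
  exact ⟨_, _, hc.symm⟩

lemma isoCard_of_exists {W : Submodule F (Fin 5 → F)} {x y u : Fin 5 → F} (hW : W ≤ perp q x)
    (hc : vecCard W = q ^ 6) (hx0 : x ≠ 0) (hxW : x ∈ W) (hyW : y ∈ W) (hy : herm q y y = 0)
    (hu : u ∈ W) (hyu : herm q y u ≠ 0) : isoCard q W + q ^ 3 = q ^ 5 + q ^ 4 := by
  have h1 := h.vecCard_perp W hu hyu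
  rw [hc] at h1
  have h2 : vecCard (W ⊓ perp q y) = q ^ 4 := by
    refine Nat.eq_of_mul_eq_mul_left (pow_pos h.pos 2) ?_
    rw [← h1]; ring
  have h3 : isoCard q (W ⊓ perp q y) = q ^ 4 := by
    rw [← h2]
    refine congrArg Finset.card (Finset.filter_congr fun v _ => and_iff_left_of_imp fun hv => ?_)
    obtain ⟨a, b, rfl⟩ := h.exists_eq_add_smul hW hc hx0 hxW hyW hy hu hyu hv
    have hx : herm q x x = 0 := hW hxW
    have hxy : herm q x y = 0 := hW hyW
    have hyx : herm q y x = 0 := h.herm_comm_eq_zero.1 hxy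
    simp [h.herm_add_left, herm_smul_left, hx, hy, hxy, hyx]
  have h4 := h.isoCard_of_isotropic hyW hy hu hyu
  rw [h2, h3] at h4
  refine Nat.eq_of_mul_eq_mul_left h.pos ?_
  zify at *
  linear_combination h4

end IsHermField

/-- The tangent plane at `x` of the zero locus of `H` inside the complement of `x` is contained in
the zero locus of `H`, and its radical is spanned by `x`. -/
structure TangContained (q : ℕ) (H : MvPolynomial (Fin 5) F) (x : Fin 5 → F) : Prop where
  exists_dir_ne_zero : ∃ u ∈ perp q x, dir H x u ≠ 0
  exists_iso : ∃ y ∈ tang q H x, herm q y y = 0 ∧ ∃ u ∈ tang q H x, herm q y u ≠ 0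
  eval_eq_zero : ∀ y ∈ tang q H x, eval y H = 0

lemma IsHermField.le_local {H : MvPolynomial (Fin 5) F} {d : ℕ} (hH : H.IsHomogeneous d)
    (hd : d ≤ 3) (hlin : ∀ a : Fin 5 → F, a ≠ 0 → ∃ y ∈ perp q a, eval y H ≠ 0) {x : Fin 5 → F}
    (hx0 : x ≠ 0) (hx : herm q x x = 0) (hHx : eval x H = 0) :
    ((q : ℤ) ^ 4 - q ^ 2) * (q ^ 3 - if TangContained q H x then (q : ℤ) else 0) ≤
      #{y | IsoPair q x y} + #{y | IsoPair q x y ∧ dir H x y = 0} -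
        2 * #{y | IsoPair q x y ∧ Cont H x y} := by
  have hq : (7 : ℤ) ≤ q := by exact_mod_cast h.le
  have hcard := h.degree_lt_card hd
  have hd' : (d : ℤ) ≤ 3 := by exact_mod_cast hd
  have hY : (#{y | IsoPair q x y} : ℤ) = (q ^ 3 + 1) * (q ^ 4 - q ^ 2) := by
    rw [h.card_isoPair_top hx0 hx]
    have h4 : q ^ 2 ≤ q ^ 4 := Nat.pow_le_pow_right h.pos (by norm_num)
    push_cast [h4]
    rfl
  have ht : #{y | IsoPair q x y ∧ dir H x y = 0} + q ^ 2 = isoCard q (tang q H x) := by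
    rw [← h.card_isoPair (tang_le_perp H x) (h.self_mem_tang hH hd hx hHx) hx0]
    refine congrArg (· + q ^ 2) (congrArg Finset.card (Finset.filter_congr fun y _ => ?_))
    exact ⟨fun hy => ⟨⟨hy.1.orth, hy.2⟩, hy.1⟩, fun hy => ⟨hy.2, hy.1.2⟩⟩
  have hlt : #{y | IsoPair q x y ∧ Cont H x y} ≤ #{y | IsoPair q x y ∧ dir H x y = 0} :=
    Finset.card_le_card (Finset.monotone_filter_right _ fun y _ hy =>
      ⟨hy.1, hy.2.dir_eq_zero hH hcard⟩)
  have hlH : (∃ u ∈ tang q H x, eval u H ≠ 0) →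
      q ^ 2 * #{y | IsoPair q x y ∧ Cont H x y} ≤ d * vecCard (tang q H x) := by
    rintro ⟨u, hu, hHu⟩
    refine le_trans ?_ (card_zeros_le hH hcard hu hHu)
    rw [h.card]
    refine Nat.mul_le_mul_left _ (Finset.card_le_card (Finset.monotone_filter_right _
      fun y _ hy => ?_))
    exact ⟨⟨hy.1.orth, hy.2.dir_eq_zero hH hcard⟩, hy.2.right⟩
  zify at ht hlt hlH
  by_cases hS : ∃ u ∈ perp q x, dir H x u ≠ 0
  swap
  · push Not at hS
    have hT : tang q H x = perp q x := inf_eq_left.2 hS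
    have hM : ¬ TangContained q H x := fun hM => by
      obtain ⟨u, hu, hu'⟩ := hM.exists_dir_ne_zero
      exact hu' (hS u hu)
    rw [hT] at hlH ht
    have h1 := hlH (hlin x hx0)
    rw [h.vecCard_perp_top hx0] at h1
    have h2 := h.isoCard_perp_isotropic hx0 hx
    zify at h2
    rw [if_neg hM, hY]
    have h3 : (#{y | IsoPair q x y ∧ Cont H x y} : ℤ) ≤ 3 * q ^ 6 := by
      have hq2 : (0 : ℤ) < q ^ 2 := by positivity
      refine le_of_mul_le_mul_left (h1.trans ?_) hq2
      push_cast
      have : (0 : ℤ) ≤ q ^ 8 := by positivity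
      nlinarith
    obtain ⟨k, hk⟩ : ∃ k : ℕ, (q : ℤ) = k + 7 := ⟨q - 7, by have := h.le; omega⟩
    have : (0 : ℤ) ≤ q ^ 7 - 6 * q ^ 6 - q ^ 5 + 2 * q ^ 4 - 2 * q ^ 2 := by
      rw [hk]
      ring_nf
      positivity
    linarith
  · have hc := h.vecCard_tang hx0 hS
    by_cases hR : ∃ y ∈ tang q H x, herm q y y = 0 ∧ ∃ u ∈ tang q H x, herm q y u ≠ 0
    · obtain ⟨y, hyW, hy, u, hu, hyu⟩ := hR
      have h1 := h.isoCard_of_exists (tang_le_perp H x) hc hx0 (h.self_mem_tang hH hd hx hHx) hyW hy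
        hu hyu
      zify at h1
      by_cases hH0 : ∀ y ∈ tang q H x, eval y H = 0
      · rw [if_pos ⟨hS, ⟨y, hyW, hy, u, hu, hyu⟩, hH0⟩, hY]
        linarith
      · have hM : ¬ TangContained q H x := fun hM => hH0 hM.eval_eq_zero
        push Not at hH0
        have h2 := hlH hH0
        rw [hc] at h2
        rw [if_neg hM, hY]
        have h3 : (#{y | IsoPair q x y ∧ Cont H x y} : ℤ) ≤ 3 * q ^ 4 := by
          have hq2 : (0 : ℤ) < q ^ 2 := by positivity
          refine le_of_mul_le_mul_left (h2.trans ?_) hq2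
          push_cast
          have : (0 : ℤ) ≤ q ^ 6 := by positivity
          nlinarith
        obtain ⟨k, hk⟩ : ∃ k : ℕ, (q : ℤ) = k + 7 := ⟨q - 7, by have := h.le; omega⟩
        have : (0 : ℤ) ≤ q ^ 5 - 4 * q ^ 4 - q ^ 3 - 2 * q ^ 2 := by
          rw [hk]
          ring_nf
          positivity
        linarith
    · have hM : ¬ TangContained q H x := fun hM => hR hM.exists_iso
      push Not at hR
      obtain ⟨b, hb, -⟩ := h.tang_eq (H := H) x
      have h1 : isoCard q (tang q H x) ≤ q ^ 4 := by
        refine le_trans (Finset.card_le_card (Finset.monotone_filter_right _ fun y _ hy => ?_))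
          (h.card_perp_of_inf_le x b)
        rw [← hb]
        exact hR y hy.1 hy.2
      zify at h1
      rw [if_neg hM, hY]
      linarith

end Local

section Averaging

variable {F : Type} [Field F] {q : ℕ} [Fintype F]

lemma line_zeros_le {H : MvPolynomial (Fin 5) F} {d : ℕ} (hH : H.IsHomogeneous d)
    (hd : d + 1 < Fintype.card F) {x y : Fin 5 → F} (hc : ¬ Cont H x y) :
    (if eval y H = 0 then 1 else 0) + #{t : F | eval (x + t • y) H = 0} ≤ d := by
  have h0 : lineP H x y ≠ 0 := fun h0 => hc (cont_of_lineP_eq_zero hH hd h0)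
  have h1 := card_roots_le h0 le_rfl
  simp only [eval_lineP] at h1
  have h2 := natDegree_lineP_le hH x y
  have h3 : (lineP H x y).coeff (lineP H x y).natDegree ≠ 0 := by simpa using h0
  split_ifs with hy
  · have : (lineP H x y).natDegree ≠ d := by
      intro e; rw [e, coeff_lineP_degree hH hd, hy] at h3; exact h3 rfl
    omega
  · omega

/-- The contribution of the point `x` on its line through `y` to the averaging argument. -/
def weight (H L : MvPolynomial (Fin 5) F) (k d : ℤ) (x y : Fin 5 → F) : ℤ :=
  if eval x L = 0 then 0 else
    k * (if eval x H = 0 then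
      1 + (if dir H x y = 0 then 1 else 0) - 2 * (if Cont H x y then 1 else 0) else 0) - d

lemma sum_weight_line_le {H L : MvPolynomial (Fin 5) F} {d e : ℕ} (hH : H.IsHomogeneous d)
    (hL : L.IsHomogeneous e) (hd : d + 1 < Fintype.card F) (hd1 : 1 ≤ d)
    (he : e + 1 < Fintype.card F) (x y : Fin 5 → F) :
    weight H L (Fintype.card F + 1 - e) d y x +
      ∑ t : F, weight H L (Fintype.card F + 1 - e) d (x + t • y) y ≤ 0 := by
  have hk : (0 : ℤ) ≤ Fintype.card F + 1 - e := by zify at he; linarith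
  by_cases hc : Cont H x y
  · have key (v w : Fin 5 → F) (hvw : Cont H v w) :
        weight H L (Fintype.card F + 1 - e) d v w ≤ 0 := by
      unfold weight
      split_ifs <;> push_cast <;> linarith
    have h1 := key y x hc.symm
    have h2 := Finset.sum_nonpos fun t (_ : t ∈ Finset.univ) => key _ _ (hc.add_smul t)
    linarith
  by_cases hcL : Cont L x y
  · have key (v w : Fin 5 → F) (hv : eval v L = 0) :
        weight H L (Fintype.card F + 1 - e) d v w = 0 := if_pos hv
    rw [key _ _ hcL.right, Finset.sum_eq_zero fun t _ => key _ _ (hcL.add_smul t).left, add_zero]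
  have h1 := line_bound hH hd hd1 hc
  have h2 := line_zeros_le hL he hcL
  have key (v w : Fin 5 → F) (hvw : ¬ Cont H v w) : weight H L (Fintype.card F + 1 - e) d v w ≤
      (Fintype.card F + 1 - e) * ((if eval v H = 0 then 1 + (if dir H v w = 0 then 1 else 0)
        else 0 : ℕ) : ℤ) - d * (1 - ((if eval v L = 0 then 1 else 0 : ℕ) : ℤ)) := by
    unfold weight
    split_ifs <;> push_cast <;> linarith
  have h3 := key y x fun hc' => hc hc'.symm
  have h4 := Finset.sum_le_sum fun t (_ : t ∈ Finset.univ) =>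
    key (x + t • y) y ((cont_add_smul_iff t).not.2 hc)
  rw [Finset.sum_sub_distrib, ← Finset.mul_sum, ← Finset.mul_sum, Finset.sum_sub_distrib,
    ← Nat.cast_sum, ← Nat.cast_sum, ← Finset.card_filter, Finset.sum_const, Finset.card_univ,
    nsmul_eq_mul, mul_one] at h4
  zify at h1 h2
  have h5 := mul_le_mul_of_nonneg_left h1 hk
  have h6 := mul_le_mul_of_nonneg_left h2 (Int.natCast_nonneg d)
  push_cast at h3 h4 h5 h6
  linarith

variable (h : IsHermField q F)
include h

lemma IsHermField.sum_weight_le {H L : MvPolynomial (Fin 5) F} {d e : ℕ} (hH : H.IsHomogeneous d)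
    (hL : L.IsHomogeneous e) (hd : d ≤ 3) (hd1 : 1 ≤ d) (he : e ≤ 3) :
    ∑ x, ∑ y, (if IsoPair q x y then weight H L (q ^ 2 + 1 - e) d x y else 0) ≤ 0 := by
  have hline (x y : Fin 5 → F) := sum_weight_line_le hH hL (h.degree_lt_card hd) hd1
    (h.degree_lt_card he) x y
  rw [h.card] at hline
  push_cast at hline
  set w := weight H L ((q : ℤ) ^ 2 + 1 - e) d
  set S := ∑ x, ∑ y, (if IsoPair q x y then w x y else 0) with hS
  have h1 : ∑ x, ∑ y, (if IsoPair q x y then w y x else 0) = S := by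
    rw [Finset.sum_comm, hS]
    refine Finset.sum_congr rfl fun x _ => Finset.sum_congr rfl fun y _ => ?_
    exact if_congr ⟨h.isoPair_symm, h.isoPair_symm⟩ rfl rfl
  have h2 (t : F) : ∑ x, ∑ y, (if IsoPair q x y then w (x + t • y) y else 0) = S := by
    calc _ = ∑ y, ∑ x, (if IsoPair q (x + t • y) y then w (x + t • y) y else 0) := by
          rw [Finset.sum_comm]
          refine Finset.sum_congr rfl fun y _ => Finset.sum_congr rfl fun x _ => ?_
          exact if_congr (h.isoPair_add_smul_iff t).symm rfl rfl
      _ = ∑ y, ∑ x, (if IsoPair q x y then w x y else 0) :=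
          Finset.sum_congr rfl fun y _ => Equiv.sum_comp (Equiv.addRight (t • y))
            fun x => if IsoPair q x y then w x y else 0
      _ = S := Finset.sum_comm
  have h3 : S + ∑ t : F, S ≤ 0 := by
    calc S + ∑ t : F, S
        = ∑ x, ∑ y, (if IsoPair q x y then w y x else 0) +
            ∑ t : F, ∑ x, ∑ y, (if IsoPair q x y then w (x + t • y) y else 0) := by
          rw [h1, Finset.sum_congr rfl fun t _ => h2 t]
      _ = ∑ x, ∑ y, (if IsoPair q x y then w y x + ∑ t : F, w (x + t • y) y else 0) := by
          rw [Finset.sum_comm (s := (Finset.univ : Finset F)), ← Finset.sum_add_distrib]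
          refine Finset.sum_congr rfl fun x _ => ?_
          rw [Finset.sum_comm (s := (Finset.univ : Finset F)), ← Finset.sum_add_distrib]
          refine Finset.sum_congr rfl fun y _ => ?_
          split_ifs <;> simp
      _ ≤ 0 := Finset.sum_nonpos fun x _ => Finset.sum_nonpos fun y _ => by
          split_ifs
          exacts [hline x y, le_rfl]
  rw [Finset.sum_const, nsmul_eq_mul] at h3
  have h4 : (0 : ℤ) ≤ (#(Finset.univ : Finset F) : ℤ) := by positivity
  nlinarith

/-- The nonzero isotropic vectors off the hyperplane `L = 0`. -/
def isoOff (q : ℕ) (L : MvPolynomial (Fin 5) F) : Finset (Fin 5 → F) :=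
  {x | (x ≠ 0 ∧ herm q x x = 0) ∧ eval x L ≠ 0}

/-- The nonzero isotropic zeros of `H` off the hyperplane `L = 0`. -/
def zerosOff (q : ℕ) (H L : MvPolynomial (Fin 5) F) : Finset (Fin 5 → F) :=
  {x ∈ isoOff q L | eval x H = 0}

lemma IsHermField.sum_local_le {H L : MvPolynomial (Fin 5) F} {d e : ℕ} (hH : H.IsHomogeneous d)
    (hL : L.IsHomogeneous e) (hd : d ≤ 3) (hd1 : 1 ≤ d) (he : e ≤ 3) :
    ((q : ℤ) ^ 2 + 1 - e) * ∑ x ∈ zerosOff q H L, ((#{y | IsoPair q x y} : ℤ) +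
      #{y | IsoPair q x y ∧ dir H x y = 0} - 2 * #{y | IsoPair q x y ∧ Cont H x y}) ≤
      d * #(isoOff q L) * ((q ^ 3 + 1) * (q ^ 4 - q ^ 2)) := by
  have h1 := h.sum_weight_le hH hL hd hd1 he
  have h2 (x : Fin 5 → F) : ∑ y, (if IsoPair q x y then weight H L (q ^ 2 + 1 - e) d x y else 0) =
      if x ∈ isoOff q L then
        (if eval x H = 0 then ((q : ℤ) ^ 2 + 1 - e) * ((#{y | IsoPair q x y} : ℤ) +
          #{y | IsoPair q x y ∧ dir H x y = 0} - 2 * #{y | IsoPair q x y ∧ Cont H x y}) else 0) -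
            (d : ℤ) * (((q : ℤ) ^ 3 + 1) * ((q : ℤ) ^ 4 - (q : ℤ) ^ 2)) else 0 := by
    by_cases hx : x ∈ isoOff q L
    · rw [if_pos hx]
      simp only [isoOff, Finset.mem_filter, Finset.mem_univ, true_and] at hx
      have hY : (#{y | IsoPair q x y} : ℤ) = (q ^ 3 + 1) * (q ^ 4 - q ^ 2) := by
        rw [h.card_isoPair_top hx.1.1 hx.1.2]
        have h4 : q ^ 2 ≤ q ^ 4 := Nat.pow_le_pow_right h.pos (by norm_num)
        push_cast [h4]
        rfl
      rw [← hY]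
      unfold weight
      simp_rw [if_neg hx.2]
      rw [← Finset.sum_filter, Finset.sum_sub_distrib, Finset.sum_const, nsmul_eq_mul,
        ← Finset.mul_sum, mul_comm (d : ℤ)]
      split_ifs with hHx
      · rw [Finset.sum_sub_distrib, Finset.sum_add_distrib, ← Finset.mul_sum, Finset.sum_boole,
          Finset.sum_boole, Finset.filter_filter, Finset.filter_filter, Finset.sum_const,
          nsmul_eq_mul, mul_one]
      · simp
    · rw [if_neg hx]
      refine Finset.sum_eq_zero fun y _ => ite_eq_right_iff.2 fun hxy => if_pos ?_
      by_contra hxL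
      exact hx (by simp [isoOff, hxy.left_ne_zero, hxy.left, hxL])
  simp_rw [h2] at h1
  rw [← Finset.sum_filter, Finset.filter_mem_eq_inter, Finset.univ_inter, Finset.sum_sub_distrib,
    ← Finset.sum_filter, ← Finset.mul_sum, Finset.sum_const, nsmul_eq_mul] at h1
  change _ * ∑ x ∈ zerosOff q H L, _ - _ ≤ _ at h1
  linarith

lemma IsHermField.main_sum_le {H L : MvPolynomial (Fin 5) F} {d e : ℕ} (hH : H.IsHomogeneous d)
    (hL : L.IsHomogeneous e) (hd : d ≤ 3) (hd1 : 1 ≤ d) (he : e ≤ 3)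
    (hlin : ∀ a : Fin 5 → F, a ≠ 0 → ∃ y ∈ perp q a, eval y H ≠ 0) :
    ((q : ℤ) ^ 2 + 1 - e) * (q ^ 3 * #(zerosOff q H L) -
      q * #{x ∈ zerosOff q H L | TangContained q H x}) ≤ d * #(isoOff q L) * (q ^ 3 + 1) := by
  have hq : (7 : ℤ) ≤ q := by exact_mod_cast h.le
  have h1 := h.sum_local_le hH hL hd hd1 he
  have h2 := Finset.sum_le_sum fun x (hx : x ∈ zerosOff q H L) => by
    simp only [zerosOff, isoOff, Finset.mem_filter, Finset.mem_univ, true_and] at hx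
    exact h.le_local hH hd hlin hx.1.1.1 hx.1.1.2 hx.2
  rw [← Finset.mul_sum, Finset.sum_sub_distrib, Finset.sum_const, nsmul_eq_mul,
    ← Finset.sum_filter, Finset.sum_const, nsmul_eq_mul] at h2
  have he' : (e : ℤ) ≤ 3 := by exact_mod_cast he
  have hk : (0 : ℤ) ≤ (q : ℤ) ^ 2 + 1 - e := by nlinarith
  have h3 := (mul_le_mul_of_nonneg_left h2 hk).trans h1
  have h4 : (0 : ℤ) < (q : ℤ) ^ 4 - q ^ 2 := 
    sub_pos.2 (pow_lt_pow_right₀ (by linarith) (by norm_num))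
  refine le_of_mul_le_mul_left ?_ h4
  linarith

end Averaging

section Incidence

lemma card_mul_le_card_biUnion_add {ι α : Type*} [DecidableEq α] (s : Finset ι) (A : ι → Finset α) {a b : ℕ}
    (ha : ∀ i ∈ s, a ≤ #(A i)) (hb : ∀ i ∈ s, ∀ j ∈ s, i ≠ j → #(A i ∩ A j) ≤ b) :
    #s * a ≤ #(s.biUnion A) + #s ^ 2 * b := by
  induction s using Finset.induction_on with
  | empty => simp
  | insert i s hi ih =>
    have h1 := ih (fun j hj => ha j (Finset.mem_insert_of_mem hj)) fun j hj k hk =>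
      hb j (Finset.mem_insert_of_mem hj) k (Finset.mem_insert_of_mem hk)
    have h2 := ha i (Finset.mem_insert_self i s)
    have h3 := Finset.card_union_add_card_inter (A i) (s.biUnion A)
    have h4 : #(A i ∩ s.biUnion A) ≤ #s * b := by
      rw [Finset.inter_biUnion]
      refine Finset.card_biUnion_le_card_mul _ _ _ fun j hj => ?_
      exact hb i (Finset.mem_insert_self i s) j (Finset.mem_insert_of_mem hj)
        (ne_of_mem_of_not_mem hj hi).symm
    rw [Finset.biUnion_insert, Finset.card_insert_of_notMem hi]
    nlinarith

variable {F : Type} [Field F] {q : ℕ} [Fintype F] (h : IsHermField q F)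
include h

namespace IsHermField

/-- At most `d` planes of a threefold lie on a hypersurface of degree `d`. -/
lemma card_planes_le {H : MvPolynomial (Fin 5) F} {d : ℕ} (hH : H.IsHomogeneous d) (hd : d ≤ 3)
    {U : Submodule F (Fin 5 → F)} (hU : vecCard U = q ^ 8) {u : Fin 5 → F} (hu : u ∈ U)
    (hHu : eval u H ≠ 0) {s : Finset (Submodule F (Fin 5 → F))} (hs : ∀ T ∈ s, vecCard T = q ^ 6)
    (hsU : ∀ T ∈ s, T ≤ U) (hsH : ∀ T ∈ s, ∀ y ∈ T, eval y H = 0)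
    (hs' : ∀ T ∈ s, ∀ T' ∈ s, T ≠ T' → vecCard (T ⊓ T') ≤ q ^ 4) : #s ≤ d := by
  by_contra! hlt
  obtain ⟨t, hts, htc⟩ := Finset.exists_subset_card_eq (Nat.succ_le_of_lt hlt)
  have h1 := card_mul_le_card_biUnion_add t
    (fun T => ({v | v ∈ T} : Finset (Fin 5 → F))) (a := q ^ 6) (b := q ^ 4)
    (fun T hT => (hs T (hts hT)).ge) fun T hT T' hT' hne => by
      rw [← Finset.filter_and]
      simpa only [vecCard, Submodule.mem_inf] using hs' T (hts hT) T' (hts hT') hne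
  have h2 : #(t.biUnion fun T => ({v | v ∈ T} : Finset (Fin 5 → F))) ≤
      #{v | v ∈ U ∧ eval v H = 0} := by
    refine Finset.card_le_card fun v hv => ?_
    simp only [Finset.mem_biUnion, Finset.mem_filter, Finset.mem_univ, true_and] at hv ⊢
    obtain ⟨T, hT, hv⟩ := hv
    exact ⟨hsU T (hts hT) hv, hsH T (hts hT) v hv⟩
  have h3 := card_zeros_le hH (h.degree_lt_card hd) hu hHu
  rw [h.card, hU] at h3
  have h4 : #{v | v ∈ U ∧ eval v H = 0} ≤ d * q ^ 6 := by
    refine Nat.le_of_mul_le_mul_left ?_ (pow_pos h.pos 2)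
    exact h3.trans (by ring_nf; rfl)
  rw [htc] at h1
  have h5 : q ^ 4 * q ^ 2 ≤ q ^ 4 * (d + 1) ^ 2 := by
    simp only [Nat.succ_eq_add_one] at h1
    have : q ^ 4 * q ^ 2 = q ^ 6 := by ring
    linarith
  have h6 := Nat.le_of_mul_le_mul_left h5 (pow_pos h.pos 4)
  have := h.le
  nlinarith

lemma vecCard_tang_inf_le {H : MvPolynomial (Fin 5) F} {x y : Fin 5 → F}
    (hx : vecCard (tang q H x) = q ^ 6) (hy : vecCard (tang q H y) = q ^ 6)
    (hne : tang q H x ≠ tang q H y) : vecCard (tang q H x ⊓ tang q H y) ≤ q ^ 4 := by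
  have hnle : ¬ tang q H x ≤ tang q H y := fun hle =>
    hne (eq_of_le_of_vecCard_le hle (hy.trans hx.symm).le)
  obtain ⟨u, hu, huy⟩ := Set.not_subset.1 hnle
  have key (f : (Fin 5 → F) →ₗ[F] F) (hf : f u ≠ 0) (hfy : tang q H y ≤ LinearMap.ker f) :
      vecCard (tang q H x ⊓ tang q H y) ≤ q ^ 4 := by
    have h1 := h.vecCard_ker (tang q H x) f hu hf
    refine (vecCard_mono (inf_le_inf_left _ hfy)).trans ?_
    refine Nat.le_of_mul_le_mul_left ?_ (pow_pos h.pos 2)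
    rw [← h1, hx]
    exact (by ring : q ^ 6 = q ^ 2 * q ^ 4).le
  by_cases h1 : herm q y u = 0
  · exact key (dir H y) (fun h2 => huy (mem_tang.2 ⟨h1, h2⟩)) inf_le_right
  · exact key (herm q y) h1 inf_le_left

lemma exists_smul_eq_of_tang_eq {H : MvPolynomial (Fin 5) F} {d : ℕ} (hH : H.IsHomogeneous d)
    (hd : d ≤ 3) {x y : Fin 5 → F} (hx0 : x ≠ 0) (hx : herm q x x = 0) (hHx : eval x H = 0)
    (hy : herm q y y = 0) (hHy : eval y H = 0) (hT : TangContained q H x)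
    (hxy : tang q H x = tang q H y) : ∃ c : F, c • x = y := by
  obtain ⟨z, hz, hzz, u, hu, hzu⟩ := hT.exists_iso
  have hyz : herm q y z = 0 := (mem_tang.1 (hxy ▸ hz)).1
  have hyu : herm q y u = 0 := (mem_tang.1 (hxy ▸ hu)).1
  have hyT : y ∈ tang q H x := hxy ▸ h.self_mem_tang hH hd hy hHy
  obtain ⟨a, b, rfl⟩ := h.exists_eq_add_smul (tang_le_perp H x)
    (h.vecCard_tang hx0 hT.exists_dir_ne_zero) hx0 (h.self_mem_tang hH hd hx hHx) hz hzz hu hzu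
    ⟨hyT, h.herm_comm_eq_zero.1 hyz⟩
  have hxu : herm q x u = 0 := (mem_tang.1 hu).1
  rw [h.herm_add_left, herm_smul_left, herm_smul_left, hxu, mul_zero, zero_add, mul_eq_zero,
    or_iff_left hzu, pow_eq_zero_iff h.ne_zero] at hyu
  exact ⟨a, by simp [hyu]⟩

/-- The zeros of `H` at which the tangent plane is contained in the zero locus. -/
lemma card_tang_fiber_le {H L : MvPolynomial (Fin 5) F} {d : ℕ} (hH : H.IsHomogeneous d)
    (hd : d ≤ 3) (hlin : ∀ a : Fin 5 → F, a ≠ 0 → ∃ y ∈ perp q a, eval y H ≠ 0) {r : Fin 5 → F}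
    (hr : dir H r ≠ 0) :
    #{x ∈ ({x ∈ zerosOff q H L | TangContained q H x} : Finset (Fin 5 → F)) | r ∈ tang q H x} ≤
      d * q ^ 2 := by
  set M : Finset (Fin 5 → F) :=
    {x ∈ ({x ∈ zerosOff q H L | TangContained q H x} : Finset (Fin 5 → F)) | r ∈ tang q H x} with hM
  have hmem {x} (hx : x ∈ M) : (x ≠ 0 ∧ herm q x x = 0 ∧ eval x H = 0) ∧ TangContained q H x ∧
      r ∈ tang q H x := by
    simp only [hM, zerosOff, isoOff, Finset.mem_filter, Finset.mem_univ, true_and] at hx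
    tauto
  have hT {x} (hx : x ∈ M) : vecCard (tang q H x) = q ^ 6 :=
    h.vecCard_tang (hmem hx).1.1 (hmem hx).2.1.exists_dir_ne_zero
  obtain ⟨b, hb⟩ := h.exists_herm (dir H r)
  have hb0 : b ≠ 0 := by
    rintro rfl
    exact hr (hb.trans (by ext; simp [herm_apply, h.zero_pow]))
  obtain ⟨u, hu, hHu⟩ := hlin b hb0
  have h1 : #(M.image (tang q H)) ≤ d := by
    refine h.card_planes_le hH hd (h.vecCard_perp_top hb0) hu hHu ?_ ?_ ?_ ?_
    · simp only [Finset.forall_mem_image]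
      exact fun x hx => hT hx
    · simp only [Finset.forall_mem_image]
      intro x hx y hy
      rw [mem_perp, ← hb]
      refine Cont.dir_eq_zero hH (h.degree_lt_card hd) fun s t => ?_
      exact (hmem hx).2.1.eval_eq_zero _ (Submodule.add_mem _ (Submodule.smul_mem _ _ (hmem hx).2.2)
        (Submodule.smul_mem _ _ hy))
    · simp only [Finset.forall_mem_image]
      exact fun x hx => (hmem hx).2.1.eval_eq_zero
    · simp only [Finset.forall_mem_image]
      exact fun x hx y hy hne => h.vecCard_tang_inf_le (hT hx) (hT hy) hne
  refine (Finset.card_le_mul_card_image (f := tang q H) M (q ^ 2) fun T hTM => ?_).trans ?_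
  · obtain ⟨x, hx, rfl⟩ := Finset.mem_image.1 hTM
    rw [← h.card, ← Finset.card_univ]
    refine (Finset.card_le_card (t := Finset.univ.image fun c : F => c • x) fun y hy => ?_).trans
      Finset.card_image_le
    rw [Finset.mem_filter] at hy
    simp only [Finset.mem_image, Finset.mem_univ, true_and]
    obtain ⟨⟨hx0, hxx, hHx⟩, hTx, -⟩ := hmem hx
    obtain ⟨⟨-, hyy, hHy⟩, -⟩ := hmem hy.1
    exact h.exists_smul_eq_of_tang_eq hH hd hx0 hxx hHx hyy hHy hTx hy.2.symm
  · rw [mul_comm]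
    exact Nat.mul_le_mul_right _ h1

lemma le_card_tang {H L : MvPolynomial (Fin 5) F} {d e : ℕ} (hH : H.IsHomogeneous d)
    (hL : L.IsHomogeneous e) (hd1 : 1 ≤ d) (hde : d + e = 3) {x : Fin 5 → F}
    (hx : x ∈ zerosOff q H L) (hT : TangContained q H x) :
    q ^ 5 ≤ #{r ∈ ({r ∈ zerosOff q H L | dir H r ≠ 0} : Finset (Fin 5 → F)) | r ∈ tang q H x} := by
  simp only [zerosOff, isoOff, Finset.mem_filter, Finset.mem_univ, true_and] at hx
  obtain ⟨⟨⟨hx0, hxx⟩, hLx⟩, hHx⟩ := hx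
  have hd : d ≤ 3 := by omega
  obtain ⟨v, hv, hxv⟩ := hT.exists_dir_ne_zero
  obtain ⟨y, hy, hyy, u, hu, hyu⟩ := hT.exists_iso
  have hc := h.vecCard_tang hx0 hT.exists_dir_ne_zero
  have hxT := h.self_mem_tang hH hd hxx hHx
  have hS := h.isoCard_of_exists (tang_le_perp H x) hc hx0 hxT hy hyy hu hyu
  set B : MvPolynomial (Fin 5) F := L * ∑ i, C (v i) * pderiv i H with hB
  have hBhom : B.IsHomogeneous 2 := by
    have : (∑ i, C (v i) * pderiv i H).IsHomogeneous (d - 1) :=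
      IsHomogeneous.sum _ _ _ fun i _ => by
        simpa using (isHomogeneous_C _ (v i)).mul hH.pderiv
    have h2 := hL.mul this
    rwa [show e + (d - 1) = 2 by omega] at h2
  have hBe (r : Fin 5 → F) : eval r B = eval r L * dir H r v := by
    simp [hB, dir_apply, mul_comm]
  set S : Finset (Fin 5 → F) := {r | r ∈ tang q H x ∧ herm q r r = 0} with hSdef
  have h1 := sum_card_shift (S := S) (F := F) x (fun r hr s => by
    simp only [hSdef, Finset.mem_filter, Finset.mem_univ, true_and] at hr ⊢
    refine ⟨Submodule.add_mem _ hr.1 (Submodule.smul_mem _ _ hxT), ?_⟩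
    have hxr : herm q x r = 0 := (mem_tang.1 hr.1).1
    have hrx : herm q r x = 0 := h.herm_comm_eq_zero.1 hxr
    simp [h.herm_add_left, herm_smul_left, hr.2, hxr, hrx, hxx]) (fun r => eval r B = 0)
  have h2 : ∑ r ∈ S, #{s : F | eval (r + s • x) B = 0} ≤ #S * 2 := by
    refine Finset.sum_le_card_nsmul _ _ _ fun r _ => ?_
    refine le_trans (Nat.le_add_left _ _)
      (line_zeros_le hBhom (h.degree_lt_card (by norm_num)) (x := r) (y := x) (fun hcont => ?_))
    have := hcont.right
    rw [hBe, mul_eq_zero] at this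
    exact this.elim hLx hxv
  have h3 := Finset.card_filter_add_card_filter_not (s := S) (fun r => eval r B = 0)
  have h4 : #{r ∈ S | ¬ eval r B = 0} ≤
      #{r ∈ ({r ∈ zerosOff q H L | dir H r ≠ 0} : Finset (Fin 5 → F)) | r ∈ tang q H x} := by
    refine Finset.card_le_card fun r hr => ?_
    simp only [hSdef, zerosOff, isoOff, Finset.mem_filter, Finset.mem_univ, true_and, hBe,
      mul_eq_zero, not_or] at hr ⊢
    refine ⟨⟨⟨⟨⟨?_, hr.1.2⟩, hr.2.1⟩, hT.eval_eq_zero r hr.1.1⟩, fun h0 => hr.2.2 (by simp [h0])⟩,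
      hr.1.1⟩
    rintro rfl
    have h0 := hBe 0
    have : eval (0 : Fin 5 → F) B = 0 := by
      have := eval_smul_of_isHomogeneous hBhom 0 0
      simpa using this
    rw [this] at h0
    exact (mul_ne_zero hr.2.1 hr.2.2) h0.symm
  rw [h.card] at h1
  have hS' : #S + q ^ 3 = q ^ 5 + q ^ 4 := hS
  rw [h1] at h2
  have hq := h.le
  have h5 : #{r ∈ S | eval r B = 0} + q ^ 3 ≤ q ^ 4 := by
    refine Nat.le_of_mul_le_mul_left ?_ (pow_pos h.pos 2)
    have h6 : q ^ 5 + 2 * q ^ 5 + 2 * q ^ 4 ≤ q ^ 6 + 2 * q ^ 3 := by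
      obtain ⟨k, rfl⟩ : ∃ k, q = k + 7 := ⟨q - 7, by omega⟩
      ring_nf
      nlinarith
    linarith
  omega

lemma card_tangContained_le {H L : MvPolynomial (Fin 5) F} {d e : ℕ} (hH : H.IsHomogeneous d)
    (hL : L.IsHomogeneous e) (hd1 : 1 ≤ d) (hde : d + e = 3)
    (hlin : ∀ a : Fin 5 → F, a ≠ 0 → ∃ y ∈ perp q a, eval y H ≠ 0) :
    q ^ 3 * #{x ∈ zerosOff q H L | TangContained q H x} ≤ d * #(zerosOff q H L) := by
  have h1 := Finset.card_mul_le_card_mul (fun x r => r ∈ tang q H x)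
    (s := {x ∈ zerosOff q H L | TangContained q H x}) (t := {r ∈ zerosOff q H L | dir H r ≠ 0})
    (fun x hx => h.le_card_tang hH hL hd1 hde (Finset.mem_filter.1 hx).1 (Finset.mem_filter.1 hx).2)
    (fun r hr => h.card_tang_fiber_le hH (by omega) hlin (Finset.mem_filter.1 hr).2)
  have h2 := Finset.card_filter_le (zerosOff q H L) (fun r => dir H r ≠ 0)
  refine Nat.le_of_mul_le_mul_left ?_ (pow_pos h.pos 2)
  have h3 := Nat.mul_le_mul_right (d * q ^ 2) h2
  linarith

end IsHermField

end Incidence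

section Factorization

variable {F : Type} [Field F] {q : ℕ} [Fintype F] (h : IsHermField q F)
include h

namespace IsHermField

lemma zerosOff_bound {H L : MvPolynomial (Fin 5) F} {d e : ℕ} (hH : H.IsHomogeneous d)
    (hL : L.IsHomogeneous e) (hd1 : 1 ≤ d) (hde : d + e = 3)
    (hlin : ∀ a : Fin 5 → F, a ≠ 0 → ∃ y ∈ perp q a, eval y H ≠ 0) :
    ((q : ℤ) ^ 2 + 1 - e) * (#(zerosOff q H L) * (q ^ 5 - d)) ≤
      d * #(isoOff q L) * (q ^ 3 + 1) * q ^ 2 := by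
  have hq : (7 : ℤ) ≤ q := by exact_mod_cast h.le
  have h1 := h.main_sum_le hH hL (by omega) hd1 (by omega) hlin
  have h2 := h.card_tangContained_le hH hL hd1 hde hlin
  zify at h2
  have he : (e : ℤ) ≤ 3 := by exact_mod_cast (by omega : e ≤ 3)
  have hk : (0 : ℤ) ≤ (q : ℤ) ^ 2 + 1 - e := by nlinarith
  have h3 := mul_le_mul_of_nonneg_right h1 (sq_nonneg (q : ℤ))
  have h4 := mul_le_mul_of_nonneg_left h2 hk
  linarith

lemma card_isoOff_one : #(isoOff q (1 : MvPolynomial (Fin 5) F)) + 1 + q ^ 5 = q ^ 9 + q ^ 4 := by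
  rw [← h.isoCard_top, isoCard, isoOff]
  congr 1
  have := Finset.card_filter_add_card_filter_not
    (s := ({v | v ∈ (⊤ : Submodule F (Fin 5 → F)) ∧ herm q v v = 0} : Finset (Fin 5 → F)))
    (fun v => v ≠ 0)
  rw [← this, Finset.filter_filter, Finset.filter_filter]
  congr 1
  · refine congrArg Finset.card (Finset.filter_congr fun v _ => ?_)
    simp [and_comm]
  · symm
    rw [Finset.card_eq_one]
    refine ⟨0, ?_⟩
    ext v
    simp only [Finset.mem_filter, Finset.mem_univ, true_and, Finset.mem_singleton, not_not]
    refine ⟨fun hv => hv.2, ?_⟩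
    rintro rfl
    simp

lemma card_isoOff_linForm (a : Fin 5 → F) :
    #(isoOff q (linForm q a)) + isoCard q (perp q a) + q ^ 5 = q ^ 9 + q ^ 4 := by
  rw [← h.isoCard_top, isoCard, isoCard, isoOff, add_comm (Finset.card _)]
  congr 1
  have := Finset.card_filter_add_card_filter_not
    (s := ({v | v ∈ (⊤ : Submodule F (Fin 5 → F)) ∧ herm q v v = 0} : Finset (Fin 5 → F)))
    (fun v => v ∈ perp q a)
  rw [← this, Finset.filter_filter, Finset.filter_filter]
  congr 1
  · refine congrArg Finset.card (Finset.filter_congr fun v _ => ?_)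
    simp [and_comm]
  · refine congrArg Finset.card (Finset.filter_congr fun v _ => ?_)
    simp only [eval_linForm, Submodule.mem_top, true_and, mem_perp]
    refine ⟨fun hv => ⟨hv.1.2, hv.2⟩, fun hv => ⟨⟨?_, hv.1⟩, hv.2⟩⟩
    rintro rfl
    exact hv.2 (map_zero _)

omit h in
lemma card_zeros_perp {G : MvPolynomial (Fin 5) F} {a : Fin 5 → F}
    (hG : ∀ v ∈ perp q a, eval v G = 0) :
    #(zerosOff q G (linForm q a)) + isoCard q (perp q a) = #(zerosOff q G 1) + 1 := by
  have h1 := Finset.card_filter_add_card_filter_not (s := zerosOff q G 1) (fun v => v ∈ perp q a)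
  have h2 := Finset.card_filter_add_card_filter_not
    (s := ({v | v ∈ perp q a ∧ herm q v v = 0} : Finset (Fin 5 → F))) (fun v => v ≠ 0)
  have h3 : #{v ∈ ({v | v ∈ perp q a ∧ herm q v v = 0} : Finset (Fin 5 → F)) | ¬ v ≠ 0} = 1 := by
    rw [Finset.card_eq_one]
    refine ⟨0, ?_⟩
    ext v
    simp only [Finset.mem_filter, Finset.mem_univ, true_and, Finset.mem_singleton, not_not]
    refine ⟨fun hv => hv.2, ?_⟩
    rintro rfl
    simp
  have h4 : #{v ∈ ({v | v ∈ perp q a ∧ herm q v v = 0} : Finset (Fin 5 → F)) | v ≠ 0} =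
      #{v ∈ zerosOff q G 1 | v ∈ perp q a} := by
    congr 1
    ext v
    simp only [zerosOff, isoOff, Finset.mem_filter, Finset.mem_univ, true_and, map_one, ne_eq,
      one_ne_zero, not_false_eq_true, and_true]
    exact ⟨fun hv => ⟨⟨⟨hv.2, hv.1.2⟩, hG v hv.1.1⟩, hv.1.1⟩,
      fun hv => ⟨⟨hv.2, hv.1.1.2⟩, hv.1.1.1⟩⟩
  have h5 : zerosOff q G (linForm q a) = {v ∈ zerosOff q G 1 | ¬ v ∈ perp q a} := by
    ext v
    simp only [zerosOff, isoOff, Finset.mem_filter, Finset.mem_univ, true_and, map_one, ne_eq,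
      one_ne_zero, not_false_eq_true, and_true, eval_linForm, mem_perp]
    tauto
  rw [h5]
  change _ + #({v | v ∈ perp q a ∧ herm q v v = 0} : Finset (Fin 5 → F)) = _
  omega

/-- A quadratic factor of a cubic threefold with many isotropic points vanishes on a hyperplane. -/
lemma exists_perp_of_quadric {Q : MvPolynomial (Fin 5) F} (hQ : Q.IsHomogeneous 2)
    {a : Fin 5 → F} (ha : a ≠ 0)
    (hN : ((q : ℤ) ^ 2 - 1) * (3 * (q ^ 5 + q ^ 2) + q ^ 3 + 1) ≤
      #(zerosOff q (linForm q a * Q) 1)) :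
    ∃ b : Fin 5 → F, b ≠ 0 ∧ ∀ y ∈ perp q b, eval y Q = 0 := by
  by_contra! hlin
  obtain ⟨k, hk⟩ : ∃ k : ℕ, (q : ℤ) = k + 7 := ⟨q - 7, by have := h.le; omega⟩
  have h1 := h.zerosOff_bound hQ (isHomogeneous_linForm (q := q) a) (by norm_num) (by norm_num) hlin
  have h2 := h.card_isoOff_linForm a
  have h3 := card_zeros_perp (G := linForm q a * Q) (a := a) fun v hv => by
    rw [map_mul, eval_linForm, (hv : herm q a v = 0), zero_mul]
  have h4 : zerosOff q (linForm q a * Q) (linForm q a) = zerosOff q Q (linForm q a) := by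
    ext v
    simp only [zerosOff, isoOff, Finset.mem_filter, Finset.mem_univ, true_and, map_mul,
      mul_eq_zero]
    tauto
  rw [h4] at h3
  have hq2 : (0 : ℤ) < q ^ 2 := by rw [hk]; positivity
  have h5 : (#(zerosOff q Q (linForm q a)) : ℤ) * (q ^ 5 - 2) ≤
      2 * #(isoOff q (linForm q a)) * (q ^ 3 + 1) := by
    refine le_of_mul_le_mul_left ?_ hq2
    push_cast at h1
    linarith
  by_cases hiso : herm q a a = 0
  · have h6 := h.isoCard_perp_isotropic ha hiso
    zify at h2 h3 h6
    have h7 : (#(isoOff q (linForm q a)) : ℤ) = (q ^ 2 - 1) * q ^ 7 := by linarith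
    have h8 : ((q : ℤ) ^ 2 - 1) * (2 * q ^ 5 + q ^ 3 + 2 * q ^ 2) ≤
      #(zerosOff q Q (linForm q a)) := by linarith
    rw [h7] at h5
    have h9 : (0 : ℤ) ≤ (q : ℤ) ^ 5 - 2 := by rw [hk]; ring_nf; positivity
    have h10 := (mul_le_mul_of_nonneg_right h8 h9).trans h5
    have h11 : (0 : ℤ) < (q ^ 2 - 1) * (2 * q ^ 5 + q ^ 3 + 2 * q ^ 2) * (q ^ 5 - 2) -
        2 * ((q ^ 2 - 1) * q ^ 7) * (q ^ 3 + 1) := by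
      rw [hk]; ring_nf; positivity
    linarith
  · have h6 := h.isoCard_perp_not_isotropic hiso
    zify at h2 h3 h6
    have h7 : (#(isoOff q (linForm q a)) : ℤ) = (q ^ 2 - 1) * (q ^ 7 - q ^ 3) := by linarith
    have h8 : ((q : ℤ) ^ 2 - 1) * (2 * q ^ 5 + 2 * q ^ 2) ≤
      #(zerosOff q Q (linForm q a)) := by linarith
    rw [h7] at h5
    have h9 : (0 : ℤ) ≤ (q : ℤ) ^ 5 - 2 := by rw [hk]; ring_nf; positivity
    have h10 := (mul_le_mul_of_nonneg_right h8 h9).trans h5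
    have h11 : (0 : ℤ) < (q ^ 2 - 1) * (2 * q ^ 5 + 2 * q ^ 2) * (q ^ 5 - 2) -
        2 * ((q ^ 2 - 1) * (q ^ 7 - q ^ 3)) * (q ^ 3 + 1) := by
      rw [hk]; ring_nf; positivity
    linarith

lemma exists_perp_of_cubic {G : MvPolynomial (Fin 5) F} (hG : G.IsHomogeneous 3)
    (hN : ((q : ℤ) ^ 2 - 1) * (3 * (q ^ 5 + q ^ 2) + q ^ 3 + 1) ≤ #(zerosOff q G 1)) :
    ∃ b : Fin 5 → F, b ≠ 0 ∧ ∀ y ∈ perp q b, eval y G = 0 := by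
  by_contra! hlin
  obtain ⟨k, hk⟩ : ∃ k : ℕ, (q : ℤ) = k + 7 := ⟨q - 7, by have := h.le; omega⟩
  have h1 := h.zerosOff_bound hG (isHomogeneous_one _ _) (by norm_num) (by norm_num) hlin
  have h2 := h.card_isoOff_one
  zify at h2
  have h3 : (#(isoOff q (1 : MvPolynomial (Fin 5) F)) : ℤ) =
      (q ^ 2 - 1) * (q ^ 2 + 1) * (q ^ 5 + 1) := by linarith
  have h4 : (0 : ℤ) ≤ (q : ℤ) ^ 5 - 3 := by rw [hk]; ring_nf; positivity
  have h5 : (0 : ℤ) < (q ^ 2 - 1) * (q ^ 2 + 1) := by rw [hk]; ring_nf; positivity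
  rw [h3] at h1
  push_cast at h1
  have h6 : (3 * ((q : ℤ) ^ 5 + q ^ 2) + q ^ 3 + 1) * (q ^ 5 - 3) ≤
      3 * (q ^ 5 + 1) * (q ^ 3 + 1) * q ^ 2 := by
    refine le_of_mul_le_mul_left ?_ h5
    have h7 := mul_le_mul_of_nonneg_right hN h4
    have h8 := mul_le_mul_of_nonneg_left h7 (by positivity : (0 : ℤ) ≤ q ^ 2 + 1)
    linarith
  have h7 : (0 : ℤ) < (3 * ((q : ℤ) ^ 5 + q ^ 2) + q ^ 3 + 1) * (q ^ 5 - 3) -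
      3 * (q ^ 5 + 1) * (q ^ 3 + 1) * q ^ 2 := by
    rw [hk]; ring_nf; positivity
  linarith

lemma exists_eq_linForm_mul_linForm_mul {G : MvPolynomial (Fin 5) F} (hG : G.IsHomogeneous 3)
    (hG0 : G ≠ 0)
    (hN : ((q : ℤ) ^ 2 - 1) * (3 * (q ^ 5 + q ^ 2) + q ^ 3 + 1) ≤ #(zerosOff q G 1)) :
    ∃ a b c : Fin 5 → F, (a ≠ 0 ∧ b ≠ 0 ∧ c ≠ 0) ∧
      G = linForm q a * linForm q b * linForm q c := by
  have hcard := h.degree_lt_card le_rfl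
  obtain ⟨a, ha, hav⟩ := h.exists_perp_of_cubic hG hN
  obtain ⟨Q, hQ, rfl⟩ := HermitianCubic.exists_eq_linForm_mul (d := 2) hG (by omega) ha hav
  obtain ⟨b, hb, hbv⟩ := h.exists_perp_of_quadric hQ ha hN
  obtain ⟨R, hR, rfl⟩ := HermitianCubic.exists_eq_linForm_mul (d := 1) hQ (by omega) hb hbv
  obtain ⟨c, rfl⟩ := h.exists_eq_linForm hR
  refine ⟨a, b, c, ⟨ha, hb, ?_⟩, (mul_assoc _ _ _).symm⟩
  rintro rfl
  refine hG0 ?_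
  simp [linForm, h.zero_pow]

end IsHermField

end Factorization

section Triple

lemma card_union_three {α : Type*} [DecidableEq α] (A B C : Finset α) :
    #(A ∪ B ∪ C) + #(A ∩ C) + #(B ∩ C) + #((A ∩ B) \ C) = #A + #B + #C := by
  have h1 := Finset.card_union_add_card_inter (A ∪ B) C
  have h2 := Finset.card_union_add_card_inter (A ∩ C) (B ∩ C)
  have h3 := Finset.card_union_add_card_inter A B
  have h4 := Finset.card_sdiff_add_card_inter (A ∩ B) C
  rw [Finset.union_inter_distrib_right] at h1
  rw [← Finset.inter_inter_distrib_right] at h2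
  omega

variable {F : Type} [Field F] {q : ℕ}

/-- Three hyperplanes through a common plane, none of them tangent to the Hermitian threefold, such
that the plane meets the threefold in a non-degenerate curve. -/
structure GoodTriple [Fintype F] (q : ℕ) (a b c : Fin 5 → F) : Prop where
  ne₁₂ : perp q a ≠ perp q b
  ne₁₃ : perp q a ≠ perp q c
  ne₂₃ : perp q b ≠ perp q c
  herm₁ : herm q a a ≠ 0
  herm₂ : herm q b b ≠ 0
  herm₃ : herm q c c ≠ 0
  vecCard_eq : vecCard (perp q a ⊓ perp q b ⊓ perp q c) = q ^ 6
  isoCard_eq : isoCard q (perp q a ⊓ perp q b ⊓ perp q c) + q ^ 3 = q ^ 5 + q ^ 2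

lemma ne_smul_of_perp_ne {a b : Fin 5 → F} (hb : b ≠ 0) (hab : perp q a ≠ perp q b) (c : F) :
    b ≠ c • a := by
  rintro rfl
  refine hab (Submodule.ext fun v => ?_)
  have hc : c ≠ 0 := by
    rintro rfl
    simp at hb
  simp [mem_perp, herm_smul_left, hc]

variable [Fintype F]

lemma GoodTriple.rotate {a b c : Fin 5 → F} (hg : GoodTriple q a b c) : GoodTriple q b c a where
  ne₁₂ := hg.ne₂₃
  ne₁₃ := hg.ne₁₂.symm
  ne₂₃ := hg.ne₁₃.symm
  herm₁ := hg.herm₂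
  herm₂ := hg.herm₃
  herm₃ := hg.herm₁
  vecCard_eq := by rw [inf_comm, ← inf_assoc]; exact hg.vecCard_eq
  isoCard_eq := by rw [inf_comm, ← inf_assoc]; exact hg.isoCard_eq

/-- The isotropic vectors of a subspace. -/
def isoSet (q : ℕ) (U : Submodule F (Fin 5 → F)) : Finset (Fin 5 → F) :=
  {v | v ∈ U ∧ herm q v v = 0}

lemma card_isoSet (U : Submodule F (Fin 5 → F)) : #(isoSet q U) = isoCard q U := rfl

lemma mem_isoSet {U : Submodule F (Fin 5 → F)} {v : Fin 5 → F} :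
    v ∈ isoSet q U ↔ v ∈ U ∧ herm q v v = 0 := by
  simp [isoSet]

lemma isoSet_inf (U W : Submodule F (Fin 5 → F)) :
    isoSet q (U ⊓ W) = isoSet q U ∩ isoSet q W := by
  ext v
  simp only [mem_isoSet, Finset.mem_inter, Submodule.mem_inf]
  tauto

lemma card_zerosOff_linForm (a b c : Fin 5 → F) :
    #(zerosOff q (linForm q a * linForm q b * linForm q c) 1) + 1 =
      #(isoSet q (perp q a) ∪ isoSet q (perp q b) ∪ isoSet q (perp q c)) := by
  rw [← Finset.card_insert_of_notMem (a := 0) (by simp [zerosOff, isoOff])]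
  congr 1
  ext v
  simp only [zerosOff, isoOff, Finset.mem_insert, Finset.mem_filter, Finset.mem_univ, true_and,
    map_one, ne_eq, one_ne_zero, not_false_eq_true, and_true, Finset.mem_union, mem_isoSet,
    map_mul, eval_linForm, mul_eq_zero, mem_perp]
  by_cases hv : v = 0
  · simp [hv]
  · tauto

variable (h : IsHermField q F)
include h

namespace IsHermField

lemma isoCard_perp_le {a : Fin 5 → F} (ha : a ≠ 0) :
    isoCard q (perp q a) + q ^ 3 ≤ q ^ 7 + q ^ 4 := by
  by_cases hiso : herm q a a = 0
  · have := h.isoCard_perp_isotropic ha hiso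
    have : q ^ 3 ≤ q ^ 5 := Nat.pow_le_pow_right h.pos (by norm_num)
    omega
  · exact (h.isoCard_perp_not_isotropic hiso).le

lemma goodTriple_of_card {a b c : Fin 5 → F} (ha : a ≠ 0) (hb : b ≠ 0) (hc : herm q c c ≠ 0)
    (hac : perp q a ≠ perp q c) (hbc : perp q b ≠ perp q c) (hab : perp q a ≠ perp q b)
    (hN : (#(isoSet q (perp q a) ∪ isoSet q (perp q b) ∪ isoSet q (perp q c)) : ℤ) =
      3 * q ^ 7 - 2 * q ^ 5 + 3 * q ^ 4 - q ^ 3 - 2 * q ^ 2) : GoodTriple q a b c := by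
  have hq : (7 : ℤ) ≤ q := by exact_mod_cast h.le
  have hlt : (q : ℤ) ^ 3 < q ^ 5 := pow_lt_pow_right₀ (by linarith) (by norm_num)
  have hc0 : c ≠ 0 := by
    rintro rfl
    simp at hc
  have h1 := card_union_three (isoSet q (perp q a)) (isoSet q (perp q b)) (isoSet q (perp q c))
  rw [← isoSet_inf, ← isoSet_inf, ← isoSet_inf, card_isoSet, card_isoSet, card_isoSet, card_isoSet,
    card_isoSet] at h1
  have h2 := h.isoCard_perp_le ha
  have h3 := h.isoCard_perp_le hb
  have h4 := h.isoCard_perp_not_isotropic hc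
  have h5 := h.le_isoCard_perp_inf hc (ne_smul_of_perp_ne ha hac.symm)
  have h6 := h.le_isoCard_perp_inf hc (ne_smul_of_perp_ne hb hbc.symm)
  rw [inf_comm] at h5 h6
  zify at *
  have h7 : #(isoSet q (perp q a ⊓ perp q b) \ isoSet q (perp q c)) = 0 := by
    zify
    refine le_antisymm ?_ (by positivity)
    linarith
  have h7' : (#(isoSet q (perp q a ⊓ perp q b) \ isoSet q (perp q c)) : ℤ) = 0 := by
    exact_mod_cast h7
  have hsub : isoSet q (perp q a ⊓ perp q b) ⊆ isoSet q (perp q c) :=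
    Finset.sdiff_eq_empty_iff_subset.1 (Finset.card_eq_zero.1 h7)
  have haa : herm q a a ≠ 0 := fun hiso => by
    have := h.isoCard_perp_isotropic ha hiso
    zify at this
    linarith
  have hbb : herm q b b ≠ 0 := fun hiso => by
    have := h.isoCard_perp_isotropic hb hiso
    zify at this
    linarith
  have hle : perp q a ⊓ perp q b ≤ perp q c := by
    intro u hu
    by_contra hcu
    have h8 := h.vecCard_perp _ hu hcu
    rw [h.vecCard_perp_inf ha (ne_smul_of_perp_ne hb hab)] at h8
    have h9 := h.le_isoCard_perp_inf haa (ne_smul_of_perp_ne hb hab)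
    have h10 : isoCard q (perp q a ⊓ perp q b) ≤ vecCard (perp q a ⊓ perp q b ⊓ perp q c) := by
      refine Finset.card_le_card fun v hv => ?_
      have hv' := hsub hv
      simp only [mem_isoSet, Finset.mem_filter, Finset.mem_univ, true_and] at hv hv' ⊢
      exact ⟨hv.1, hv'.1⟩
    have h11 : vecCard (perp q a ⊓ perp q b ⊓ perp q c) = q ^ 4 := by
      refine Nat.eq_of_mul_eq_mul_left (pow_pos h.pos 2) ?_
      rw [← h8]; ring
    rw [h11] at h10
    zify at h9 h10
    obtain ⟨k, hk⟩ : ∃ k : ℕ, (q : ℤ) = k + 7 := ⟨q - 7, by have := h.le; omega⟩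
    have : (0 : ℤ) < q ^ 5 + q ^ 2 - q ^ 3 - q ^ 4 := by rw [hk]; ring_nf; positivity
    linarith
  have heq : perp q a ⊓ perp q b ⊓ perp q c = perp q a ⊓ perp q c := by
    rw [inf_eq_left.2 hle]
    refine eq_of_le_of_vecCard_le (le_inf inf_le_left hle) ?_
    rw [h.vecCard_perp_inf ha (ne_smul_of_perp_ne hb hab),
      h.vecCard_perp_inf ha (ne_smul_of_perp_ne hc0 hac)]
  refine ⟨hab, hac, hbc, haa, hbb, hc, ?_, ?_⟩
  · rw [heq, h.vecCard_perp_inf ha (ne_smul_of_perp_ne hc0 hac)]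
  · rw [heq]
    zify
    linarith

lemma perp_ne_of_card {a b c : Fin 5 → F} (ha : a ≠ 0) (hc : c ≠ 0)
    (hN : (#(isoSet q (perp q a) ∪ isoSet q (perp q b) ∪ isoSet q (perp q c)) : ℤ) =
      3 * q ^ 7 - 2 * q ^ 5 + 3 * q ^ 4 - q ^ 3 - 2 * q ^ 2) : perp q a ≠ perp q b := by
  intro hab
  rw [← hab, Finset.union_self] at hN
  have h1 := Finset.card_union_le (isoSet q (perp q a)) (isoSet q (perp q c))
  rw [card_isoSet, card_isoSet] at h1
  have h2 := h.isoCard_perp_le ha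
  have h3 := h.isoCard_perp_le hc
  obtain ⟨k, hk⟩ : ∃ k : ℕ, (q : ℤ) = k + 7 := ⟨q - 7, by have := h.le; omega⟩
  have : (0 : ℤ) < q ^ 7 - 2 * q ^ 5 + q ^ 4 + q ^ 3 - 2 * q ^ 2 := by rw [hk]; ring_nf; positivity
  zify at h1 h2 h3
  linarith

lemma card_eq_of_goodTriple {a b c : Fin 5 → F} (ha : a ≠ 0) (hb : b ≠ 0) (hc : c ≠ 0)
    (hg : GoodTriple q a b c) :
    (#(isoSet q (perp q a) ∪ isoSet q (perp q b) ∪ isoSet q (perp q c)) : ℤ) =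
      3 * q ^ 7 - 2 * q ^ 5 + 3 * q ^ 4 - q ^ 3 - 2 * q ^ 2 := by
  have key {x y : Fin 5 → F} (hx : x ≠ 0) (hy : y ≠ 0) (hxy : perp q x ≠ perp q y)
      (hle : perp q a ⊓ perp q b ⊓ perp q c ≤ perp q x ⊓ perp q y) :
      perp q a ⊓ perp q b ⊓ perp q c = perp q x ⊓ perp q y := by
    refine eq_of_le_of_vecCard_le hle ?_
    rw [hg.vecCard_eq, h.vecCard_perp_inf hx (ne_smul_of_perp_ne hy hxy)]
  have h12 := key ha hb hg.ne₁₂ inf_le_left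
  have h13 := key ha hc hg.ne₁₃ (inf_le_inf_right _ inf_le_left)
  have h23 := key hb hc hg.ne₂₃ (inf_le_inf_right _ inf_le_right)
  have h1 := card_union_three (isoSet q (perp q a)) (isoSet q (perp q b)) (isoSet q (perp q c))
  have h2 : isoSet q (perp q a ⊓ perp q b) \ isoSet q (perp q c) = ∅ := by
    rw [Finset.sdiff_eq_empty_iff_subset, ← h12, isoSet_inf]
    exact Finset.inter_subset_right
  rw [← isoSet_inf, ← isoSet_inf, ← isoSet_inf, ← h13, ← h23, h2, card_isoSet, card_isoSet,
    card_isoSet, card_isoSet, Finset.card_empty] at h1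
  have h3 := h.isoCard_perp_not_isotropic hg.herm₁
  have h4 := h.isoCard_perp_not_isotropic hg.herm₂
  have h5 := h.isoCard_perp_not_isotropic hg.herm₃
  have h6 := hg.isoCard_eq
  zify at h1 h3 h4 h5 h6
  linarith

lemma card_zerosOff_eq_iff {a b c : Fin 5 → F} (ha : a ≠ 0) (hb : b ≠ 0) (hc : c ≠ 0) :
    (#(zerosOff q (linForm q a * linForm q b * linForm q c) 1) : ℤ) =
      (q ^ 2 - 1) * (3 * (q ^ 5 + q ^ 2) + q ^ 3 + 1) ↔ GoodTriple q a b c := by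
  have h1 := card_zerosOff_linForm (q := q) a b c
  zify at h1
  constructor
  · intro hN
    have hU : (#(isoSet q (perp q a) ∪ isoSet q (perp q b) ∪ isoSet q (perp q c)) : ℤ) =
        3 * q ^ 7 - 2 * q ^ 5 + 3 * q ^ 4 - q ^ 3 - 2 * q ^ 2 := by linarith
    have hU₁ := hU
    rw [Finset.union_assoc, Finset.union_comm] at hU₁
    have hU₂ := hU₁
    rw [Finset.union_assoc, Finset.union_comm] at hU₂
    have hab := h.perp_ne_of_card ha hc hU
    have hbc := h.perp_ne_of_card hb ha hU₁
    have hca := h.perp_ne_of_card hc hb hU₂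
    by_cases hcc : herm q c c = 0
    · by_cases hbb : herm q b b = 0
      · by_cases haa : herm q a a = 0
        · exfalso
          have h2 := Finset.card_union_le (isoSet q (perp q a) ∪ isoSet q (perp q b))
            (isoSet q (perp q c))
          have h3 := Finset.card_union_le (isoSet q (perp q a)) (isoSet q (perp q b))
          rw [card_isoSet] at h2 h3
          rw [card_isoSet] at h3
          have h4 := h.isoCard_perp_isotropic ha haa
          have h5 := h.isoCard_perp_isotropic hb hbb
          have h6 := h.isoCard_perp_isotropic hc hcc
          obtain ⟨k, hk⟩ : ∃ k : ℕ, (q : ℤ) = k + 7 := ⟨q - 7, by have := h.le; omega⟩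
          have : (0 : ℤ) < q ^ 5 - q ^ 3 - 2 * q ^ 2 := by rw [hk]; ring_nf; positivity
          zify at h2 h3 h4 h5 h6
          linarith
        · exact (h.goodTriple_of_card hb hc haa hab.symm hca hbc hU₁).rotate.rotate
      · exact (h.goodTriple_of_card hc ha hbb hbc.symm hab hca hU₂).rotate
    · exact h.goodTriple_of_card ha hb hcc hca.symm hbc hab hU
  · intro hg
    have := h.card_eq_of_goodTriple ha hb hc hg
    linarith

end IsHermField

end Triple

section Points

variable {F : Type} [Field F] {q : ℕ}

/-- The set of points of projective space contained in a linear subspace. -/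
def points (U : Submodule F (Fin 5 → F)) : Set (P4 F) := {x | x.submodule ≤ U}

lemma mem_points {U : Submodule F (Fin 5 → F)} {x : P4 F} : x ∈ points U ↔ x.rep ∈ U := by
  rw [points, Set.mem_ofPred_eq, Projectivization.submodule_eq, Submodule.span_singleton_le_iff_mem]

lemma mk_mem_points {U : Submodule F (Fin 5 → F)} {v : Fin 5 → F} (hv : v ≠ 0) :
    Projectivization.mk F v hv ∈ points U ↔ v ∈ U := by
  rw [points, Set.mem_ofPred_eq, Projectivization.submodule_mk, Submodule.span_singleton_le_iff_mem]

lemma points_injective : Function.Injective (points : Submodule F (Fin 5 → F) → Set (P4 F)) := by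
  intro U W hUW
  ext v
  by_cases hv : v = 0
  · simp [hv]
  · rw [← mk_mem_points hv, hUW, mk_mem_points hv]

lemma points_inf (U W : Submodule F (Fin 5 → F)) : points (U ⊓ W) = points U ∩ points W := by
  ext x
  simp [mem_points]

lemma VG_linForm (a : Fin 5 → F) : VG (linForm q a) = points (perp q a) := by
  ext x
  rw [mem_points, mem_perp, ← eval_linForm]
  rfl

lemma mem_hermV3 {x : P4 F} : x ∈ hermV3 q F ↔ herm q x.rep x.rep = 0 := by
  simp only [hermV3, Set.mem_ofPred_eq, herm_apply, pow_succ]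

lemma tangentHyp_eq (x : P4 F) : tangentHyp q x = points (perp q x.rep) := by
  ext y
  rw [mem_points, mem_perp, herm_apply]
  rfl

lemma herm_smul_self_eq_zero_iff {c : F} (hc : c ≠ 0) (v : Fin 5 → F) :
    herm q (c • v) (c • v) = 0 ↔ herm q v v = 0 := by
  simp [herm_smul_left, hc]

variable [Fintype F]

lemma isPlane_points (h : IsHermField q F) {U : Submodule F (Fin 5 → F)} :
    IsPlane F (points U) ↔ vecCard U = q ^ 6 := by
  have hcard : vecCard U = q ^ (2 * Module.finrank F U) := by
    rw [pow_mul, ← h.card, ← Module.card_eq_pow_finrank (K := F) (V := U)]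
    simp [vecCard, Fintype.card_subtype]
  have h1 : IsPlane F (points U) ↔ Module.finrank F U = 3 := by
    constructor
    · rintro ⟨W, hW, hUW⟩
      rw [points_injective (a₁ := U) (a₂ := W) hUW, hW]
    · exact fun hU => ⟨U, hU, rfl⟩
  have := h.le
  rw [h1, hcard, Nat.pow_right_inj (by omega)]
  omega

lemma ncard_mul (h : IsHermField q F) {P : (Fin 5 → F) → Prop}
    (hP : ∀ (c : F) v, c ≠ 0 → (P (c • v) ↔ P v)) :
    ({x : P4 F | P x.rep}.ncard : ℤ) * (q ^ 2 - 1) = #{v : Fin 5 → F | v ≠ 0 ∧ P v} := by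
  have hu : (Fintype.card Fˣ : ℤ) = q ^ 2 - 1 := by
    rw [Fintype.card_units, h.card, Nat.cast_sub (Nat.one_le_pow _ _ h.pos)]
    simp
  have : Fintype (P4 F) := Fintype.ofFinite _
  rw [Set.ncard_eq_toFinset_card', ← hu, ← Finset.card_univ, ← Nat.cast_mul, ← Finset.card_product]
  congr 1
  refine Finset.card_bij (fun x _ => x.2 • x.1.rep) ?_ ?_ ?_
  · intro x hx
    simp only [Finset.mem_product, Set.mem_toFinset, Set.mem_ofPred_eq, Finset.mem_univ,
      and_true, Finset.mem_filter, true_and] at hx ⊢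
    exact ⟨(smul_ne_zero_iff_ne _).2 x.1.rep_nonzero, (hP _ _ x.2.ne_zero).2 hx⟩
  · rintro ⟨x, u⟩ - ⟨y, v⟩ - hxy
    simp only at hxy
    have h1 : x = y := by
      rw [← x.mk_rep, ← y.mk_rep, Projectivization.mk_eq_mk_iff]
      exact ⟨u⁻¹ * v, by rw [mul_smul, ← hxy, inv_smul_smul]⟩
    subst h1
    have h2 := smul_left_injective F x.rep_nonzero hxy
    rw [Units.ext h2]
  · intro v hv
    simp only [Finset.mem_filter, Finset.mem_univ, true_and] at hv
    obtain ⟨u, hu⟩ := Projectivization.exists_smul_eq_mk_rep F v hv.1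
    refine ⟨(Projectivization.mk F v hv.1, u⁻¹), ?_, by rw [← hu, inv_smul_smul]⟩
    simp only [Finset.mem_product, Set.mem_toFinset, Set.mem_ofPred_eq, Finset.mem_univ, and_true]
    rw [← hu]
    exact (hP _ _ u.ne_zero).2 hv.2

variable (h : IsHermField q F)
include h

namespace IsHermField

lemma ncard_VG_inter {G : MvPolynomial (Fin 5) F} {d : ℕ} (hG : G.IsHomogeneous d) :
    ((VG G ∩ hermV3 q F).ncard : ℤ) * (q ^ 2 - 1) = #(zerosOff q G 1) := by
  have h1 : VG G ∩ hermV3 q F = {x : P4 F | eval x.rep G = 0 ∧ herm q x.rep x.rep = 0} := by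
    ext x
    rw [Set.mem_inter_iff, mem_hermV3]
    rfl
  rw [h1, ncard_mul h (P := fun v => eval v G = 0 ∧ herm q v v = 0) fun c v hc => by
    rw [herm_smul_self_eq_zero_iff hc, eval_smul_of_isHomogeneous hG]
    simp [hc]]
  congr 2
  ext v
  simp only [zerosOff, isoOff, Finset.mem_filter, Finset.mem_univ, true_and, map_one, ne_eq,
    one_ne_zero, not_false_eq_true, and_true]
  tauto

lemma ncard_points_inter (U : Submodule F (Fin 5 → F)) :
    ((points U ∩ hermV3 q F).ncard : ℤ) * (q ^ 2 - 1) + 1 = isoCard q U := by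
  have h1 : points U ∩ hermV3 q F = {x : P4 F | x.rep ∈ U ∧ herm q x.rep x.rep = 0} := by
    ext x
    rw [Set.mem_inter_iff, mem_hermV3, mem_points]
    rfl
  rw [h1, ncard_mul h (P := fun v => v ∈ U ∧ herm q v v = 0) fun c v hc => by
    rw [herm_smul_self_eq_zero_iff hc, Submodule.smul_mem_iff _ hc]]
  norm_cast
  rw [← Finset.card_insert_of_notMem (a := 0) (by simp), isoCard]
  congr 1
  ext v
  by_cases hv : v = 0 <;> simp [hv]

lemma isTangentHyp_iff {a : Fin 5 → F} (ha : a ≠ 0) :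
    IsTangentHyp q (points (perp q a)) ↔ herm q a a = 0 := by
  constructor
  · rintro ⟨x, hx, hax⟩
    rw [tangentHyp_eq] at hax
    obtain ⟨c, rfl⟩ := h.exists_smul_eq x.rep_nonzero (points_injective hax).ge
    rw [mem_hermV3] at hx
    simp [herm_smul_left, hx]
  · intro hiso
    obtain ⟨u, hu⟩ := Projectivization.exists_smul_eq_mk_rep F a ha
    refine ⟨Projectivization.mk F a ha, ?_, ?_⟩
    · rw [mem_hermV3, ← hu, Units.smul_def, herm_smul_self_eq_zero_iff u.ne_zero, hiso]
    · rw [tangentHyp_eq, ← hu]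
      congr 1
      ext v
      simp [mem_perp, Units.smul_def, herm_smul_left]

lemma goodTriple_iff {a b c : Fin 5 → F} (ha : a ≠ 0) (hb : b ≠ 0) (hc : c ≠ 0) :
    GoodTriple q a b c ↔
      VG (linForm q a) ≠ VG (linForm q b) ∧ VG (linForm q a) ≠ VG (linForm q c) ∧
      VG (linForm q b) ≠ VG (linForm q c) ∧ ¬ IsTangentHyp q (VG (linForm q a)) ∧
      ¬ IsTangentHyp q (VG (linForm q b)) ∧ ¬ IsTangentHyp q (VG (linForm q c)) ∧
      IsPlane F (VG (linForm q a) ∩ VG (linForm q b) ∩ VG (linForm q c)) ∧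
      ((VG (linForm q a) ∩ VG (linForm q b) ∩ VG (linForm q c)) ∩ hermV3 q F).ncard =
        q ^ 3 + 1 := by
  have h1 := h.ncard_points_inter (perp q a ⊓ perp q b ⊓ perp q c)
  have hq : (0 : ℤ) < q ^ 2 - 1 := by
    have : (7 : ℤ) ≤ q := by exact_mod_cast h.le
    nlinarith
  have h2 : (points (perp q a ⊓ perp q b ⊓ perp q c) ∩ hermV3 q F).ncard = q ^ 3 + 1 ↔
      isoCard q (perp q a ⊓ perp q b ⊓ perp q c) + q ^ 3 = q ^ 5 + q ^ 2 := by
    zify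
    rw [← h1]
    constructor
    · intro h3
      rw [h3]
      ring
    · intro h3
      refine mul_right_cancel₀ hq.ne' ?_
      linarith
  simp only [VG_linForm, ← points_inf, isPlane_points h, h2, h.isTangentHyp_iff ha,
    h.isTangentHyp_iff hb, h.isTangentHyp_iff hc, ne_eq, points_injective.eq_iff]
  exact ⟨fun ⟨h1, h2, h3, h4, h5, h6, h7, h8⟩ => ⟨h1, h2, h3, h4, h5, h6, h7, h8⟩,
    fun ⟨h1, h2, h3, h4, h5, h6, h7, h8⟩ => ⟨h1, h2, h3, h4, h5, h6, h7, h8⟩⟩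

lemma linForm_zero : linForm q (0 : Fin 5 → F) = 0 := by
  simp [linForm, h.zero_pow]

end IsHermField

end Points

lemma ncard_VG_inter_hermV3_eq_iff {q : ℕ} (hq : IsPrimePow q) (hq7 : 7 ≤ q)
    {F : Type} [Field F] [Fintype F] (hF : Fintype.card F = q ^ 2)
    {G : MvPolynomial (Fin 5) F} (hG : G ≠ 0) (hGd : G.IsHomogeneous 3) :
    (VG G ∩ hermV3 q F).ncard = 3 * (q ^ 5 + q ^ 2) + q ^ 3 + 1 ↔
      ∃ (c : F) (L₁ L₂ L₃ : MvPolynomial (Fin 5) F), c ≠ 0 ∧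
        L₁.IsHomogeneous 1 ∧ L₂.IsHomogeneous 1 ∧ L₃.IsHomogeneous 1 ∧
        G = C c * (L₁ * L₂ * L₃) ∧
        VG L₁ ≠ VG L₂ ∧ VG L₁ ≠ VG L₃ ∧ VG L₂ ≠ VG L₃ ∧
        ¬ IsTangentHyp q (VG L₁) ∧ ¬ IsTangentHyp q (VG L₂) ∧ ¬ IsTangentHyp q (VG L₃) ∧
        IsPlane F (VG L₁ ∩ VG L₂ ∩ VG L₃) ∧
        ((VG L₁ ∩ VG L₂ ∩ VG L₃) ∩ hermV3 q F).ncard = q ^ 3 + 1 := by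
  have h := IsHermField.of_isPrimePow hq hq7 hF
  have h0 : (0 : ℤ) < q ^ 2 - 1 := by
    have : (7 : ℤ) ≤ q := by exact_mod_cast hq7
    nlinarith
  have hN : (VG G ∩ hermV3 q F).ncard = 3 * (q ^ 5 + q ^ 2) + q ^ 3 + 1 ↔
      (#(zerosOff q G 1) : ℤ) = (q ^ 2 - 1) * (3 * (q ^ 5 + q ^ 2) + q ^ 3 + 1) := by
    rw [← h.ncard_VG_inter hGd, mul_comm ((q : ℤ) ^ 2 - 1), mul_left_inj' h0.ne']
    norm_cast
  rw [hN]
  constructor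
  · intro hGN
    obtain ⟨a, b, c, ⟨ha, hb, hc⟩, rfl⟩ := h.exists_eq_linForm_mul_linForm_mul hGd hG hGN.ge
    exact ⟨1, linForm q a, linForm q b, linForm q c, one_ne_zero, isHomogeneous_linForm a,
      isHomogeneous_linForm b, isHomogeneous_linForm c, by rw [C_1, one_mul],
      (h.goodTriple_iff ha hb hc).1 ((h.card_zerosOff_eq_iff ha hb hc).1 hGN)⟩
  · rintro ⟨r, L₁, L₂, L₃, hr, hL₁, hL₂, hL₃, rfl, hgood⟩
    obtain ⟨a, rfl⟩ := h.exists_eq_linForm hL₁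
    obtain ⟨b, rfl⟩ := h.exists_eq_linForm hL₂
    obtain ⟨c, rfl⟩ := h.exists_eq_linForm hL₃
    have ha : a ≠ 0 := by
      rintro rfl
      simp [h.linForm_zero] at hG
    have hb : b ≠ 0 := by
      rintro rfl
      simp [h.linForm_zero] at hG
    have hc : c ≠ 0 := by
      rintro rfl
      simp [h.linForm_zero] at hG
    rw [← (h.card_zerosOff_eq_iff ha hb hc).2 ((h.goodTriple_iff ha hb hc).2 hgood)]
    congr 2
    ext v
    simp [zerosOff, isoOff, hr]

end HermitianCubic

theorem stmt1 (q : ℕ) (hq : IsPrimePow q) (hq7 : 7 ≤ q)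
    (F : Type) [Field F] [Fintype F] (hF : Fintype.card F = q ^ 2)
    (G : MvPolynomial (Fin 5) F) (hG : G ≠ 0) (hGd : G.IsHomogeneous 3) :
    (VG G ∩ hermV3 q F).ncard = 3 * (q ^ 5 + q ^ 2) + q ^ 3 + 1 ↔
      ∃ (c : F) (L₁ L₂ L₃ : MvPolynomial (Fin 5) F), c ≠ 0 ∧
        L₁.IsHomogeneous 1 ∧ L₂.IsHomogeneous 1 ∧ L₃.IsHomogeneous 1 ∧
        G = C c * (L₁ * L₂ * L₃) ∧
        VG L₁ ≠ VG L₂ ∧ VG L₁ ≠ VG L₃ ∧ VG L₂ ≠ VG L₃ ∧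
        ¬ IsTangentHyp q (VG L₁) ∧ ¬ IsTangentHyp q (VG L₂) ∧ ¬ IsTangentHyp q (VG L₃) ∧
        IsPlane F (VG L₁ ∩ VG L₂ ∩ VG L₃) ∧
        ((VG L₁ ∩ VG L₂ ∩ VG L₃) ∩ hermV3 q F).ncard = q ^ 3 + 1 :=
  HermitianCubic.ncard_VG_inter_hermV3_eq_iff hq hq7 hF hG hGd
end
end

section
/- Let q be a prime power, F a finite field with q^2 elements, and 1 ≤ d ≤ q. For every nonzero homogeneous polynomial G ∈ F[x_0,x_1,x_2,x_3] of degree d, |V(G)(F) ∩ V_2'| ≤ d(q+1)q^2 + 1. -/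
open MvPolynomial

noncomputable section

/-- The projective space ℙ³(F): 1-dimensional F-linear subspaces of F⁴. -/
abbrev P3 (F : Type) [Field F] := Projectivization F (Fin 4 → F)

/-- The degenerate Hermitian surface of rank 3:
    V₂' = {[x] ∈ ℙ³(F) : x₀^{q+1} + x₁^{q+1} + x₂^{q+1} = 0}. -/
def hermV2' (q : ℕ) (F : Type) [Field F] : Set (P3 F) :=
  {x | x.rep 0 ^ (q + 1) + x.rep 1 ^ (q + 1) + x.rep 2 ^ (q + 1) = 0}

/-- V(G)(F) = {[x] ∈ ℙ³(F) : G(x) = 0}, well defined for G homogeneous. -/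
def VG3 {F : Type} [Field F] (G : MvPolynomial (Fin 4) F) : Set (P3 F) :=
  {x | eval x.rep G = 0}

/-- A plane of ℙ³(F): points contained in a 3-dimensional F-linear subspace of F⁴. -/
def IsPlane3 (F : Type) [Field F] (S : Set (P3 F)) : Prop :=
  ∃ W : Submodule F (Fin 4 → F), Module.finrank F W = 3 ∧
    S = {x : P3 F | x.submodule ≤ W}

/-- The vertex P₀ = [0:0:0:1] of the cone V₂'. -/
def vertexP0 (F : Type) [Field F] : P3 F :=
  Projectivization.mk F ![0, 0, 0, 1] (by
    intro h
    have h3 := congrFun h 3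
    simp at h3)

namespace MvPolynomial

/-- The space of forms of degree `m` in `n + 1` variables has dimension `(n + m).choose m`. -/
lemma finrank_homogeneousSubmodule {K : Type*} [Field K] (n m : ℕ) :
    Module.finrank K (homogeneousSubmodule (Fin (n + 1)) K m) = (n + m).choose m := by
  have h : homogeneousSubmodule (Fin (n + 1)) K m =
      restrictSupport K ((Finset.univ.finsuppAntidiag m : Finset (Fin (n + 1) →₀ ℕ)) : Set _) := by
    rw [homogeneousSubmodule_eq_finsupp_supported]
    congr 1
    ext d
    simp [Finsupp.degree_eq_sum]
  rw [h, Module.finrank_eq_card_basis (basisRestrictSupport K _)]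
  simp [Finset.card_finsuppAntidiag_nat_eq_choose, add_right_comm]

instance {K : Type*} [Field K] {σ : Type*} [Finite σ] (m : ℕ) :
    FiniteDimensional K (homogeneousSubmodule σ K m) :=
  Module.Finite.iff_fg.2 (homogeneousSubmodule_fg σ K m)

/-- A homogeneous multiple of a homogeneous polynomial is a homogeneous multiple of it. -/
lemma IsHomogeneous.exists_eq_mul_of_dvd {R σ : Type*} [CommRing R]
    {p q : MvPolynomial σ R} {m n : ℕ} (hp : p.IsHomogeneous m) (hq : q.IsHomogeneous (m + n))
    (h : p ∣ q) : ∃ r : MvPolynomial σ R, r.IsHomogeneous n ∧ q = p * r := by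
  let := gradedAlgebra (σ := σ) (R := R)
  obtain ⟨r, rfl⟩ := h
  refine ⟨DirectSum.decompose (homogeneousSubmodule σ R) r n,
    SetLike.coe_mem (DirectSum.decompose (homogeneousSubmodule σ R) r n), ?_⟩
  rw [← DirectSum.coe_decompose_mul_add_of_left_mem (homogeneousSubmodule σ R) hp,
    DirectSum.decompose_of_mem_same _ hq]

/-- A linear form vanishing at one of two distinct points of projective space, but not at
the other. -/
lemma exists_linear_form_separating {K : Type*} [Field K] {n : ℕ}
    {a b : Projectivization K (Fin n → K)} (hab : a ≠ b) :
    ∃ f : MvPolynomial (Fin n) K, f.IsHomogeneous 1 ∧ eval a.rep f ≠ 0 ∧ eval b.rep f = 0 := by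
  obtain ⟨j, hj⟩ := Function.ne_iff.1 b.rep_nonzero
  obtain ⟨i, hi⟩ : ∃ i, a.rep i * b.rep j - a.rep j * b.rep i ≠ 0 := by
    by_contra! h
    refine hab ?_
    rw [← a.mk_rep, ← b.mk_rep, Projectivization.mk_eq_mk_iff']
    refine ⟨a.rep j / b.rep j, ?_⟩
    ext i
    simp only [Pi.smul_apply, smul_eq_mul, Pi.zero_apply] at hj ⊢
    field_simp
    linear_combination -h i
  refine ⟨C (b.rep j) * X i - C (b.rep i) * X j,
    (isHomogeneous_C_mul_X _ _).sub (isHomogeneous_C_mul_X _ _), ?_, ?_⟩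
  · simpa [mul_comm] using hi
  · simp [mul_comm]

/-- Finitely many points of projective space are separated by the forms of every degree that is at
least the number of points. -/
lemma exists_form_separating {K : Type*} [Field K] {n m : ℕ}
    (T : Finset (Projectivization K (Fin n → K))) (hm : T.card ≤ m)
    (a : Projectivization K (Fin n → K)) :
    ∃ f : MvPolynomial (Fin n) K, f.IsHomogeneous m ∧ eval a.rep f ≠ 0 ∧
      ∀ b ∈ T, b ≠ a → eval b.rep f = 0 := by
  classical
  obtain ⟨j, hj⟩ := Function.ne_iff.1 a.rep_nonzero
  choose! g hg hga hgb using fun (b : Projectivization K (Fin n → K)) (hb : b ≠ a) =>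
    exists_linear_form_separating hb.symm
  have hcard : (T.erase a).card ≤ m := (Finset.card_le_card (T.erase_subset a)).trans hm
  refine ⟨(∏ b ∈ T.erase a, g b) * X j ^ (m - (T.erase a).card), ?_, ?_, fun b hb hba => ?_⟩
  · have h := (IsHomogeneous.prod (T.erase a) g (fun _ => 1)
      fun b hb => hg b (Finset.ne_of_mem_erase hb)).mul
        (isHomogeneous_X_pow (R := K) j (m - (T.erase a).card))
    simpa [Nat.add_sub_cancel' hcard] using h
  · rw [map_mul, map_prod, map_pow, eval_X]
    exact mul_ne_zero (Finset.prod_ne_zero_iff.2 fun b hb => hga b (Finset.ne_of_mem_erase hb))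
      (pow_ne_zero _ hj)
  · rw [map_mul, map_prod, Finset.prod_eq_zero (Finset.mem_erase.2 ⟨hba, hb⟩) (hgb b hba), zero_mul]

lemma finrank_map_mulLeft {K σ : Type*} [Field K] {f : MvPolynomial σ K} (hf : f ≠ 0)
    (V : Submodule K (MvPolynomial σ K)) :
    Module.finrank K (V.map (LinearMap.mulLeft K f)) = Module.finrank K V :=
  (Submodule.equivMapOfInjective _ (mul_right_injective₀ hf) V).finrank_eq.symm

/-- The upper bound in Bézout's theorem: two plane curves of degrees `m` and `n` without a common
component have at most `m * n` rational points in common. -/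
theorem card_le_mul_of_isRelPrime {K : Type*} [Field K] {f g : MvPolynomial (Fin 3) K} {m n : ℕ}
    (hf : f.IsHomogeneous m) (hg : g.IsHomogeneous n) (hf0 : f ≠ 0) (hg0 : g ≠ 0)
    (hfg : IsRelPrime f g) (T : Finset (Projectivization K (Fin 3 → K)))
    (hT : ∀ a ∈ T, eval a.rep f = 0 ∧ eval a.rep g = 0) : T.card ≤ m * n := by
  classical
  let V := homogeneousSubmodule (Fin 3) K
  set k := T.card with hk
  let ev : MvPolynomial (Fin 3) K →ₗ[K] (T → K) :=
    LinearMap.pi fun a => (aeval (R := K) a.1.rep).toLinearMap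
  have hev : ∀ p a, ev p a = eval a.1.rep p := fun p a => by
    simp only [ev, LinearMap.pi_apply, AlgHom.toLinearMap_apply]
    rfl
  have hsurj : LinearMap.range (ev.domRestrict (V (m + n + k))) = ⊤ := by
    rw [LinearMap.range_eq_top]
    intro y
    choose p hp hpa hpb using exists_form_separating T (show T.card ≤ m + n + k by omega)
    refine ⟨⟨∑ a : T, (y a / eval a.1.rep (p a)) • p a,
      Submodule.sum_mem _ fun a _ => Submodule.smul_mem _ _ (hp a)⟩, ?_⟩
    ext b
    rw [LinearMap.domRestrict_apply, hev, map_sum, Finset.sum_eq_single b]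
    · simp [smul_eval, hpa]
    · intro a _ hab
      simp [smul_eval, hpb a b b.2 (fun h => hab (Subtype.ext h.symm))]
    · simp
  have hrank := LinearMap.finrank_range_add_finrank_ker (ev.domRestrict (V (m + n + k)))
  rw [hsurj, finrank_top, Module.finrank_fintype_fun_eq_card, Fintype.card_coe, ← hk] at hrank
  let A := (V (n + k)).map (LinearMap.mulLeft K f)
  let B := (V (m + k)).map (LinearMap.mulLeft K g)
  have hle : A ⊔ B ≤
      (LinearMap.ker (ev.domRestrict (V (m + n + k)))).map (V (m + n + k)).subtype := by
    refine sup_le ?_ ?_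
    · rintro _ ⟨p, hp, rfl⟩
      refine ⟨⟨f * p, ?_⟩, LinearMap.mem_ker.2 ?_, rfl⟩
      · have := hf.mul (show p.IsHomogeneous _ from hp)
        rwa [← add_assoc] at this
      · ext a
        simp [hev, (hT a a.2).1]
    · rintro _ ⟨p, hp, rfl⟩
      refine ⟨⟨g * p, ?_⟩, LinearMap.mem_ker.2 ?_, rfl⟩
      · have := hg.mul (show p.IsHomogeneous _ from hp)
        rwa [← add_assoc, add_comm n m] at this
      · ext a
        simp [hev, (hT a a.2).2]
  have hinf : A ⊓ B ≤ (V k).map (LinearMap.mulLeft K (f * g)) := by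
    rintro _ ⟨⟨p, hp, rfl⟩, ⟨r, hr, hpr⟩⟩
    simp only [LinearMap.mulLeft_apply] at hpr
    obtain ⟨s, hs, rfl⟩ := hf.exists_eq_mul_of_dvd hr
      (hfg.dvd_of_dvd_mul_left (hpr ▸ dvd_mul_right f p))
    exact ⟨s, hs, by simp only [LinearMap.mulLeft_apply]; rw [← hpr]; ring⟩
  have h1 := Submodule.finrank_mono hle
  have h2 := Submodule.finrank_mono hinf
  have h3 := Submodule.finrank_sup_add_finrank_inf_eq A B
  rw [Submodule.finrank_map_subtype_eq] at h1
  rw [finrank_map_mulLeft (mul_ne_zero hf0 hg0)] at h2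
  rw [finrank_map_mulLeft hf0, finrank_map_mulLeft hg0] at h3
  have hdim : ∀ j, (Module.finrank K (V j) : ℚ) = (j + 2) * (j + 1) / 2 := fun j => by
    rw [finrank_homogeneousSubmodule 2 j, ← Nat.choose_symm_add, add_comm 2 j, Nat.cast_choose_two]
    push_cast
    ring
  have e1 := hdim k
  have e2 := hdim (n + k)
  have e3 := hdim (m + k)
  have e4 := hdim (m + n + k)
  qify at h1 h2 h3 hrank ⊢
  push_cast at e1 e2 e3 e4
  rw [e4] at hrank
  rw [e1] at h2
  rw [e2, e3] at h3
  nlinarith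

end MvPolynomial

namespace MvPolynomial

/-- The Fermat curve of degree `n` is irreducible over every field containing an `n`-th root of
`-1` in which `n` is nonzero. -/
lemma irreducible_sum_X_pow {K : Type*} [Field K] {n : ℕ} (hn : (n : K) ≠ 0) {a : K}
    (ha : a ^ n = -1) :
    Irreducible (X 0 ^ n + X 1 ^ n + X 2 ^ n : MvPolynomial (Fin 3) K) := by
  have hn0 : n ≠ 0 := by rintro rfl; simp at hn
  have ha0 : a ≠ 0 := by rintro rfl; simp [hn0] at ha
  have heq : finSuccEquiv K 2 (X 0 ^ n + X 1 ^ n + X 2 ^ n) =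
      Polynomial.X ^ n + Polynomial.C (X 0 ^ n + X 1 ^ n) := by
    rw [show (1 : Fin 3) = Fin.succ 0 from rfl, show (2 : Fin 3) = Fin.succ 1 from rfl]
    simp only [map_add, map_pow, finSuccEquiv_X_zero, finSuccEquiv_X_succ, add_assoc]
  rw [← MulEquiv.irreducible_iff (finSuccEquiv K 2), heq]
  set P : Ideal (MvPolynomial (Fin 2) K) := RingHom.ker (eval ![a, 1]) with hP
  have hmonic := Polynomial.monic_X_pow_add_C (X 0 ^ n + X 1 ^ n : MvPolynomial (Fin 2) K) hn0
  have hdeg : (Polynomial.X ^ n + Polynomial.C (X 0 ^ n + X 1 ^ n : MvPolynomial (Fin 2) K)).degree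
      = (n : WithBot ℕ) := Polynomial.degree_X_pow_add_C (Nat.pos_of_ne_zero hn0) _
  have hderiv : ∀ p ∈ P ^ 2, pderiv 0 p ∈ P := by
    intro p hp
    rw [sq] at hp
    refine Submodule.mul_induction_on hp (fun r hr s hs => ?_) fun r s hr hs => ?_
    · rw [Derivation.leibniz]
      exact P.add_mem (P.mul_mem_right _ hr) (P.mul_mem_right _ hs)
    · rw [map_add]
      exact P.add_mem hr hs
  refine Polynomial.irreducible_of_eisenstein_criterion (P := P) (RingHom.ker_isPrime _) ?_ ?_ ?_ ?_
    hmonic.isPrimitive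
  · rw [hmonic.leadingCoeff]
    simp [hP]
  · intro i hi
    rw [hdeg, Nat.cast_lt] at hi
    rw [Polynomial.coeff_add, Polynomial.coeff_X_pow, if_neg hi.ne, zero_add, Polynomial.coeff_C]
    split_ifs
    · simp [hP, ha]
    · exact P.zero_mem
  · rw [hdeg]
    exact_mod_cast Nat.pos_of_ne_zero hn0
  · rw [Polynomial.coeff_add, Polynomial.coeff_X_pow, if_neg hn0.symm, zero_add,
      Polynomial.coeff_C_zero]
    intro h
    have := hderiv _ h
    simp [hP, pderiv_X, hn, ha0] at this

end MvPolynomial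

namespace FiniteField

variable {F : Type*} [Field F] [Fintype F] {q : ℕ}

lemma cast_eq_zero_of_card_eq_sq (hF : Fintype.card F = q ^ 2) : (q : F) = 0 := by
  have h := cast_card_eq_zero F
  rw [hF] at h
  simpa using h

lemma add_pow_of_card_eq_sq (hF : Fintype.card F = q ^ 2) (x y : F) :
    (x + y) ^ q = x ^ q + y ^ q := by
  obtain ⟨p, _⟩ := CharP.exists F
  obtain ⟨n, hp, hn⟩ := FiniteField.card F p
  obtain ⟨k, -, rfl⟩ := (Nat.dvd_prime_pow hp).1 (hn ▸ hF ▸ dvd_pow_self q two_ne_zero)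
  have := ExpChar.prime (R := F) hp
  exact add_pow_expChar_pow x y p k

lemma one_lt_of_card_eq_sq (hF : Fintype.card F = q ^ 2) : 1 < q := by
  have := Fintype.one_lt_card (α := F)
  rw [hF] at this
  exact (one_lt_pow_iff two_ne_zero).1 this

/-- `-1` is a norm from `F` to its subfield with `q` elements. -/
lemma exists_pow_eq_neg_one (hF : Fintype.card F = q ^ 2) : ∃ a : F, a ^ (q + 1) = -1 := by
  have hq := one_lt_of_card_eq_sq hF
  have hpow : (-1 : Fˣ) ^ (q - 1) = 1 := by
    rcases Nat.even_or_odd q with h | h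
    · have h2 : ringChar F = 2 := by
        rw [even_card_iff_char_two, hF, ← Nat.even_iff]
        exact h.pow_of_ne_zero two_ne_zero
      have := ringChar.of_eq h2
      have h1 : (-1 : Fˣ) = 1 := Units.ext (by simpa using CharTwo.neg_eq (1 : F))
      rw [h1, one_pow]
    · exact (Nat.Odd.sub_odd h odd_one).neg_one_pow
  obtain ⟨g, hg⟩ := IsCyclic.exists_monoid_generator (α := Fˣ)
  obtain ⟨k, hk⟩ := hg (-1)
  have hk : g ^ k = -1 := hk
  have horder : orderOf g = (q - 1) * (q + 1) := by
    rw [orderOf_eq_card_of_forall_mem_zpowers fun x => mem_powers_iff_mem_zpowers.1 (hg x),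
      Nat.card_units, Nat.card_eq_fintype_card, hF, mul_comm, ← Nat.sq_sub_sq, one_pow]
  rw [← hk, ← pow_mul, ← orderOf_dvd_iff_pow_eq_one, horder, mul_comm k] at hpow
  obtain ⟨j, rfl⟩ := Nat.dvd_of_mul_dvd_mul_left (by omega) hpow
  refine ⟨(g ^ j : Fˣ), ?_⟩
  rw [← Units.val_pow_eq_pow_val, ← pow_mul, mul_comm, hk]
  simp

end FiniteField

section Hermitian

open FiniteField

variable {F : Type*} [Field F] {q : ℕ}

lemma eval_smul_of_isHomogeneous {σ : Type*} {p : MvPolynomial σ F} {n : ℕ}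
    (hp : p.IsHomogeneous n) (c : F) (v : σ → F) : eval (c • v) p = c ^ n * eval v p := by
  rw [eval_eq, eval_eq, Finset.mul_sum]
  refine Finset.sum_congr rfl fun d hd => ?_
  simp only [Pi.smul_apply, smul_eq_mul, mul_pow, Finset.prod_mul_distrib]
  rw [Finset.prod_pow_eq_pow_sum, ← hp.degree_eq_sum_deg_support hd]
  ring

/-- The form defining the Hermitian curve. -/
def hermitianForm (q : ℕ) (F : Type*) [Field F] : MvPolynomial (Fin 3) F :=
  X 0 ^ (q + 1) + X 1 ^ (q + 1) + X 2 ^ (q + 1)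

lemma isHomogeneous_hermitianForm : (hermitianForm q F).IsHomogeneous (q + 1) :=
  ((isHomogeneous_X_pow _ _).add (isHomogeneous_X_pow _ _)).add (isHomogeneous_X_pow _ _)

lemma eval_hermitianForm (v : Fin 3 → F) :
    eval v (hermitianForm q F) = v 0 ^ (q + 1) + v 1 ^ (q + 1) + v 2 ^ (q + 1) := by
  simp [hermitianForm]

variable [Fintype F]

lemma irreducible_hermitianForm (hF : Fintype.card F = q ^ 2) :
    Irreducible (hermitianForm q F) := by
  obtain ⟨a, ha⟩ := exists_pow_eq_neg_one hF
  exact irreducible_sum_X_pow (by simp [cast_eq_zero_of_card_eq_sq hF]) ha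

lemma isRelPrime_hermitianForm (hF : Fintype.card F = q ^ 2) {g : MvPolynomial (Fin 3) F} {e : ℕ}
    (hg : g.IsHomogeneous e) (hg0 : g ≠ 0) (he : e ≤ q) : IsRelPrime (hermitianForm q F) g := by
  have hirr := irreducible_hermitianForm hF
  rw [hirr.isRelPrime_iff_not_dvd]
  intro h
  have := totalDegree_le_of_dvd_of_isDomain h hg0
  rw [isHomogeneous_hermitianForm.totalDegree hirr.ne_zero, hg.totalDegree hg0] at this
  omega

/-- The number of rational points of the Hermitian curve: each of the `q ^ 2` lines through the
rational point `[a : 1 : 0]` other than the tangent meets it in at most `q` further points. -/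
lemma card_hermitian_curve_le (hF : Fintype.card F = q ^ 2)
    (Z : Finset (Projectivization F (Fin 3 → F)))
    (hZ : ∀ p ∈ Z, eval p.rep (hermitianForm q F) = 0) : Z.card ≤ q ^ 2 * q + 1 := by
  classical
  obtain ⟨a, ha⟩ := exists_pow_eq_neg_one hF
  have hq := one_lt_of_card_eq_sq hF
  have ha0 : a ≠ 0 := by rintro rfl; simp at ha
  let f : F → Polynomial F := fun s => Polynomial.C (a ^ q) * Polynomial.X ^ q +
    Polynomial.C a * Polynomial.X + Polynomial.C (1 + s ^ (q + 1))
  have hcoeff : ∀ s, (f s).coeff q = a ^ q := fun s => by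
    have h1 : 1 ≠ q := hq.ne
    have h0 : q ≠ 0 := by omega
    simp only [f, Polynomial.coeff_add, Polynomial.coeff_C_mul, Polynomial.coeff_X_pow_self,
      Polynomial.coeff_X_of_ne_one h1.symm, Polynomial.coeff_C_of_ne_zero h0, mul_one, mul_zero,
      add_zero]
  have hf0 : ∀ s, f s ≠ 0 := fun s h => by
    have := hcoeff s
    rw [h, Polynomial.coeff_zero] at this
    exact pow_ne_zero q ha0 this.symm
  have hdeg : ∀ s, (f s).natDegree ≤ q := fun s => by
    simp only [f]
    compute_degree
    omega
  have hne : ∀ s y : F, ![1 + a * y, y, s] ≠ 0 := fun s y h => by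
    have h0 := congrFun h 0
    have h1 := congrFun h 1
    simp only [Matrix.cons_val_zero, Matrix.cons_val_one, Pi.zero_apply] at h0 h1
    simp [h1] at h0
  have hne' : ![a, 1, 0] ≠ 0 := fun h => by simpa using congrFun h 1
  have hsub : Z ⊆ insert (Projectivization.mk F ![a, 1, 0] hne')
      ((Finset.univ.sigma fun s : F => (f s).roots.toFinset).image
        fun t => Projectivization.mk F ![1 + a * t.2, t.2, t.1] (hne t.1 t.2)) := by
    intro p hp
    have hv := hZ p hp
    rw [eval_hermitianForm] at hv
    rw [Finset.mem_insert, Finset.mem_image]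
    obtain hu | hu := eq_or_ne (p.rep 0 - a * p.rep 1) 0
    · left
      have hx : p.rep 0 = a * p.rep 1 := sub_eq_zero.1 hu
      have hz : p.rep 2 = 0 := by
        refine eq_zero_of_pow_eq_zero (n := q + 1) ?_
        rw [hx, mul_pow, ha] at hv
        linear_combination hv
      rw [← p.mk_rep, Projectivization.mk_eq_mk_iff']
      refine ⟨p.rep 1, ?_⟩
      ext i
      fin_cases i <;> simp [hx, hz, mul_comm]
    · right
      set u := p.rep 0 - a * p.rep 1 with hu'
      refine ⟨⟨p.rep 2 / u, p.rep 1 / u⟩, ?_, ?_⟩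
      · simp only [Finset.mem_sigma, Finset.mem_univ, true_and, Multiset.mem_toFinset,
          Polynomial.mem_roots (hf0 _), Polynomial.IsRoot.def]
        have hfrob := add_pow_of_card_eq_sq hF 1 (a * (p.rep 1 / u))
        have h1 : 1 + a * (p.rep 1 / u) = p.rep 0 / u := by
          field_simp
          rw [hu']
          ring
        have h2 : (p.rep 0 / u) ^ (q + 1) + (p.rep 1 / u) ^ (q + 1) + (p.rep 2 / u) ^ (q + 1)
            = 0 := by
          rw [div_pow, div_pow, div_pow, ← add_div, ← add_div, hv, zero_div]
        rw [← h1, pow_succ (1 + _), hfrob, one_pow] at h2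
        simp only [f, Polynomial.eval_add, Polynomial.eval_mul, Polynomial.eval_C,
          Polynomial.eval_pow, Polynomial.eval_X]
        rw [mul_pow] at h2
        linear_combination h2 - (p.rep 1 / u) ^ (q + 1) * ha
      · conv_rhs => rw [← p.mk_rep]
        rw [Projectivization.mk_eq_mk_iff']
        refine ⟨u⁻¹, ?_⟩
        ext i
        fin_cases i
        · simp
          field_simp
          rw [hu']
          ring
        · simp [div_eq_inv_mul]
        · simp [div_eq_inv_mul]
  refine (Finset.card_le_card hsub).trans ((Finset.card_insert_le _ _).trans
    (Nat.succ_le_succ (Finset.card_image_le.trans ?_)))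
  rw [Finset.card_sigma, ← hF]
  exact Finset.sum_le_card_nsmul _ _ _ fun s _ =>
    (Multiset.toFinset_card_le _).trans ((f s).card_roots'.trans (hdeg s))

end Hermitian

theorem stmt2 (q : ℕ) (hq : IsPrimePow q)
    (F : Type) [Field F] [Fintype F] (hF : Fintype.card F = q ^ 2)
    (d : ℕ) (hd1 : 1 ≤ d) (hdq : d ≤ q)
    (G : MvPolynomial (Fin 4) F) (hG : G ≠ 0) (hGd : G.IsHomogeneous d) :
    (VG3 G ∩ hermV2' q F).ncard ≤ d * (q + 1) * q ^ 2 + 1 := by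
  classical
  have : Fintype (Projectivization F (Fin 3 → F)) := Fintype.ofFinite _
  have hrot : ∀ (t : F) (v : Fin 3 → F),
      (Fin.cons t v : Fin 4 → F) ∘ finRotate 4 = ![v 0, v 1, v 2, t] := by
    intro t v
    ext i
    fin_cases i <;> rfl
  set Φ := finSuccEquiv F 3 (rename (finRotate 4) G) with hΦ
  have hG'd : (rename (finRotate 4) G).IsHomogeneous d := hGd.rename_isHomogeneous
  have hΦ0 : Φ ≠ 0 := by
    rw [hΦ, EmbeddingLike.map_ne_zero_iff]
    exact (map_ne_zero_iff _ (rename_injective _ (finRotate 4).injective)).2 hG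
  have heval : ∀ (t : F) (v : Fin 3 → F),
      (Φ.map (eval v)).eval t = eval ![v 0, v 1, v 2, t] G := by
    intro t v
    rw [hΦ, ← eval_eq_eval_mv_eval', eval_rename, hrot]
  have hm : Φ.natDegree ≤ d := by
    rw [hΦ, natDegree_finSuccEquiv]
    exact (degreeOf_le_totalDegree _ _).trans hG'd.totalDegree_le
  set m := Φ.natDegree
  have hlead : Φ.leadingCoeff.IsHomogeneous (d - m) :=
    hG'd.finSuccEquiv_coeff_isHomogeneous m (d - m) (Nat.add_sub_cancel' hm)
  have hlead0 : Φ.leadingCoeff ≠ 0 := Polynomial.leadingCoeff_ne_zero.2 hΦ0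
  let Z : Finset (Projectivization F (Fin 3 → F)) :=
    Finset.univ.filter fun p => eval p.rep (hermitianForm q F) = 0
  let T : Projectivization F (Fin 3 → F) → Finset F := fun p =>
    Finset.univ.filter fun t => (Φ.map (eval p.rep)).eval t = 0
  have hT : ∀ p, (T p).card ≤ if eval p.rep Φ.leadingCoeff = 0 then q ^ 2 else m := by
    intro p
    split_ifs with h
    · exact hF ▸ Finset.card_le_univ _
    · have hp0 : Φ.map (eval p.rep) ≠ 0 := fun h0 => h (by
        rw [Polynomial.leadingCoeff, ← Polynomial.coeff_map, h0, Polynomial.coeff_zero])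
      have hsub : T p ⊆ (Φ.map (eval p.rep)).roots.toFinset := fun t ht => by
        rw [Multiset.mem_toFinset, Polynomial.mem_roots hp0]
        exact (Finset.mem_filter.1 ht).2
      exact (Finset.card_le_card hsub).trans ((Multiset.toFinset_card_le _).trans
        ((Polynomial.card_roots' _).trans Polynomial.natDegree_map_le))
  have hne : ∀ (p : Projectivization F (Fin 3 → F)) (t : F),
      ![p.rep 0, p.rep 1, p.rep 2, t] ≠ 0 := by
    intro p t h
    refine p.rep_nonzero (funext fun i => ?_)
    fin_cases i
    · exact congrFun h 0
    · exact congrFun h 1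
    · exact congrFun h 2
  have hsub : VG3 G ∩ hermV2' q F ⊆ ↑(insert (vertexP0 F) ((Z.sigma T).image
      fun x => Projectivization.mk F ![x.1.rep 0, x.1.rep 1, x.1.rep 2, x.2] (hne x.1 x.2))) := by
    rintro x ⟨hxG, hxH⟩
    simp only [VG3, hermV2', Set.mem_ofPred_eq] at hxG hxH
    rw [Finset.mem_coe, Finset.mem_insert, Finset.mem_image]
    by_cases hw : ![x.rep 0, x.rep 1, x.rep 2] = 0
    · left
      have h0 : x.rep 0 = 0 := congrFun hw 0
      have h1 : x.rep 1 = 0 := congrFun hw 1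
      have h2 : x.rep 2 = 0 := congrFun hw 2
      rw [← x.mk_rep, vertexP0, Projectivization.mk_eq_mk_iff']
      refine ⟨x.rep 3, ?_⟩
      ext i
      fin_cases i <;> simp [h0, h1, h2]
    · right
      obtain ⟨c, hc⟩ := Projectivization.exists_smul_eq_mk_rep F _ hw
      set p := Projectivization.mk F _ hw
      have hc' : p.rep = (c : F) • ![x.rep 0, x.rep 1, x.rep 2] := hc.symm
      have hrep : ![p.rep 0, p.rep 1, p.rep 2, (c : F) * x.rep 3] = (c : F) • x.rep := by
        ext i
        fin_cases i <;> simp [hc']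
      refine ⟨⟨p, c * x.rep 3⟩, ?_, ?_⟩
      · simp only [Finset.mem_sigma, Z, T, Finset.mem_filter, Finset.mem_univ, true_and]
        constructor
        · rw [hc', eval_smul_of_isHomogeneous isHomogeneous_hermitianForm, eval_hermitianForm]
          exact mul_eq_zero_of_right _ hxH
        · rw [heval, hrep, eval_smul_of_isHomogeneous hGd, hxG, mul_zero]
      · conv_rhs => rw [← x.mk_rep]
        rw [Projectivization.mk_eq_mk_iff']
        exact ⟨c, hrep.symm⟩
  have hcard : (VG3 G ∩ hermV2' q F).ncard ≤ ∑ p ∈ Z, (T p).card + 1 := by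
    refine (Set.ncard_le_ncard hsub (Finset.finite_toSet _)).trans ?_
    rw [Set.ncard_coe_finset, ← Finset.card_sigma]
    exact (Finset.card_insert_le _ _).trans (Nat.succ_le_succ Finset.card_image_le)
  have hsum := Finset.sum_le_sum fun p (_ : p ∈ Z) => hT p
  rw [Finset.sum_ite, Finset.sum_const, Finset.sum_const, smul_eq_mul, smul_eq_mul] at hsum
  have hsplit := Finset.card_filter_add_card_filter_not (s := Z)
    (fun p => eval p.rep Φ.leadingCoeff = 0)
  have hZ := card_hermitian_curve_le hF Z fun p hp => (Finset.mem_filter.1 hp).2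
  have hk := card_le_mul_of_isRelPrime isHomogeneous_hermitianForm hlead
    (irreducible_hermitianForm hF).ne_zero hlead0
    (isRelPrime_hermitianForm hF hlead hlead0 ((Nat.sub_le _ _).trans hdq))
    (Z.filter fun p => eval p.rep Φ.leadingCoeff = 0)
    fun p hp => ⟨(Finset.mem_filter.1 (Finset.mem_filter.1 hp).1).2, (Finset.mem_filter.1 hp).2⟩
  generalize (Z.filter fun p => eval p.rep Φ.leadingCoeff = 0).card = k at *
  generalize (Z.filter fun p => ¬ eval p.rep Φ.leadingCoeff = 0).card = l at *
  obtain ⟨r, rfl⟩ := Nat.exists_eq_add_of_le hm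
  rw [Nat.add_sub_cancel_left] at hk
  refine hcard.trans (Nat.succ_le_succ (hsum.trans ?_))
  have hkl : k + l ≤ q ^ 2 * (q + 1) := by nlinarith
  have hmq : m ≤ q ^ 2 := by nlinarith
  zify at hk hkl hmq ⊢
  nlinarith [mul_nonneg (sub_nonneg.2 hmq) (sub_nonneg.2 hk),
    mul_nonneg (Nat.cast_nonneg (α := ℤ) m) (sub_nonneg.2 hkl),
    (by positivity : (0 : ℤ) ≤ (q + 1) * r * m)]
end
end

section
/- Let q be a prime power, F a finite field with q^2 elements, 1 ≤ d ≤ q, and G ∈ F[x_0,x_1,x_2,x_3] a nonzero homogeneous polynomial of degree d. If Π is a plane of ℙ^3(F) such that the vertex P_0 = [0:0:0:1] does not lie on Π and Π is not contained in V(G)(F), then |V(G)(F) ∩ V_2' ∩ Π| ≤ d(q+1). -/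
open MvPolynomial

noncomputable section

theorem finrank_homogeneousSubmodule_fin_three (K : Type*) [Field K] (m : ℕ) :
    Module.finrank K (homogeneousSubmodule (Fin 3) K m) = (m + 2).choose 2 := by
  have h : homogeneousSubmodule (Fin 3) K m
      = restrictSupport K ((Finset.univ.finsuppAntidiag m : Finset (Fin 3 →₀ ℕ)) : Set _) := by
    rw [homogeneousSubmodule_eq_finsupp_supported, restrictSupport]
    congr 1
    ext d
    simp [Finset.mem_finsuppAntidiag, Finsupp.degree_eq_sum]
  rw [h, Module.finrank_eq_card_basis (basisRestrictSupport K _)]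
  simp only [Finset.coe_sort_coe, Fintype.card_coe]
  rw [Finset.card_finsuppAntidiag_nat_eq_choose, Finset.card_univ, Fintype.card_fin,
    show 3 + m - 1 = m + 2 by omega, ← Nat.choose_symm_add]

/-- A cofactor of a homogeneous polynomial in a homogeneous multiple can be chosen homogeneous. -/
theorem exists_homogeneous_cofactor {σ K : Type*} [Field K] {f b : MvPolynomial σ K} {e n : ℕ}
    (hf : f.IsHomogeneous e) (hb : b.IsHomogeneous (n + e)) (h : f ∣ b) :
    ∃ c : MvPolynomial σ K, c.IsHomogeneous n ∧ b = f * c := by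
  obtain ⟨c, rfl⟩ := h
  let _ := gradedAlgebra (σ := σ) (R := K)
  refine ⟨DirectSum.decompose (homogeneousSubmodule σ K) c n,
    (DirectSum.decompose (homogeneousSubmodule σ K) c n).2, ?_⟩
  rw [← DirectSum.coe_decompose_mul_add_of_left_mem (homogeneousSubmodule σ K) hf, add_comm e n,
    DirectSum.decompose_of_mem_same (homogeneousSubmodule σ K) hb]

/-- Two non-proportional vectors are separated by a linear form. -/
theorem exists_linear_form_separating {σ K : Type*} [Field K] {v w : σ → K} (hw : w ≠ 0)
    (h : ∀ c : K, v ≠ c • w) :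
    ∃ l : MvPolynomial σ K, l.IsHomogeneous 1 ∧ eval w l = 0 ∧ eval v l ≠ 0 := by
  obtain ⟨b, hb⟩ := Function.ne_iff.mp hw
  obtain ⟨a, ha⟩ := Function.ne_iff.mp (h (v b / w b))
  refine ⟨C (w b) * X a - C (w a) * X b,
    (isHomogeneous_C_mul_X _ _).sub (isHomogeneous_C_mul_X _ _), by simp; ring, ?_⟩
  simp only [Pi.zero_apply, Pi.smul_apply, smul_eq_mul, ne_eq] at hb ha
  simp only [map_sub, map_mul, eval_C, eval_X]
  contrapose! ha
  field_simp
  linear_combination ha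

/-- Homogeneous polynomials of large degree interpolate arbitrary values at finitely many
pairwise distinct projective points. -/
theorem exists_homogeneous_eval_eq {σ K ι : Type*} [Field K] [Fintype ι] (v : ι → σ → K)
    (hv : ∀ i, v i ≠ 0) (hvv : ∀ i j, i ≠ j → ∀ c : K, v i ≠ c • v j) {m : ℕ}
    (hm : Fintype.card ι ≤ m) (y : ι → K) :
    ∃ p : MvPolynomial σ K, p.IsHomogeneous m ∧ ∀ i, eval (v i) p = y i := by
  classical
  have key : ∀ i, ∃ p : MvPolynomial σ K, p.IsHomogeneous m ∧ eval (v i) p ≠ 0 ∧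
      ∀ j, j ≠ i → eval (v j) p = 0 := by
    intro i
    have hl : ∀ j, ∃ l : MvPolynomial σ K, l.IsHomogeneous 1 ∧ (j ≠ i → eval (v j) l = 0) ∧
        eval (v i) l ≠ 0 := by
      intro j
      by_cases hj : j = i
      · obtain ⟨a, ha⟩ := Function.ne_iff.mp (hv i)
        exact ⟨X a, isHomogeneous_X _ _, fun h => absurd hj h, by simpa using ha⟩
      · obtain ⟨l, h1, h2, h3⟩ := exists_linear_form_separating (hv j) (hvv i j (Ne.symm hj))
        exact ⟨l, h1, fun _ => h2, h3⟩
    choose l h1 h2 h3 using hl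
    refine ⟨(∏ j, l j) * l i ^ (m - Fintype.card ι), ?_, ?_, ?_⟩
    · convert (IsHomogeneous.prod Finset.univ l (fun _ => 1) fun j _ => h1 j).mul
        ((h1 i).pow (m - Fintype.card ι)) using 1
      simp; omega
    · simp [map_prod, Finset.prod_ne_zero_iff, h3]
    · intro j hj
      rw [map_mul, map_prod, Finset.prod_eq_zero (Finset.mem_univ j) (h2 j hj), zero_mul]
  choose p h1 h2 h3 using key
  refine ⟨∑ i, C (y i / eval (v i) (p i)) * p i,
    IsHomogeneous.sum _ _ _ fun i _ => (h1 i).C_mul _, fun i => ?_⟩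
  rw [map_sum, Finset.sum_eq_single i]
  · simp [h2 i]
  · intro j _ hj
    simp [h3 j i hj.symm]
  · simp

theorem choose_two_second_difference (n d e : ℕ) :
    (n + d + e + 2).choose 2 + (n + 2).choose 2
      = (n + d + 2).choose 2 + (n + e + 2).choose 2 + d * e := by
  have h : ∀ k : ℕ, ((k.choose 2 : ℕ) : ℚ) = k * (k - 1) / 2 := fun k => Nat.cast_choose_two ℚ k
  have : (((n + d + e + 2).choose 2 + (n + 2).choose 2 : ℕ) : ℚ)
      = ((n + d + 2).choose 2 + (n + e + 2).choose 2 + d * e : ℕ) := by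
    push_cast [h]
    ring
  exact_mod_cast this

/-- Bézout's inequality for the rational points of two plane projective curves, one of which is
integral and not contained in the other. -/
theorem card_common_zeros_le {K ι : Type*} [Field K] [Fintype ι]
    {f g : MvPolynomial (Fin 3) K} {d e : ℕ} (hf : f.IsHomogeneous e) (hg : g.IsHomogeneous d)
    (hfp : Prime f) (hfg : ¬ f ∣ g) (v : ι → Fin 3 → K)
    (hv : ∀ i, v i ≠ 0) (hvv : ∀ i j, i ≠ j → ∀ c : K, v i ≠ c • v j)
    (hvf : ∀ i, eval (v i) f = 0) (hvg : ∀ i, eval (v i) g = 0) :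
    Fintype.card ι ≤ d * e := by
  set n := Fintype.card ι with hn
  let S := homogeneousSubmodule (Fin 3) K
  have hS : ∀ m, Module.Finite K (S m) := fun m =>
    Module.Finite.iff_fg.mpr (homogeneousSubmodule_fg (Fin 3) K m)
  have hg0 : g ≠ 0 := fun h => hfg (h ▸ dvd_zero f)
  have hinj : ∀ {p : MvPolynomial (Fin 3) K}, p ≠ 0 →
      Function.Injective (LinearMap.mulLeft K p) := fun hp => mul_right_injective₀ hp
  have hdim : ∀ {p : MvPolynomial (Fin 3) K}, p ≠ 0 → ∀ m,
      Module.finrank K ((S m).map (LinearMap.mulLeft K p)) = (m + 2).choose 2 := fun hp m => by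
    rw [← (Submodule.equivMapOfInjective _ (hinj hp) (S m)).finrank_eq,
      finrank_homogeneousSubmodule_fin_three]
  let A := (S (n + d)).map (LinearMap.mulLeft K f)
  let B := (S (n + e)).map (LinearMap.mulLeft K g)
  have hAS : A ≤ S (n + d + e) := by
    rintro _ ⟨a, ha, rfl⟩
    have := hf.mul ha
    rwa [add_comm] at this
  have hBS : B ≤ S (n + d + e) := by
    rintro _ ⟨a, ha, rfl⟩
    have := hg.mul ha
    rwa [show d + (n + e) = n + d + e by ring] at this
  have hinf : A ⊓ B ≤ (S n).map (LinearMap.mulLeft K (g * f)) := by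
    rintro x ⟨⟨a, ha, rfl⟩, ⟨b, hb, hab⟩⟩
    simp only [LinearMap.mulLeft_apply] at hab
    have hdvd : f ∣ b := (hfp.dvd_or_dvd (hab ▸ dvd_mul_right f a)).resolve_left hfg
    obtain ⟨c, hc, rfl⟩ := exists_homogeneous_cofactor hf hb hdvd
    exact ⟨c, hc, by simp [← hab]⟩
  let L : MvPolynomial (Fin 3) K →ₗ[K] (ι → K) :=
    LinearMap.pi fun i => (aeval (v i)).toLinearMap
  have hL : ∀ p i, L p i = eval (v i) p := fun p i => by simp [L, aeval_eq_eval]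
  have hABL : A ⊔ B ≤ LinearMap.ker L := by
    refine sup_le ?_ ?_ <;> rintro _ ⟨a, -, rfl⟩ <;> ext i <;> simp [hL, hvf, hvg]
  let L' := L.domRestrict (S (n + d + e))
  have hsurj : Function.Surjective L' := fun y => by
    obtain ⟨p, hp, hpy⟩ := exists_homogeneous_eval_eq v hv hvv (m := n + d + e) (by omega) y
    refine ⟨⟨p, hp⟩, ?_⟩
    ext i
    rw [LinearMap.domRestrict_apply, hL, hpy]
  have hker : Module.finrank K (A ⊔ B : Submodule K _) ≤ Module.finrank K (LinearMap.ker L') := by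
    rw [← (Submodule.comapSubtypeEquivOfLe (sup_le hAS hBS)).finrank_eq]
    exact Submodule.finrank_mono fun x hx => hABL hx
  have hrank := L'.finrank_range_add_finrank_ker
  rw [LinearMap.range_eq_top.mpr hsurj, finrank_top, Module.finrank_fintype_fun_eq_card,
    finrank_homogeneousSubmodule_fin_three] at hrank
  have hsup := Submodule.finrank_sup_add_finrank_inf_eq A B
  have hle := Submodule.finrank_mono hinf
  rw [hdim (mul_ne_zero hg0 hfp.ne_zero)] at hle
  rw [hdim hfp.ne_zero, hdim hg0] at hsup
  have := choose_two_second_difference n d e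
  omega

/-- The polynomial `x₀ ^ (q + 1) + x₁ ^ (q + 1)` has a simple prime factor when `q = 0` in the field. -/
theorem exists_prime_dvd_not_sq_dvd {K : Type*} [Field K] {q : ℕ} (hq : (q : K) = 0) :
    ∃ p : MvPolynomial (Fin 2) K, Prime p ∧ p ∣ X 0 ^ (q + 1) + X 1 ^ (q + 1) ∧
      ¬ p ^ 2 ∣ X 0 ^ (q + 1) + X 1 ^ (q + 1) := by
  set u : MvPolynomial (Fin 2) K := X 0 ^ (q + 1) + X 1 ^ (q + 1) with hu
  have hq' : (q : MvPolynomial (Fin 2) K) = 0 := by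
    rw [← map_natCast (C : K →+* MvPolynomial (Fin 2) K), hq, map_zero]
  have hunit : ¬ IsUnit u := fun h => by
    have := h.map (eval (0 : Fin 2 → K))
    simp [hu] at this
  have hu0 : u ≠ 0 := fun h => by
    have := congrArg (eval ![(1 : K), 0]) h
    simp [hu] at this
  obtain ⟨p, hp, hpu⟩ := WfDvdMonoid.exists_irreducible_factor hunit hu0
  refine ⟨p, hp.prime, hpu, ?_⟩
  rintro ⟨h, hh⟩
  have hpd : ∀ i, p ∣ pderiv i u := fun i => by
    rw [hh, pow_two, mul_assoc, Derivation.leibniz]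
    simp only [smul_eq_mul, Derivation.leibniz]
    exact dvd_add (dvd_mul_right _ _) (by rw [mul_assoc]; exact dvd_mul_of_dvd_left (dvd_refl p) _)
  have h0 : p ∣ X 0 := by
    have := hpd 0
    simp [hu, Derivation.leibniz_pow, hq'] at this
    exact hp.prime.dvd_of_dvd_pow this
  have h1 : p ∣ X 1 := by
    have := hpd 1
    simp [hu, Derivation.leibniz_pow, hq'] at this
    exact hp.prime.dvd_of_dvd_pow this
  have h2 : (X 0 : MvPolynomial (Fin 2) K) ∣ X 1 :=
    ((hp.associated_of_dvd (X_prime (i := (0 : Fin 2))).irreducible h0).dvd_iff_dvd_left).mp h1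
  rw [X_dvd_X] at h2
  simp at h2

/-- The Fermat polynomial of degree `q + 1` is prime when `q = 0` in the base field. -/
theorem prime_fermat {K : Type*} [Field K] {q : ℕ} (hq : (q : K) = 0) :
    Prime (X 0 ^ (q + 1) + X 1 ^ (q + 1) + X 2 ^ (q + 1) : MvPolynomial (Fin 3) K) := by
  obtain ⟨p, hp, hpu, hpu2⟩ := exists_prime_dvd_not_sq_dvd hq
  set u : MvPolynomial (Fin 2) K := X 0 ^ (q + 1) + X 1 ^ (q + 1) with hu
  rw [← MulEquiv.prime_iff (finSuccEquiv K 2).toMulEquiv]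
  have hmap : (finSuccEquiv K 2).toMulEquiv (X 0 ^ (q + 1) + X 1 ^ (q + 1) + X 2 ^ (q + 1))
      = Polynomial.X ^ (q + 1) + Polynomial.C u := by
    have h1 : finSuccEquiv K 2 (X 1) = Polynomial.C (X 0) := finSuccEquiv_X_succ (j := 0)
    have h2 : finSuccEquiv K 2 (X 2) = Polynomial.C (X 1) := finSuccEquiv_X_succ (j := 1)
    change finSuccEquiv K 2 _ = _
    simp only [map_add, map_pow, finSuccEquiv_X_zero, h1, h2, hu, add_assoc]
  rw [hmap]
  have hmonic : (Polynomial.X ^ (q + 1) + Polynomial.C u).Monic :=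
    Polynomial.monic_X_pow_add_C u q.succ_ne_zero
  have hdeg := Polynomial.degree_X_pow_add_C q.succ_pos u
  refine (Polynomial.irreducible_of_eisenstein_criterion (P := Ideal.span {p})
    ((Ideal.span_singleton_prime hp.ne_zero).mpr hp) ?_ ?_ ?_ ?_ hmonic.isPrimitive).prime
  · rw [hmonic.leadingCoeff, Ideal.mem_span_singleton]
    exact fun h => hp.not_isUnit (isUnit_of_dvd_one h)
  · intro n hn
    rw [hdeg, Nat.cast_lt] at hn
    rw [Polynomial.coeff_add, Polynomial.coeff_X_pow, if_neg hn.ne, zero_add,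
      Polynomial.coeff_C, Ideal.mem_span_singleton]
    split_ifs
    exacts [hpu, dvd_zero p]
  · rw [hdeg]
    exact_mod_cast q.succ_pos
  · simpa [Ideal.span_singleton_pow, Ideal.mem_span_singleton] using hpu2

/-- A hyperplane not containing the last coordinate vector is the graph of a linear form. -/
theorem exists_graph_of_finrank_eq_three {F : Type*} [Field F] (W : Submodule F (Fin 4 → F))
    (hW : Module.finrank F W = 3) (h : ![0, 0, 0, 1] ∉ W) :
    ∃ a : Fin 3 → F, ∀ u ∈ W, u 3 = a 0 * u 0 + a 1 * u 1 + a 2 * u 2 := by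
  have hlt : W < ⊤ := lt_top_iff_ne_top.mpr fun hT => h (hT ▸ Submodule.mem_top)
  obtain ⟨φ, hφ, hle⟩ := W.exists_le_ker_of_lt_top hlt
  have hker : W = LinearMap.ker φ := by
    refine Submodule.eq_of_le_of_finrank_eq hle ?_
    have := Module.Dual.finrank_ker_add_one_of_ne_zero hφ
    rw [Module.finrank_fin_fun] at this
    omega
  have hexp : ∀ u, φ u = u 0 * φ ![1, 0, 0, 0] + u 1 * φ ![0, 1, 0, 0] + u 2 * φ ![0, 0, 1, 0]
      + u 3 * φ ![0, 0, 0, 1] := fun u => by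
    simp only [← smul_eq_mul, ← map_smul, ← map_add]
    congr 1
    ext i
    fin_cases i <;> simp
  rw [hker, LinearMap.mem_ker] at h
  refine ⟨fun i => -(![φ ![1, 0, 0, 0], φ ![0, 1, 0, 0], φ ![0, 0, 1, 0]] i) / φ ![0, 0, 0, 1],
    fun u hu => ?_⟩
  have hu0 := hexp u
  rw [LinearMap.mem_ker.mp (hle hu)] at hu0
  simp
  field_simp
  linear_combination -hu0

theorem stmt3 (q : ℕ) (hq : IsPrimePow q)
    (F : Type) [Field F] [Fintype F] (hF : Fintype.card F = q ^ 2)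
    (d : ℕ) (hd1 : 1 ≤ d) (hdq : d ≤ q)
    (G : MvPolynomial (Fin 4) F) (hG : G ≠ 0) (hGd : G.IsHomogeneous d)
    (Pl : Set (P3 F)) (hPl : IsPlane3 F Pl)
    (hP0 : vertexP0 F ∉ Pl) (hPlG : ¬ Pl ⊆ VG3 G) :
    (VG3 G ∩ hermV2' q F ∩ Pl).ncard ≤ d * (q + 1) := by
  obtain ⟨W, hW, rfl⟩ := hPl
  have hq0 : (q : F) = 0 := by
    have := Nat.cast_card_eq_zero F
    rw [hF] at this
    exact pow_eq_zero_iff two_ne_zero |>.mp (by exact_mod_cast this)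
  obtain ⟨a, ha⟩ := exists_graph_of_finrank_eq_three W hW fun h => hP0 <| by
    simpa [vertexP0, Projectivization.submodule_mk, Submodule.span_singleton_le_iff_mem] using h
  have hrep : ∀ x : P3 F, x.submodule ≤ W →
      x.rep 3 = a 0 * x.rep 0 + a 1 * x.rep 1 + a 2 * x.rep 2 := fun x hx => ha _ <| hx <| by
    rw [Projectivization.submodule_eq]
    exact Submodule.mem_span_singleton_self _
  let g : MvPolynomial (Fin 3) F :=
    aeval ![X 0, X 1, X 2, C (a 0) * X 0 + C (a 1) * X 1 + C (a 2) * X 2] G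
  have hg : g.IsHomogeneous d := by
    rw [← one_mul d]
    refine hGd.aeval _ fun i => ?_
    fin_cases i
    · exact isHomogeneous_X _ _
    · exact isHomogeneous_X _ _
    · exact isHomogeneous_X _ _
    · exact ((isHomogeneous_C_mul_X _ _).add (isHomogeneous_C_mul_X _ _)).add
        (isHomogeneous_C_mul_X _ _)
  let v : P3 F → Fin 3 → F := fun x => ![x.rep 0, x.rep 1, x.rep 2]
  have hgG : ∀ x : P3 F, x.submodule ≤ W → eval (v x) g = eval x.rep G := fun x hx => by
    have : (aeval (v x)).comp (aeval (R := F) ![X 0, X 1, X 2,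
        C (a 0) * X 0 + C (a 1) * X 1 + C (a 2) * X 2]) = aeval (R := F) x.rep := by
      ext i
      fin_cases i <;> simp [v, hrep x hx]
    simpa [g, aeval_eq_eval] using DFunLike.congr_fun this G
  have hg0 : g ≠ 0 := fun h => hPlG fun x hx => by
    rw [VG3, Set.mem_ofPred_eq, ← hgG x hx, h, map_zero]
  have hfp := prime_fermat hq0
  have hf : (X 0 ^ (q + 1) + X 1 ^ (q + 1) + X 2 ^ (q + 1) :
      MvPolynomial (Fin 3) F).IsHomogeneous (q + 1) :=
    ((isHomogeneous_X_pow _ _).add (isHomogeneous_X_pow _ _)).add (isHomogeneous_X_pow _ _)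
  have hfg : ¬ (X 0 ^ (q + 1) + X 1 ^ (q + 1) + X 2 ^ (q + 1) :
      MvPolynomial (Fin 3) F) ∣ g := fun h => by
    have := totalDegree_le_of_dvd_of_isDomain h hg0
    rw [hf.totalDegree hfp.ne_zero, hg.totalDegree hg0] at this
    omega
  have hsmul : ∀ x y : P3 F, x.submodule ≤ W → y.submodule ≤ W → ∀ c : F, v x = c • v y →
      x.rep = c • y.rep := fun x y hx hy c h => by
    have h0 : x.rep 0 = c * y.rep 0 := congrFun h 0
    have h1 : x.rep 1 = c * y.rep 1 := congrFun h 1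
    have h2 : x.rep 2 = c * y.rep 2 := congrFun h 2
    ext i
    fin_cases i
    · exact h0
    · exact h1
    · exact h2
    · change x.rep 3 = c * y.rep 3
      rw [hrep x hx, hrep y hy, h0, h1, h2]
      ring
  have := Fintype.ofFinite ↥(VG3 G ∩ hermV2' q F ∩ {x : P3 F | x.submodule ≤ W})
  rw [← Nat.card_coe_set_eq, Nat.card_eq_fintype_card]
  refine card_common_zeros_le hf hg hfp hfg (fun x => v x.1) (fun x h => ?_) (fun x y hxy c h => ?_)
    (fun x => ?_) (fun x => ?_)
  · refine x.1.rep_nonzero ?_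
    rw [hsmul x.1 x.1 x.2.2 x.2.2 0 (by rw [h, smul_zero]), zero_smul]
  · refine hxy (Subtype.ext ?_)
    rw [← x.1.mk_rep, ← y.1.mk_rep, Projectivization.mk_eq_mk_iff']
    exact ⟨c, (hsmul _ _ x.2.2 y.2.2 c h).symm⟩
  · have : _ = _ := x.2.1.2
    simpa [v] using this
  · rw [hgG _ x.2.2]
    exact x.2.1.1
end
end
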